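/- ∫_0^1 √2 [2E(√t) - K(√t)]³ / (t(1-t))^{1/4} dt = 48 π⁶ / Γ(1/4)⁸, where E and K are the complete elliptic integrals of the second and first kind; equivalently ∫_{-1}^1 [P_{1/2}(x)]³ (1-x²)^{-1/4} dx = 384 π³ / Γ(1/4)⁸, using P_{1/2}(1-2t) = (2/π)[2E(√t) - K(√t)]. -/

import Mathlib

open Real MeasureTheory intervalIntegral Complex

/-- Complete elliptic integral of the first kind. -/
noncomputable def ellipticK (k : ℝ) : ℝ :=
  ∫ θ in (0:ℝ)..(π/2), (1 - k ^ 2 * Real.sin θ ^ 2) ^ (-(1/2 : ℝ))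

/-- Complete elliptic integral of the second kind. -/
noncomputable def ellipticE (k : ℝ) : ℝ :=
  ∫ θ in (0:ℝ)..(π/2), (1 - k ^ 2 * Real.sin θ ^ 2) ^ ((1/2 : ℝ))

/-- Legendre function of the first kind of degree ν : P_ν(1-2z) = ₂F₁(-ν, ν+1; 1; z). -/
noncomputable def legendreP (ν : ℂ) (x : ℂ) : ℂ :=
  ordinaryHypergeometric (-ν) (ν + 1) 1 ((1 - x) / 2)

local notation "UU" => Set.Ioo (0:ℝ) 1

lemma cov_image {f f' : ℝ → ℝ} {a b : ℝ} (hab : a < b) (hc : ContinuousOn f (Set.Icc a b))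
    (hd : ∀ x ∈ Set.Ioo a b, HasDerivAt f (f' x) x) (hp : ∀ x ∈ Set.Ioo a b, 0 < f' x) :
    f '' Set.Ioo a b = Set.Ioo (f a) (f b) ∧ MonotoneOn f (Set.Ioo a b) := by
  have hs : StrictMonoOn f (Set.Icc a b) := by
    apply strictMonoOn_of_deriv_pos (convex_Icc a b) hc
    intro x hx
    rw [interior_Icc] at hx
    rw [(hd x hx).deriv]; exact hp x hx
  refine ⟨?_, (hs.mono Set.Ioo_subset_Icc_self).monotoneOn⟩
  apply Set.Subset.antisymm
  · rintro _ ⟨x, hx, rfl⟩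
    exact ⟨hs (Set.left_mem_Icc.2 hab.le) (Set.Ioo_subset_Icc_self hx) hx.1,
      hs (Set.Ioo_subset_Icc_self hx) (Set.right_mem_Icc.2 hab.le) hx.2⟩
  · exact intermediate_value_Ioo hab.le hc

lemma cov {f f' : ℝ → ℝ} {a b : ℝ} (hab : a < b) (hc : ContinuousOn f (Set.Icc a b))
    (hd : ∀ x ∈ Set.Ioo a b, HasDerivAt f (f' x) x) (hp : ∀ x ∈ Set.Ioo a b, 0 < f' x)
    (g : ℝ → ℝ) :
    ∫ y in Set.Ioo (f a) (f b), g y = ∫ x in Set.Ioo a b, f' x * g (f x) := by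
  obtain ⟨h1, h2⟩ := cov_image hab hc hd hp
  rw [← h1, integral_image_eq_integral_deriv_smul_of_monotoneOn measurableSet_Ioo
    (fun x hx => (hd x hx).hasDerivWithinAt) h2]
  rfl

lemma cov_int {f f' : ℝ → ℝ} {a b : ℝ} (hab : a < b) (hc : ContinuousOn f (Set.Icc a b))
    (hd : ∀ x ∈ Set.Ioo a b, HasDerivAt f (f' x) x) (hp : ∀ x ∈ Set.Ioo a b, 0 < f' x)
    (g : ℝ → ℝ) :
    IntegrableOn g (Set.Ioo (f a) (f b)) ↔ IntegrableOn (fun x => f' x * g (f x)) (Set.Ioo a b) := by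
  obtain ⟨h1, h2⟩ := cov_image hab hc hd hp
  rw [← h1, integrableOn_image_iff_integrableOn_deriv_smul_of_monotoneOn measurableSet_Ioo
    (fun x hx => (hd x hx).hasDerivWithinAt) h2]
  rfl

lemma cov_refl (g : ℝ → ℝ) : ∫ y in UU, g y = ∫ x in UU, g (1 - x) := by
  have := integral_image_eq_integral_deriv_smul_of_antitoneOn (s := UU) (f := fun x => 1 - x)
    (f' := fun _ => -1) measurableSet_Ioo
    (fun x _ => by simpa using ((hasDerivAt_id x).const_sub 1).hasDerivWithinAt)
    (fun x _ y _ h => by simp only; linarith) g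
  simpa using this

lemma cov_refl_int (g : ℝ → ℝ) : IntegrableOn g UU ↔ IntegrableOn (fun x => g (1 - x)) UU := by
  have := integrableOn_image_iff_integrableOn_deriv_smul_of_antitoneOn (s := UU)
    (f := fun x => 1 - x)
    (f' := fun _ => -1) measurableSet_Ioo
    (fun x _ => by simpa using ((hasDerivAt_id x).const_sub 1).hasDerivWithinAt)
    (fun x _ y _ h => by simp only; linarith) g
  simpa using this

/-- the Beta integral on the open unit interval -/
lemma beta_intg {a b : ℝ} (ha : 0 < a) (hb : 0 < b) :
    IntegrableOn (fun t : ℝ => t ^ (a - 1) * (1 - t) ^ (b - 1)) UU := by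
  have h := Complex.betaIntegral_convergent (u := a) (v := b) (by simpa) (by simpa)
  rw [intervalIntegrable_iff_integrableOn_Ioo_of_le zero_le_one] at h
  have h2 := h.re
  refine IntegrableOn.congr_fun h2 ?_ measurableSet_Ioo
  intro t ht
  have h1 : (0:ℝ) ≤ t := ht.1.le
  have h3 : (0:ℝ) ≤ 1 - t := by linarith [ht.2]
  simp only [RCLike.re_to_complex]
  rw [show ((a:ℂ) - 1) = ((a - 1 : ℝ) : ℂ) by push_cast; rfl,
    show ((b:ℂ) - 1) = ((b - 1 : ℝ) : ℂ) by push_cast; rfl,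
    show ((1:ℂ) - t) = ((1 - t : ℝ) : ℂ) by push_cast; rfl,
    ← Complex.ofReal_cpow h1, ← Complex.ofReal_cpow h3, ← Complex.ofReal_mul, Complex.ofReal_re]

lemma beta_val {a b : ℝ} (ha : 0 < a) (hb : 0 < b) :
    ∫ t in UU, (t : ℝ) ^ (a - 1) * (1 - t) ^ (b - 1)
      = Real.Gamma a * Real.Gamma b / Real.Gamma (a + b) := by
  have h := ProbabilityTheory.beta_eq_betaIntegralReal a b ha hb
  rw [ProbabilityTheory.beta] at h
  rw [h, Complex.betaIntegral, intervalIntegral.integral_of_le zero_le_one,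
    integral_Ioc_eq_integral_Ioo]
  have : ∫ t in UU, (((t : ℝ) ^ (a - 1) * (1 - t) ^ (b - 1) : ℝ) : ℂ)
      = ∫ x in UU, (x:ℂ) ^ ((a:ℂ) - 1) * (1 - (x:ℂ)) ^ ((b:ℂ) - 1) := by
    refine setIntegral_congr_fun measurableSet_Ioo ?_
    intro t ht
    have h1 : (0:ℝ) ≤ t := ht.1.le
    have h3 : (0:ℝ) ≤ 1 - t := by linarith [ht.2]
    simp only
    rw [show ((a:ℂ) - 1) = ((a - 1 : ℝ) : ℂ) by push_cast; rfl,
      show ((b:ℂ) - 1) = ((b - 1 : ℝ) : ℂ) by push_cast; rfl,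
      show ((1:ℂ) - t) = ((1 - t : ℝ) : ℂ) by push_cast; rfl,
      ← Complex.ofReal_cpow h1, ← Complex.ofReal_cpow h3, ← Complex.ofReal_mul]
  rw [← this, integral_complex_ofReal, Complex.ofReal_re]

/-- Fubini with a product bound -/
lemma swap_dom {F : ℝ → ℝ → ℝ} (hF : Measurable (Function.uncurry F)) {A B : ℝ → ℝ}
    (hA : IntegrableOn A UU) (hB : IntegrableOn B UU)
    (hb : ∀ x ∈ UU, ∀ y ∈ UU, |F x y| ≤ A x * B y) :
    ∫ x in UU, ∫ y in UU, F x y = ∫ y in UU, ∫ x in UU, F x y := by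
  apply integral_integral_swap
  have h := hA.mul_prod hB
  refine h.mono' hF.aestronglyMeasurable ?_
  rw [Measure.prod_restrict]
  refine (ae_restrict_iff' (measurableSet_Ioo.prod measurableSet_Ioo)).2 (Filter.Eventually.of_forall ?_)
  rintro ⟨x, y⟩ ⟨hx, hy⟩
  exact hb x hx y hy

lemma trunc_int {u : ℝ} (hu : u ∈ UU) (φ : ℝ → ℝ) :
    (IntegrableOn (fun y => if y < u then φ y else 0) UU ↔
      IntegrableOn (fun τ => u * φ (u * τ)) UU) ∧
    ∫ y in UU, (if y < u then φ y else 0) = ∫ τ in UU, u * φ (u * τ) := by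
  have e : (fun y => if y < u then φ y else 0) = Set.indicator (Set.Iio u) φ := by
    ext y; simp [Set.indicator]
  have hcov := cov (f := fun τ => u * τ) (f' := fun _ => u) (a := 0) (b := 1) zero_lt_one
    (by fun_prop) (fun x _ => by simpa using (hasDerivAt_id x).const_mul u) (fun _ _ => hu.1) φ
  have hcov2 := cov_int (f := fun τ => u * τ) (f' := fun _ => u) (a := 0) (b := 1) zero_lt_one
    (by fun_prop) (fun x _ => by simpa using (hasDerivAt_id x).const_mul u) (fun _ _ => hu.1) φ
  simp only [mul_zero, mul_one] at hcov hcov2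
  have hs : UU ∩ Set.Iio u = Set.Ioo 0 u := by
    ext y; simp only [Set.mem_inter_iff, Set.mem_Ioo, Set.mem_Iio]
    exact ⟨fun h => ⟨h.1.1, h.2⟩, fun h => ⟨⟨h.1, h.2.trans hu.2⟩, h.2⟩⟩
  rw [e, setIntegral_indicator measurableSet_Iio, hs, ← hcov, ← hcov2]
  refine ⟨?_, rfl⟩
  rw [← hs, Set.inter_comm, ← integrableOn_indicator_iff measurableSet_Iio]

/-- Mellin convolution -/
noncomputable def mconv (m k : ℝ → ℝ) (y : ℝ) : ℝ :=
  ∫ u in UU, if y < u then m u * k (y / u) / u else 0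

lemma mellin_conv0 {m k g : ℝ → ℝ} (hm : Measurable m) (hk : Measurable k) (hg : Measurable g)
    {A B : ℝ → ℝ} (IA : IntegrableOn A UU) (IB : IntegrableOn B UU)
    (hgb' : ∀ u ∈ UU, ∀ τ ∈ UU, |m u * (k τ * g (u * τ))| ≤ A u * B τ) :
    IntegrableOn (fun y => g y * mconv m k y) UU ∧
    ∫ y in UU, g y * mconv m k y = ∫ u in UU, m u * ∫ τ in UU, k τ * g (u * τ) := by
  set F : ℝ → ℝ → ℝ := fun u y => if y < u then g y * (m u * k (y / u) / u) else 0 with hF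
  have mF : Measurable (Function.uncurry F) := by
    apply Measurable.ite (measurableSet_lt measurable_snd measurable_fst)
    · fun_prop
    · fun_prop
  have e1 : ∀ u ∈ UU, ∀ τ : ℝ, u * (g (u * τ) * (m u * k (u * τ / u) / u))
      = m u * (k τ * g (u * τ)) := by
    intro u hu τ
    have : u ≠ 0 := hu.1.ne'
    rw [mul_div_cancel_left₀ _ this]
    field_simp
  have hint : ∀ u ∈ UU, IntegrableOn (fun τ => m u * (k τ * g (u * τ))) UU := by
    intro u hu
    refine Integrable.mono' (IB.const_mul (A u))
      (by fun_prop) ?_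
    refine (ae_restrict_iff' measurableSet_Ioo).2 (Filter.Eventually.of_forall ?_)
    intro τ hτ
    exact hgb' u hu τ hτ
  have hF1 : ∀ u ∈ UU, IntegrableOn (fun y => F u y) UU := by
    intro u hu
    rw [hF]
    apply (trunc_int hu (fun y => g y * (m u * k (y / u) / u))).1.2
    refine (hint u hu).congr_fun ?_ measurableSet_Ioo
    intro τ _
    exact (e1 u hu τ).symm
  have hI : Integrable (Function.uncurry F) ((volume.restrict UU).prod (volume.restrict UU)) := by
    rw [integrable_prod_iff mF.aestronglyMeasurable]
    refine ⟨(ae_restrict_iff' measurableSet_Ioo).2 (Filter.Eventually.of_forall hF1), ?_⟩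
    refine Integrable.mono' (g := fun u => A u * ∫ τ in UU, B τ) (IA.mul_const _) ?_ ?_
    · exact (mF.norm.stronglyMeasurable.integral_prod_right (f := fun x y => ‖F x y‖)).aestronglyMeasurable
    · refine (ae_restrict_iff' measurableSet_Ioo).2 (Filter.Eventually.of_forall ?_)
      intro u hu
      have h5 : ∀ y, ‖Function.uncurry F (u, y)‖ =
          if y < u then |g y * (m u * k (y / u) / u)| else 0 := by
        intro y; simp only [Function.uncurry, hF]; split_ifs <;> simp [-abs_mul, -norm_mul, -norm_div, Real.norm_eq_abs]
      simp_rw [h5]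
      rw [(trunc_int hu (fun y => |g y * (m u * k (y / u) / u)|)).2]
      have h6 : ∀ τ, u * |g (u * τ) * (m u * k (u * τ / u) / u)| = |m u * (k τ * g (u * τ))| := by
        intro τ; rw [← e1 u hu τ, abs_mul u, abs_of_pos hu.1]
      simp_rw [h6]
      rw [Real.norm_of_nonneg (integral_nonneg fun _ => abs_nonneg _)]
      rw [← MeasureTheory.integral_const_mul]
      apply setIntegral_mono_on (hint u hu).abs (IB.const_mul _) measurableSet_Ioo
      intro τ hτ; exact hgb' u hu τ hτ
  have e2 : ∀ y, g y * mconv m k y = ∫ u in UU, F u y := by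
    intro y
    rw [mconv, ← MeasureTheory.integral_const_mul]
    congr 1; ext u; simp only [hF]; split_ifs <;> simp
  simp_rw [e2]
  refine ⟨hI.integral_prod_right, ?_⟩
  rw [← integral_integral_swap hI]
  refine setIntegral_congr_fun measurableSet_Ioo ?_
  intro u hu
  simp only [hF]
  rw [(trunc_int hu (fun y => g y * (m u * k (y / u) / u))).2]
  simp_rw [e1 u hu]
  rw [MeasureTheory.integral_const_mul]

lemma mellin_conv {m k g : ℝ → ℝ} (hm : Measurable m) (hk : Measurable k) (hg : Measurable g)
    (Im : IntegrableOn (fun u => m u * u ^ (-(1/2:ℝ))) UU)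
    (Ik : IntegrableOn (fun u => k u * u ^ (-(1/2:ℝ))) UU) {C : ℝ}
    (hgb : ∀ y ∈ UU, |g y| ≤ C * y ^ (-(1/2:ℝ))) :
    IntegrableOn (fun y => g y * mconv m k y) UU ∧
    ∫ y in UU, g y * mconv m k y = ∫ u in UU, m u * ∫ τ in UU, k τ * g (u * τ) := by
  have hgb' : ∀ u ∈ UU, ∀ τ ∈ UU, |m u * (k τ * g (u * τ))| ≤
      (C * |m u * u ^ (-(1/2:ℝ))|) * |k τ * τ ^ (-(1/2:ℝ))| := by
    intro u hu τ hτ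
    have h1 : u * τ ∈ UU := ⟨mul_pos hu.1 hτ.1, by nlinarith [hu.1, hu.2, hτ.1, hτ.2]⟩
    have h2 := hgb _ h1
    rw [Real.mul_rpow hu.1.le hτ.1.le] at h2
    have h3 := Real.rpow_pos_of_pos hu.1 (-(1/2:ℝ))
    have h4 := Real.rpow_pos_of_pos hτ.1 (-(1/2:ℝ))
    rw [abs_mul, abs_mul, abs_mul, abs_mul, abs_of_pos h3, abs_of_pos h4]
    calc |m u| * (|k τ| * |g (u * τ)|) ≤ |m u| * (|k τ| * (C * (u ^ (-(1/2:ℝ)) * τ ^ (-(1/2:ℝ))))) := by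
          gcongr
      _ = _ := by ring
  exact mellin_conv0 hm hk hg (Im.norm.const_mul C) Ik.norm hgb'

/-- Beta integral with a linear denominator -/
lemma beta_lin {a b A B : ℝ} (ha : 0 < a) (hb : 0 < b) (hA : 0 < A) (hAB : 0 < A + B) :
    IntegrableOn (fun τ : ℝ => τ ^ (a - 1) * (1 - τ) ^ (b - 1) * (A + B * τ) ^ (-(a + b))) UU ∧
    ∫ τ in UU, (τ : ℝ) ^ (a - 1) * (1 - τ) ^ (b - 1) * (A + B * τ) ^ (-(a + b))
      = Real.Gamma a * Real.Gamma b / Real.Gamma (a + b) * A ^ (-b) * (A + B) ^ (-a) := by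
  have hpos : ∀ τ ∈ Set.Icc (0:ℝ) 1, 0 < A + B * τ := by
    intro τ hτ
    nlinarith [hτ.1, hτ.2, mul_nonneg hτ.1 hAB.le, mul_nonneg (sub_nonneg.2 hτ.2) hA.le]
  set f : ℝ → ℝ := fun τ => τ * (A + B) / (A + B * τ) with hf
  set f' : ℝ → ℝ := fun τ => A * (A + B) / (A + B * τ) ^ 2 with hf'
  have hc : ContinuousOn f (Set.Icc 0 1) := by
    apply ContinuousOn.div (by fun_prop) (by fun_prop)
    intro x hx; exact (hpos x hx).ne'
  have hd : ∀ x ∈ UU, HasDerivAt f (f' x) x := by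
    intro x hx
    have h0 := (hpos x (Set.Ioo_subset_Icc_self hx)).ne'
    have := ((hasDerivAt_id x).mul_const (A + B)).div (((hasDerivAt_id x).const_mul B).const_add A) h0
    convert! this using 1
    simp only [hf', id]; congr 1; ring
  have hp : ∀ x ∈ UU, 0 < f' x := by
    intro x hx
    have h0 := (hpos x (Set.Ioo_subset_Icc_self hx))
    simp only [hf']; positivity
  have hf0 : f 0 = 0 := by simp [hf]
  have hf1 : f 1 = 1 := by simp [hf, hAB.ne']
  have key : ∀ τ ∈ UU, f' τ * ((f τ) ^ (a - 1) * (1 - f τ) ^ (b - 1)) =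
      (A ^ b * (A + B) ^ a) * (τ ^ (a - 1) * (1 - τ) ^ (b - 1) * (A + B * τ) ^ (-(a + b))) := by
    intro τ hτ
    have h0 := (hpos τ (Set.Ioo_subset_Icc_self hτ))
    have h1 : 1 - f τ = A * (1 - τ) / (A + B * τ) := by
      simp only [hf]; rw [eq_div_iff h0.ne', sub_mul, div_mul_cancel₀ _ h0.ne']; ring
    have h2 : 0 < 1 - τ := by linarith [hτ.2]
    have h3 := hτ.1
    rw [h1]; simp only [hf, hf']
    rw [Real.div_rpow (by positivity) h0.le, Real.div_rpow (by positivity) h0.le,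
      Real.mul_rpow h3.le hAB.le, Real.mul_rpow hA.le h2.le, Real.rpow_neg h0.le,
      Real.rpow_add h0, Real.rpow_sub_one hAB.ne', Real.rpow_sub_one hA.ne',
      Real.rpow_sub_one h0.ne', Real.rpow_sub_one h0.ne']
    have := Real.rpow_pos_of_pos h0 a
    have := Real.rpow_pos_of_pos h0 b
    field_simp
  have i1 := cov_int zero_lt_one hc hd hp (fun t => t ^ (a - 1) * (1 - t) ^ (b - 1))
  have i2 := cov zero_lt_one hc hd hp (fun t => t ^ (a - 1) * (1 - t) ^ (b - 1))
  rw [hf0, hf1] at i1 i2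
  rw [beta_val ha hb, setIntegral_congr_fun measurableSet_Ioo key, MeasureTheory.integral_const_mul] at i2
  have i3 := ((i1.1 (beta_intg ha hb)).congr_fun key measurableSet_Ioo).const_mul (A ^ b * (A + B) ^ a)⁻¹
  have hA' := Real.rpow_pos_of_pos hA b
  have hB' := Real.rpow_pos_of_pos hAB a
  constructor
  · refine IntegrableOn.congr_fun i3 ?_ measurableSet_Ioo
    intro τ _
    simp only
    field_simp
  · rw [i2, Real.rpow_neg hA.le, Real.rpow_neg hAB.le]
    generalize (∫ τ in UU, (τ : ℝ) ^ (a - 1) * (1 - τ) ^ (b - 1) * (A + B * τ) ^ (-(a + b))) = X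
    field_simp

/-- Euler swap -/
lemma euler_swap {a b v : ℝ} (hv : v < 1) (hv0 : 0 ≤ v) :
    ∫ t in UU, (t:ℝ) ^ (b - 1) * (1 - t) ^ (a - 1) * (1 - v * t) ^ (-a)
      = ∫ t in UU, (t:ℝ) ^ (a - 1) * (1 - t) ^ (b - 1) * (1 - v * t) ^ (-b) := by
  have hpos : ∀ τ ∈ Set.Icc (0:ℝ) 1, 0 < 1 - v * τ := by
    intro τ hτ
    nlinarith [hτ.1, hτ.2]
  have hv1 : 0 < 1 - v := by linarith
  set f : ℝ → ℝ := fun τ => τ * (1 - v) / (1 - v * τ) with hf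
  set f' : ℝ → ℝ := fun τ => (1 - v) / (1 - v * τ) ^ 2 with hf'
  have hc : ContinuousOn f (Set.Icc 0 1) := by
    apply ContinuousOn.div (by fun_prop) (by fun_prop)
    intro x hx; exact (hpos x hx).ne'
  have hd : ∀ x ∈ UU, HasDerivAt f (f' x) x := by
    intro x hx
    have h0 := (hpos x (Set.Ioo_subset_Icc_self hx)).ne'
    have := ((hasDerivAt_id x).mul_const (1 - v)).div (((hasDerivAt_id x).const_mul v).const_sub 1) h0
    convert! this using 1
    simp only [hf', id]; congr 1; ring
  have hp : ∀ x ∈ UU, 0 < f' x := by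
    intro x hx
    have h0 := (hpos x (Set.Ioo_subset_Icc_self hx))
    simp only [hf']; positivity
  have hf0 : f 0 = 0 := by simp [hf]
  have hf1 : f 1 = 1 := by simp [hf, hv1.ne']
  rw [cov_refl]
  have i2 := cov zero_lt_one hc hd hp (fun x => (1 - x) ^ (b - 1) * (1 - (1 - x)) ^ (a - 1) * (1 - v * (1 - x)) ^ (-a))
  rw [hf0, hf1] at i2
  rw [i2]
  refine setIntegral_congr_fun measurableSet_Ioo ?_
  intro τ hτ
  have h0 := (hpos τ (Set.Ioo_subset_Icc_self hτ))
  have h1 : 1 - f τ = (1 - τ) / (1 - v * τ) := by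
    simp only [hf]; rw [eq_div_iff h0.ne', sub_mul, div_mul_cancel₀ _ h0.ne']; ring
  have h2 : 0 < 1 - τ := by linarith [hτ.2]
  have h3 := hτ.1
  have h4 : 1 - v * (1 - f τ) = (1 - v) / (1 - v * τ) := by
    rw [h1, eq_div_iff h0.ne', sub_mul, mul_assoc, div_mul_cancel₀ _ h0.ne']; ring
  simp only
  rw [h4, h1, show 1 - (1 - τ) / (1 - v * τ) = τ * (1 - v) / (1 - v * τ) by
      rw [eq_div_iff h0.ne', sub_mul, div_mul_cancel₀ _ h0.ne']; ring]
  simp only [hf']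
  rw [Real.div_rpow (by positivity) h0.le, Real.div_rpow (by positivity) h0.le,
    Real.div_rpow (by positivity) h0.le,
      Real.mul_rpow h3.le hv1.le, Real.rpow_neg h0.le, Real.rpow_neg h0.le, Real.rpow_neg hv1.le,
      Real.rpow_sub_one hv1.ne',
      Real.rpow_sub_one h0.ne', Real.rpow_sub_one h0.ne']
  have := Real.rpow_pos_of_pos h0 a
  have := Real.rpow_pos_of_pos hv1 a
  have := Real.rpow_pos_of_pos h0 b
  field_simp

lemma pow_bd {δ y L p : ℝ} (hδ : 0 < δ) (h1 : δ ≤ y) (h2 : y ≤ L) : y ^ p ≤ δ ^ p + L ^ p := by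
  have hy : 0 < y := hδ.trans_le h1
  have a1 := Real.rpow_pos_of_pos hδ p
  have a2 := Real.rpow_pos_of_pos (hy.trans_le h2) p
  rcases le_total 0 p with h | h
  · have := Real.rpow_le_rpow hy.le h2 h; linarith
  · have := Real.rpow_le_rpow_of_nonpos hδ h1 h; linarith

lemma beta_pos_int {a b : ℝ} (c : ℝ) {g : ℝ → ℝ} (ha : 0 < a) (hb : 0 < b) (hg : Measurable g)
    (h : ∀ x ∈ UU, |g x| ≤ c) :
    IntegrableOn (fun x : ℝ => x ^ (a - 1) * (1 - x) ^ (b - 1) * g x) UU := by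
  refine Integrable.mono' ((beta_intg ha hb).mul_const c) (by fun_prop) ?_
  refine (ae_restrict_iff' measurableSet_Ioo).2 (Filter.Eventually.of_forall ?_)
  intro x hx
  have h1 := Real.rpow_pos_of_pos hx.1 (a - 1)
  have h2 := Real.rpow_pos_of_pos (sub_pos.2 hx.2) (b - 1)
  rw [Real.norm_eq_abs, abs_mul, abs_of_pos (mul_pos h1 h2)]
  have := h x hx
  gcongr

/-- Euler integral -/
noncomputable def eul (a b c t : ℝ) : ℝ :=
  ∫ x in UU, (x:ℝ) ^ (a - 1) * (1 - x) ^ (b - 1) * (1 - t * x) ^ (-c)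

lemma one_sub_lb {t x : ℝ} (hx : x ∈ UU) : min 1 (1 - t) ≤ 1 - t * x := by
  rcases le_total 0 t with h | h
  · exact (min_le_right _ _).trans (by nlinarith [hx.1, hx.2])
  · exact (min_le_left _ _).trans (by nlinarith [hx.1, hx.2])

lemma one_sub_pos {t x : ℝ} (ht : t < 1) (hx : x ∈ UU) : 0 < 1 - t * x :=
  lt_of_lt_of_le (lt_min one_pos (sub_pos.2 ht)) (one_sub_lb hx)

lemma one_sub_ub {t x : ℝ} (hx : x ∈ UU) : 1 - t * x ≤ 1 + |t| := by
  nlinarith [neg_abs_le t, hx.1, hx.2, abs_nonneg t]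

lemma eul_intg {a b : ℝ} (c : ℝ) {t : ℝ} (ha : 0 < a) (hb : 0 < b) (ht : t < 1) :
    IntegrableOn (fun x : ℝ => x ^ (a - 1) * (1 - x) ^ (b - 1) * (1 - t * x) ^ (-c)) UU := by
  refine beta_pos_int ((min 1 (1-t)) ^ (-c) + (1 + |t|) ^ (-c)) ha hb (by fun_prop) ?_
  intro x hx
  have h1 := one_sub_pos ht hx
  rw [abs_of_pos (Real.rpow_pos_of_pos h1 _)]
  exact pow_bd (lt_min one_pos (sub_pos.2 ht)) (one_sub_lb hx) (one_sub_ub hx)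

lemma eul_deriv {a b : ℝ} (c : ℝ) {t : ℝ} (ha : 0 < a) (hb : 0 < b) (ht : t < 1) :
    HasDerivAt (eul a b c) (c * eul (a + 1) b (c + 1) t) t := by
  have hs : Metric.ball t ((1 - t) / 2) ∈ nhds t := Metric.ball_mem_nhds t (by linarith)
  have h := hasDerivAt_integral_of_dominated_loc_of_deriv_le (μ := volume.restrict UU)
    (F := fun t x => (x:ℝ) ^ (a - 1) * (1 - x) ^ (b - 1) * (1 - t * x) ^ (-c))
    (F' := fun t x => c * (x ^ (a + 1 - 1) * (1 - x) ^ (b - 1) * (1 - t * x) ^ (-(c+1))))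
    (bound := fun x => |c| * (x ^ (a + 1 - 1) * (1 - x) ^ (b - 1) *
      ((min 1 ((1-t)/2)) ^ (-(c+1)) + (1 + (|t| + (1 - t)/2)) ^ (-(c+1)))))
    (x₀ := t) hs (Filter.Eventually.of_forall fun s => by fun_prop)
    (eul_intg c ha hb ht) (by fun_prop) ?_ ?_ ?_
  · have := h.2
    rw [MeasureTheory.integral_const_mul] at this
    exact this
  · refine (ae_restrict_iff' measurableSet_Ioo).2 (Filter.Eventually.of_forall ?_)
    intro x hx s hs
    rw [Metric.mem_ball, Real.dist_eq, abs_lt] at hs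
    have hs1 : s < 1 := by linarith
    have h1 := one_sub_pos hs1 hx
    have a1 := Real.rpow_pos_of_pos hx.1 (a + 1 - 1)
    have a2 := Real.rpow_pos_of_pos (sub_pos.2 hx.2) (b - 1)
    have a3 := Real.rpow_pos_of_pos h1 (-(c+1))
    rw [Real.norm_eq_abs, abs_mul, abs_of_pos (mul_pos (mul_pos a1 a2) a3)]
    gcongr
    refine pow_bd (lt_min one_pos (by linarith)) (le_trans ?_ (one_sub_lb hx)) ((one_sub_ub hx).trans ?_)
    · exact min_le_min le_rfl (by linarith)
    · have : |s| ≤ |t| + |s - t| := by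
        calc |s| = |t + (s - t)| := by ring_nf
          _ ≤ _ := abs_add_le _ _
      have : |s - t| ≤ (1 - t)/2 := abs_le.2 ⟨by linarith, by linarith⟩
      linarith
  · exact ((beta_intg (by linarith : 0 < a + 1) hb).mul_const _).const_mul _
  · refine (ae_restrict_iff' measurableSet_Ioo).2 (Filter.Eventually.of_forall ?_)
    intro x hx s hs
    rw [Metric.mem_ball, Real.dist_eq, abs_lt] at hs
    have hs1 : s < 1 := by linarith
    have h1 := one_sub_pos hs1 hx
    have := ((((hasDerivAt_id s).mul_const x).const_sub 1).rpow_const (p := -c) (Or.inl h1.ne')).const_mul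
      (x ^ (a - 1) * (1 - x) ^ (b - 1))
    convert! this using 1
    rw [show a + 1 - 1 = (a - 1) + 1 by ring, Real.rpow_add_one hx.1.ne', show -(c+1) = -c - 1 by ring]
    simp only [id]; ring

lemma eul_c {a b : ℝ} (c : ℝ) {t : ℝ} (ha : 0 < a) (hb : 0 < b) (ht : t < 1) :
    eul a b c t = eul a b (c + 1) t - t * eul (a + 1) b (c + 1) t := by
  unfold eul
  rw [← MeasureTheory.integral_const_mul, ← MeasureTheory.integral_sub (eul_intg _ ha hb ht)
    ((eul_intg (c+1) (by linarith : 0 < a + 1) hb ht).const_mul t)]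
  refine setIntegral_congr_fun measurableSet_Ioo ?_
  intro x hx
  have h1 := one_sub_pos ht hx
  simp only
  rw [show -c = -(c+1) + 1 by ring, Real.rpow_add_one h1.ne', show a + 1 - 1 = (a - 1) + 1 by ring,
    Real.rpow_add_one hx.1.ne']
  ring

lemma eul_b {a b : ℝ} (c : ℝ) {t : ℝ} (ha : 0 < a) (hb : 0 < b) (ht : t < 1) :
    eul a (b + 1) c t = eul a b c t - eul (a + 1) b c t := by
  unfold eul
  rw [← MeasureTheory.integral_sub (eul_intg _ ha hb ht)
    ((eul_intg c (by linarith : 0 < a + 1) hb ht))]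
  refine setIntegral_congr_fun measurableSet_Ioo ?_
  intro x hx
  have h1 := sub_pos.2 hx.2
  simp only
  rw [show b + 1 - 1 = (b - 1) + 1 by ring, Real.rpow_add_one h1.ne', show a + 1 - 1 = (a - 1) + 1 by ring,
    Real.rpow_add_one hx.1.ne']
  ring

lemma eul_parts {a b : ℝ} (c : ℝ) {t : ℝ} (ha : 0 < a) (hb : 0 < b) (ht : t < 1) :
    a * eul a (b + 1) c t - b * eul (a + 1) b c t + c * t * eul (a + 1) (b + 1) (c + 1) t = 0 := by
  have i1 := (eul_intg c ha (by linarith : 0 < b + 1) ht).const_mul a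
  have i2 := (eul_intg c (by linarith : 0 < a + 1) hb ht).const_mul b
  have i3 := (eul_intg (c+1) (by linarith : 0 < a + 1) (by linarith : 0 < b + 1) ht).const_mul (c * t)
  have h := intervalIntegral.integral_eq_sub_of_hasDerivAt_of_le (a := 0) (b := 1) zero_le_one
    (f := fun x => x ^ a * (1 - x) ^ b * (1 - t * x) ^ (-c))
    (f' := fun x => a * (x ^ (a - 1) * (1 - x) ^ (b + 1 - 1) * (1 - t * x) ^ (-c)) -
      b * (x ^ (a + 1 - 1) * (1 - x) ^ (b - 1) * (1 - t * x) ^ (-c)) +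
      c * t * (x ^ (a + 1 - 1) * (1 - x) ^ (b + 1 - 1) * (1 - t * x) ^ (-(c+1)))) ?_ ?_ ?_
  · have e := MeasureTheory.integral_add (i1.sub i2) i3
    simp only [Pi.sub_apply] at e
    rw [intervalIntegral.integral_of_le zero_le_one, integral_Ioc_eq_integral_Ioo,
      e, MeasureTheory.integral_sub i1 i2,
      MeasureTheory.integral_const_mul, MeasureTheory.integral_const_mul,
      MeasureTheory.integral_const_mul] at h
    unfold eul
    rw [h]
    simp [Real.zero_rpow ha.ne', Real.zero_rpow hb.ne']
  · refine ContinuousOn.mul (ContinuousOn.mul ?_ ?_) ?_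
    · exact continuousOn_id.rpow_const fun x _ => Or.inr ha.le
    · exact (continuousOn_const.sub continuousOn_id).rpow_const fun x _ => Or.inr hb.le
    · refine ContinuousOn.rpow_const (by fun_prop) fun x hx => Or.inl ?_
      have : 0 < 1 - t * x := by
        rcases le_total 0 t with h | h <;> nlinarith [hx.1, hx.2]
      exact this.ne'
  · intro x hx
    have h1 := one_sub_pos ht hx
    have h2 := sub_pos.2 hx.2
    have h3 := hx.1
    have d1 := (hasDerivAt_id x).rpow_const (p := a) (Or.inl h3.ne')
    have d2 := ((hasDerivAt_id x).const_sub 1).rpow_const (p := b) (Or.inl h2.ne')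
    have d3 := (((hasDerivAt_id x).const_mul t).const_sub 1).rpow_const (p := -c) (Or.inl h1.ne')
    convert! (d1.mul d2).mul d3 using 1
    simp only [id, Pi.mul_apply]
    rw [show b + 1 - 1 = b by ring, show a + 1 - 1 = a by ring, show -(c+1) = -c - 1 by ring]
    ring
  · rw [intervalIntegrable_iff_integrableOn_Ioo_of_le zero_le_one]
    exact (i1.sub i2).add i3

lemma eul_pos {a b : ℝ} (c : ℝ) {t : ℝ} (ha : 0 < a) (hb : 0 < b) (ht : t < 1) : 0 < eul a b c t := by
  unfold eul
  have hp : ∀ x ∈ UU, 0 < (x:ℝ) ^ (a - 1) * (1 - x) ^ (b - 1) * (1 - t * x) ^ (-c) := fun x hx =>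
      mul_pos (mul_pos (Real.rpow_pos_of_pos hx.1 _)
      (Real.rpow_pos_of_pos (sub_pos.2 hx.2) _)) (Real.rpow_pos_of_pos (one_sub_pos ht hx) _)
  rw [setIntegral_pos_iff_support_of_nonneg_ae]
  · have : Function.support (fun x : ℝ => (x:ℝ) ^ (a - 1) * (1 - x) ^ (b - 1) * (1 - t * x) ^ (-c)) ∩ UU = UU := by
      apply Set.inter_eq_right.2
      intro x hx
      exact (hp x hx).ne'
    rw [this]; simp
  · exact (ae_restrict_iff' measurableSet_Ioo).2 (Filter.Eventually.of_forall fun x hx => (hp x hx).le)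
  · exact eul_intg c ha hb ht

lemma split_bd {t x c δ : ℝ} (hδ : 0 ≤ δ) (hδc : δ ≤ c) (ht : t < 1) (ht0 : 0 ≤ t) (hx : x ∈ UU) :
    (1 - t * x) ^ (-c) ≤ (1 - t) ^ (-δ) * (1 - x) ^ (-(c - δ)) := by
  have h1 := one_sub_pos ht hx
  rw [show -c = -δ + -(c - δ) by ring, Real.rpow_add h1]
  have h2 := sub_pos.2 hx.2
  have h3 := sub_pos.2 ht
  refine mul_le_mul ?_ ?_ (Real.rpow_nonneg h1.le _) (Real.rpow_nonneg h3.le _)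
  · exact Real.rpow_le_rpow_of_nonpos h3 (by nlinarith [hx.1, hx.2]) (by linarith)
  · exact Real.rpow_le_rpow_of_nonpos h2 (by nlinarith [hx.1, hx.2]) (by linarith)

lemma eul_bound {a b c δ t : ℝ} (ha : 0 < a) (hb : 0 < b) (hδ : 0 ≤ δ) (hδc : δ ≤ c)
    (hbc : 0 < b - c + δ) (ht : t < 1) (ht0 : 0 ≤ t) :
    eul a b c t ≤ (Real.Gamma a * Real.Gamma (b - c + δ) / Real.Gamma (a + (b - c + δ))) * (1 - t) ^ (-δ) := by
  rw [← beta_val ha hbc, ← MeasureTheory.integral_mul_const]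
  unfold eul
  refine setIntegral_mono_on (eul_intg _ ha hb ht) ((beta_intg ha hbc).mul_const _) measurableSet_Ioo ?_
  intro x hx
  have := split_bd hδ hδc ht ht0 hx
  have a1 := Real.rpow_pos_of_pos hx.1 (a - 1)
  have a2 := Real.rpow_pos_of_pos (sub_pos.2 hx.2) (b - 1)
  calc _ ≤ x ^ (a - 1) * (1 - x) ^ (b - 1) * ((1 - t) ^ (-δ) * (1 - x) ^ (-(c - δ))) := by gcongr
    _ = _ := by
      rw [show b - c + δ - 1 = (b - 1) + -(c - δ) by ring, Real.rpow_add (sub_pos.2 hx.2)]; ring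

noncomputable def KK (t : ℝ) : ℝ := 1/2 * eul (1/2) (1/2) (1/2) t
noncomputable def EE (t : ℝ) : ℝ := 1/2 * eul (1/2) (1/2) (-(1/2)) t
noncomputable def MM (t : ℝ) : ℝ := 2 * EE t - KK t
noncomputable def VV (t : ℝ) : ℝ := 1/2 * ((1 - 2 * t) * EE t - (1 - t) * KK t)
noncomputable def e0 (t : ℝ) : ℝ := eul (1/2) (1/2) (3/2) t
noncomputable def e1 (t : ℝ) : ℝ := eul (3/2) (1/2) (3/2) t

lemma eul_meas (a b c : ℝ) : Measurable (eul a b c) := by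
  have h : Measurable (Function.uncurry
      (fun t x : ℝ => (x:ℝ) ^ (a - 1) * (1 - x) ^ (b - 1) * (1 - t * x) ^ (-c))) := by
    simp only [Function.uncurry_def]; fun_prop
  exact (h.stronglyMeasurable.integral_prod_right (ν := volume.restrict UU)).measurable

@[fun_prop] lemma KK_meas : Measurable KK := (eul_meas _ _ _).const_mul _
@[fun_prop] lemma EE_meas : Measurable EE := (eul_meas _ _ _).const_mul _
@[fun_prop] lemma MM_meas : Measurable MM := (EE_meas.const_mul _).sub KK_meas

lemma e2_rel {t : ℝ} (ht : t < 1) : e0 t - 2 * e1 t + t * eul (5/2) (1/2) (3/2) t = 0 := by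
  have h := eul_parts (a := 1/2) (b := 1/2) (1/2) (by norm_num) (by norm_num) ht
  have h1 := eul_b (a := 1/2) (b := 1/2) (1/2) (by norm_num) (by norm_num) ht
  have h2 := eul_b (a := 3/2) (b := 1/2) (3/2) (by norm_num) (by norm_num) ht
  have h3 := eul_c (a := 1/2) (b := 1/2) (1/2) (by norm_num) (by norm_num) ht
  have h4 := eul_c (a := 3/2) (b := 1/2) (1/2) (by norm_num) (by norm_num) ht
  norm_num at h h1 h2 h3 h4
  unfold e0 e1
  rw [h1, h2, h3, h4] at h
  linarith

lemma KK_eq {t : ℝ} (ht : t < 1) : KK t = 1/2 * (e0 t - t * e1 t) := by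
  have h3 := eul_c (a := 1/2) (b := 1/2) (1/2) (by norm_num) (by norm_num) ht
  norm_num at h3
  unfold KK e0 e1
  norm_num
  rw [h3]

lemma EE_eq {t : ℝ} (ht : t < 1) : EE t = 1/2 * ((1 - t) * e0 t) := by
  have h2 := eul_c (a := 1/2) (b := 1/2) (-(1/2)) (by norm_num) (by norm_num) ht
  have h3 := eul_c (a := 1/2) (b := 1/2) (1/2) (by norm_num) (by norm_num) ht
  have h4 := eul_c (a := 3/2) (b := 1/2) (1/2) (by norm_num) (by norm_num) ht
  have := e2_rel ht
  norm_num at h2 h3 h4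
  unfold EE
  unfold e0 e1 at *
  norm_num
  rw [h2, h3, h4]
  linear_combination t * this

lemma KK_deriv {t : ℝ} (ht : t < 1) : HasDerivAt KK (1/4 * e1 t) t := by
  have h := (eul_deriv (a := 1/2) (b := 1/2) (1/2) (by norm_num) (by norm_num) ht).const_mul (1/2)
  convert! h using 1
  unfold e1; norm_num; ring

lemma EE_deriv {t : ℝ} (ht : t < 1) : HasDerivAt EE (1/4 * (e1 t - e0 t)) t := by
  have h := (eul_deriv (a := 1/2) (b := 1/2) (-(1/2)) (by norm_num) (by norm_num) ht).const_mul (1/2)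
  convert! h using 1
  have h4 := eul_c (a := 3/2) (b := 1/2) (1/2) (by norm_num) (by norm_num) ht
  have := e2_rel ht
  norm_num at h4
  unfold e0 e1 at *; norm_num; rw [h4]
  linarith

lemma MM_deriv' {t : ℝ} (ht : t < 1) : HasDerivAt MM (1/4 * e1 t - 1/2 * e0 t) t := by
  convert! ((EE_deriv ht).const_mul 2).sub (KK_deriv ht) using 1; ring

lemma VV_eq {t : ℝ} (ht : t < 1) : VV t = t * (1 - t) * (1/4 * e1 t - 1/2 * e0 t) := by
  unfold VV; rw [KK_eq ht, EE_eq ht]; ring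

lemma MM_deriv {t : ℝ} (ht : t ∈ UU) : HasDerivAt MM (VV t / (t * (1 - t))) t := by
  convert MM_deriv' ht.2 using 1
  rw [VV_eq ht.2, mul_div_cancel_left₀]
  exact (mul_pos ht.1 (sub_pos.2 ht.2)).ne'

lemma VV_deriv {t : ℝ} (ht : t < 1) : HasDerivAt VV (-(3/4) * MM t) t := by
  have h1 := ((hasDerivAt_id t).const_mul 2).const_sub 1
  have h2 := (hasDerivAt_id t).const_sub 1
  convert! ((h1.mul (EE_deriv ht)).sub (h2.mul (KK_deriv ht))).const_mul (1/2) using 1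
  unfold MM
  simp only [id]
  rw [KK_eq ht, EE_eq ht]; ring

lemma MM_cont : ContinuousOn MM (Set.Iio 1) := fun _ hx => (MM_deriv' hx).continuousAt.continuousWithinAt
lemma VV_cont : ContinuousOn VV (Set.Iio 1) := fun _ hx => (VV_deriv hx).continuousAt.continuousWithinAt

lemma KK_nonneg {t : ℝ} (ht : t < 1) : 0 < KK t :=
  mul_pos (by norm_num) (eul_pos _ (by norm_num) (by norm_num) ht)
lemma EE_nonneg {t : ℝ} (ht : t < 1) : 0 < EE t :=
  mul_pos (by norm_num) (eul_pos _ (by norm_num) (by norm_num) ht)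

lemma KK_bound : ∃ C : ℝ, 0 < C ∧ ∀ t : ℝ, 0 ≤ t → t < 1 → KK t ≤ C * (1 - t) ^ (-(1/16:ℝ)) := by
  refine ⟨1/2 * (Real.Gamma (1/2) * Real.Gamma (1/2 - 1/2 + 1/16) / Real.Gamma (1/2 + (1/2 - 1/2 + 1/16))), ?_, ?_⟩
  · have := Real.Gamma_pos_of_pos (show (0:ℝ) < 1/2 by norm_num)
    have := Real.Gamma_pos_of_pos (show (0:ℝ) < 1/2 - 1/2 + 1/16 by norm_num)
    have := Real.Gamma_pos_of_pos (show (0:ℝ) < 1/2 + (1/2 - 1/2 + 1/16) by norm_num)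
    positivity
  · intro t h0 h1
    have := eul_bound (a := 1/2) (b := 1/2) (c := 1/2) (δ := 1/16) (t := t) (by norm_num) (by norm_num)
      (by norm_num) (by norm_num) (by norm_num) h1 h0
    unfold KK; rw [mul_assoc]; gcongr

lemma EE_le_KK {t : ℝ} (ht0 : 0 ≤ t) (ht : t < 1) : EE t ≤ KK t := by
  unfold EE KK eul
  refine mul_le_mul_of_nonneg_left ?_ (by norm_num)
  refine setIntegral_mono_on (eul_intg (a := 1/2) (b := 1/2) _ (by norm_num) (by norm_num) ht)
    (eul_intg (a := 1/2) (b := 1/2) _ (by norm_num) (by norm_num) ht) measurableSet_Ioo ?_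
  intro x hx
  have a1 := Real.rpow_pos_of_pos hx.1 (1/2 - 1)
  have a2 := Real.rpow_pos_of_pos (sub_pos.2 hx.2) (1/2 - 1)
  have a3 := one_sub_pos ht hx
  gcongr ?_ * ?_
  exact Real.rpow_le_rpow_of_exponent_ge a3 (by nlinarith [hx.1]) (by norm_num)

lemma MM_bound : ∃ C : ℝ, 0 < C ∧ ∀ t : ℝ, 0 ≤ t → t < 1 → |MM t| ≤ C * (1 - t) ^ (-(1/16:ℝ)) := by
  obtain ⟨C, hC, h⟩ := KK_bound
  refine ⟨C, hC, fun t h0 h1 => le_trans ?_ (h t h0 h1)⟩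
  have := EE_le_KK h0 h1
  have := EE_nonneg h1
  have := KK_nonneg h1
  unfold MM
  rw [abs_le]; constructor <;> linarith

lemma EE_cont : ContinuousOn EE (Set.Icc 0 1) := by
  unfold EE eul
  refine continuousOn_const.mul ?_
  refine MeasureTheory.continuousOn_of_dominated (bound := fun x => x ^ ((1/2:ℝ) - 1) * (1 - x) ^ ((1/2:ℝ) - 1)) ?_ ?_ ?_ ?_
  · intro t _; fun_prop
  · intro t ht
    refine (ae_restrict_iff' measurableSet_Ioo).2 (Filter.Eventually.of_forall ?_)
    intro x hx
    have a1 := Real.rpow_pos_of_pos hx.1 (1/2 - 1)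
    have a2 := Real.rpow_pos_of_pos (sub_pos.2 hx.2) (1/2 - 1)
    have a3 : 0 ≤ 1 - t * x := by nlinarith [hx.1, hx.2, ht.1, ht.2]
    have a4 : (1 - t * x) ^ (-(-(1/2:ℝ))) ≤ 1 := Real.rpow_le_one a3 (by nlinarith [hx.1, hx.2, ht.1, ht.2]) (by norm_num)
    have a5 := Real.rpow_nonneg a3 (-(-(1/2:ℝ)))
    rw [Real.norm_eq_abs, abs_of_nonneg (by positivity)]
    exact mul_le_of_le_one_right (by positivity) a4
  · exact beta_intg (by norm_num) (by norm_num)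
  · refine (ae_restrict_iff' measurableSet_Ioo).2 (Filter.Eventually.of_forall ?_)
    intro x hx
    refine continuousOn_const.mul ?_
    refine ContinuousOn.rpow_const (by fun_prop) fun x hx => Or.inr (by norm_num)

lemma EE_one : EE 1 = 1 := by
  unfold EE eul
  have h := beta_val (a := 1/2) (b := 1) (by norm_num) (by norm_num)
  have : ∫ x in UU, (x:ℝ) ^ ((1/2:ℝ) - 1) * (1 - x) ^ ((1/2:ℝ) - 1) * (1 - 1 * x) ^ (-(-(1/2:ℝ))) =
      ∫ x in UU, (x:ℝ) ^ ((1/2:ℝ) - 1) * (1 - x) ^ ((1:ℝ) - 1) := by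
    refine setIntegral_congr_fun measurableSet_Ioo ?_
    intro x hx
    simp only
    rw [one_mul, mul_assoc, ← Real.rpow_add (sub_pos.2 hx.2)]; norm_num
  rw [this, h]
  rw [Real.Gamma_add_one (by norm_num), Real.Gamma_one]
  have := Real.Gamma_pos_of_pos (show (0:ℝ) < 1/2 by norm_num)
  field_simp

lemma VV_zero : VV 0 = 0 := by rw [VV_eq zero_lt_one]; ring
lemma VV_one : VV 1 = -(1/2) := by unfold VV; rw [EE_one]; ring

lemma cont_ext {f : ℝ → ℝ} {C p : ℝ} (hp : 0 < p) (hc : ContinuousOn f (Set.Ico 0 1)) (h1 : f 1 = 0)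
    (hb : ∀ t, 0 ≤ t → t < 1 → |f t| ≤ C * (1 - t) ^ p) : ContinuousOn f (Set.Icc 0 1) := by
  intro t ht
  rcases lt_or_eq_of_le ht.2 with h | h
  · have h2 := hc t ⟨ht.1, h⟩
    apply h2.mono_of_mem_nhdsWithin
    rw [mem_nhdsWithin]
    exact ⟨Set.Iio 1, isOpen_Iio, h, fun x hx => ⟨hx.2.1, hx.1⟩⟩
  · subst h
    rw [ContinuousWithinAt, h1]
    apply squeeze_zero_norm' (a := fun t => C * (1 - t) ^ p)
    · filter_upwards [self_mem_nhdsWithin] with x hx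
      rcases lt_or_eq_of_le hx.2 with h | h
      · exact hb x hx.1 h
      · subst h; simp [h1, Real.zero_rpow hp.ne']
    · have : ContinuousAt (fun t : ℝ => C * (1 - t) ^ p) 1 := by
        refine continuousAt_const.mul (ContinuousAt.rpow_const (by fun_prop) (Or.inr hp.le))
      have h2 := this.tendsto
      simp only [sub_self, Real.zero_rpow hp.ne', mul_zero] at h2
      exact h2.mono_left nhdsWithin_le_nhds

lemma oneK_cont : ContinuousOn (fun t => (1 - t) * KK t) (Set.Icc 0 1) := by
  obtain ⟨C, hC, h⟩ := KK_bound
  refine cont_ext (C := C) (p := 15/16) (by norm_num) ?_ (by simp) ?_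
  · refine ContinuousOn.mul (by fun_prop) fun x hx => (KK_deriv hx.2).continuousAt.continuousWithinAt
  · intro t h0 h1
    have h2 := sub_pos.2 h1
    rw [abs_mul, abs_of_pos h2, abs_of_pos (KK_nonneg h1)]
    calc _ ≤ (1 - t) * (C * (1 - t) ^ (-(1/16:ℝ))) := by gcongr; exact h t h0 h1
      _ = C * ((1 - t) * (1 - t) ^ (-(1/16:ℝ))) := by ring
      _ = _ := by rw [← Real.rpow_one_add' h2.le (by norm_num)]; norm_num

lemma VV_contI : ContinuousOn VV (Set.Icc 0 1) := by
  unfold VV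
  refine continuousOn_const.mul (ContinuousOn.sub (ContinuousOn.mul (by fun_prop) EE_cont) oneK_cont)

lemma oneM_cont : ContinuousOn (fun t => (1 - t) * MM t) (Set.Icc 0 1) := by
  have : (fun t => (1 - t) * MM t) = fun t => (1 - t) * (2 * EE t) - (1 - t) * KK t := by
    ext t; unfold MM; ring
  rw [this]
  exact ContinuousOn.sub (ContinuousOn.mul (by fun_prop) (continuousOn_const.mul EE_cont)) oneK_cont

lemma oneM2_cont : ContinuousOn (fun t => (1 - t) * MM t ^ 2) (Set.Icc 0 1) := by
  obtain ⟨C, hC, h⟩ := MM_bound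
  refine cont_ext (C := C^2) (p := 7/8) (by norm_num) ?_ (by simp) ?_
  · refine ContinuousOn.mul (by fun_prop) (ContinuousOn.pow (MM_cont.mono fun x hx => hx.2) 2)
  · intro t h0 h1
    have h2 := sub_pos.2 h1
    rw [abs_mul, abs_of_pos h2, abs_pow]
    calc _ ≤ (1 - t) * (C * (1 - t) ^ (-(1/16:ℝ))) ^ 2 := by gcongr; exact h t h0 h1
      _ = C ^ 2 * ((1 - t) * ((1 - t) ^ (-(1/16:ℝ))) ^ 2) := by ring
      _ = _ := by
        rw [← Real.rpow_natCast ((1 - t) ^ (-(1/16:ℝ))), ← Real.rpow_mul h2.le,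
          ← Real.rpow_one_add' h2.le (by norm_num)]; norm_num

lemma sin_cov (g : ℝ → ℝ) : ∫ x in UU, g x = ∫ α in Set.Ioo 0 (π/2), 2 * Real.sin α * Real.cos α * g (Real.sin α ^ 2) := by
  have := cov (f := fun α => Real.sin α ^ 2) (f' := fun α => 2 * Real.sin α * Real.cos α) (a := 0) (b := π/2) (by positivity)
    (by fun_prop) (fun x _ => by convert! (Real.hasDerivAt_sin x).pow 2 using 1; simp) ?_ g
  · simpa using this
  · intro x hx
    have h1 := Real.sin_pos_of_pos_of_lt_pi hx.1 (by linarith [hx.2, Real.pi_pos])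
    have h2 := Real.cos_pos_of_mem_Ioo (x := x) ⟨by linarith [hx.1, Real.pi_pos], hx.2⟩
    positivity

lemma eul_trig (c t : ℝ) : 1/2 * eul (1/2) (1/2) c t =
    ∫ θ in (0:ℝ)..(π/2), (1 - t * Real.sin θ ^ 2) ^ (-c) := by
  unfold eul
  rw [sin_cov, ← MeasureTheory.integral_const_mul, intervalIntegral.integral_of_le (by positivity), integral_Ioc_eq_integral_Ioo]
  refine setIntegral_congr_fun measurableSet_Ioo ?_
  intro x hx
  have h1 := Real.sin_pos_of_pos_of_lt_pi hx.1 (by linarith [hx.2, Real.pi_pos])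
  have h2 := Real.cos_pos_of_mem_Ioo (x := x) ⟨by linarith [hx.1, Real.pi_pos], hx.2⟩
  simp only
  rw [← Real.cos_sq', ← Real.rpow_natCast, ← Real.rpow_natCast, ← Real.rpow_mul h1.le, ← Real.rpow_mul h2.le]
  norm_num
  rw [Real.rpow_neg_one, Real.rpow_neg_one]
  field_simp

lemma ellK {t : ℝ} (ht : 0 ≤ t) : ellipticK (√t) = KK t := by
  unfold KK; rw [eul_trig, ellipticK, Real.sq_sqrt ht]
lemma ellE {t : ℝ} (ht : 0 ≤ t) : ellipticE (√t) = EE t := by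
  unfold EE; rw [eul_trig, ellipticE, Real.sq_sqrt ht, neg_neg]

lemma MM_int {t : ℝ} (ht : t < 1) : MM t = ∫ x in UU, 1/2 * ((1 - 2 * t * x) *
    (x ^ (-(1/2:ℝ)) * (1 - x) ^ (-(1/2:ℝ)) * (1 - t * x) ^ (-(1/2:ℝ)))) := by
  unfold MM EE KK eul
  have i1 := (eul_intg (a := 1/2) (b := 1/2) (-(1/2)) (by norm_num) (by norm_num) ht).const_mul (1/2)
  have i2 := (eul_intg (a := 1/2) (b := 1/2) (1/2) (by norm_num) (by norm_num) ht).const_mul (1/2)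
  rw [← MeasureTheory.integral_const_mul, ← MeasureTheory.integral_const_mul, ← MeasureTheory.integral_const_mul,
     ← MeasureTheory.integral_sub (i1.const_mul 2) i2]
  refine setIntegral_congr_fun measurableSet_Ioo ?_
  intro x hx
  have h1 := one_sub_pos ht hx
  simp only
  rw [show -(-(1/2:ℝ)) = -(1/2) + 1 by norm_num, Real.rpow_add_one h1.ne']
  norm_num
  ring

lemma mconv_eq (m k : ℝ → ℝ) {y : ℝ} (hy : y ∈ UU) : mconv m k y = ∫ u in Set.Ioo y 1, m u * k (y / u) / u := by
  unfold mconv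
  have e : (fun u => if y < u then m u * k (y / u) / u else 0) = Set.indicator (Set.Ioi y) (fun u => m u * k (y / u) / u) := by
    ext y; simp [Set.indicator]
  rw [e, setIntegral_indicator measurableSet_Ioi]
  congr 2
  ext u; simp only [Set.mem_inter_iff, Set.mem_Ioo, Set.mem_Ioi]
  exact ⟨fun h => ⟨h.2, h.1.2⟩, fun h => ⟨⟨hy.1.trans h.1, h.2⟩, h.1⟩⟩

lemma F5 {u : ℝ} (hu : u ∈ UU) : MM (1 - u) = mconv (fun w => (1 - w) ^ (-(1/2:ℝ)))
    (fun τ => 1/2 * ((2 * τ - 1) * (1 - τ) ^ (-(1/2:ℝ)))) u := by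
  rw [mconv_eq _ _ hu]
  have h0 : ∀ x ∈ Set.Icc (0:ℝ) 1, 0 < 1 - (1 - u) * x := by
    intro x hx; nlinarith [hx.1, hx.2, hu.1, hu.2]
  have := cov (f := fun x => u / (1 - (1 - u) * x)) (f' := fun x => u * (1 - u) / (1 - (1 - u) * x) ^ 2)
    (a := 0) (b := 1) zero_lt_one ?_ ?_ ?_ (fun w => (1 - w) ^ (-(1/2:ℝ)) *
      (1/2 * ((2 * (u / w) - 1) * (1 - u / w) ^ (-(1/2:ℝ)))) / w)
  · rw [show u / (1 - (1 - u) * 0) = u by simp, show u / (1 - (1 - u) * 1) = 1 by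
      rw [show 1 - (1 - u) * 1 = u by ring]; exact div_self hu.1.ne'] at this
    rw [this, MM_int (by linarith [hu.1])]
    refine setIntegral_congr_fun measurableSet_Ioo ?_
    intro x hx
    have hd := h0 x (Set.Ioo_subset_Icc_self hx)
    have h1 := sub_pos.2 hx.2
    have h2 := hx.1
    have h3 := sub_pos.2 hu.2
    have h4 := hu.1
    have k1 : u / (u / (1 - (1 - u) * x)) = 1 - (1 - u) * x := by field_simp
    have k2 : 1 - u / (1 - (1 - u) * x) = (1 - u) * (1 - x) / (1 - (1 - u) * x) := by
      rw [eq_div_iff hd.ne', sub_mul, div_mul_cancel₀ _ hd.ne']; ring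
    have k3 : 1 - (1 - (1 - u) * x) = (1 - u) * x := by ring
    have k4 : 2 * (1 - (1 - u) * x) - 1 = 1 - 2 * (1 - u) * x := by ring
    simp only
    rw [k1, k2, k3, k4, Real.div_rpow (by positivity) hd.le, Real.mul_rpow h3.le h1.le, Real.mul_rpow h3.le h2.le]
    have e1 : (1 - u) ^ (-(1/2:ℝ)) * (1 - u) ^ (-(1/2:ℝ)) * (1 - u) = 1 := by
      rw [← Real.rpow_add h3, ← Real.rpow_add_one h3.ne']; norm_num
    have e2 : (1 - (1 - u) * x) ^ (-(1/2:ℝ)) * (1 - (1 - u) * x) ^ (-(1/2:ℝ)) * (1 - (1 - u) * x) = 1 := by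
      rw [← Real.rpow_add hd, ← Real.rpow_add_one hd.ne']; norm_num
    have e3 := Real.rpow_pos_of_pos hd (-(1/2:ℝ))
    generalize (1 - (1 - u) * x) ^ (-(1/2:ℝ)) = D at *
    generalize (1 - u) ^ (-(1/2:ℝ)) = E at *
    generalize (1 - (1 - u) * x) = d at *
    generalize x ^ (-(1/2:ℝ)) = X at *
    generalize (1 - x) ^ (-(1/2:ℝ)) = Y at *
    field_simp
    linear_combination (1 - 2 * (1 - u) * x) * (X * Y) * e2 - (1 - 2 * (1 - u) * x) * (X * Y) * e1
  · apply ContinuousOn.div (by fun_prop) (by fun_prop)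
    intro x hx; exact (h0 x hx).ne'
  · intro x hx
    have hd := h0 x (Set.Ioo_subset_Icc_self hx)
    have := (hasDerivAt_const x u).div (((hasDerivAt_id x).const_mul (1 - u)).const_sub 1) hd.ne'
    convert! this using 1
    simp only [id]; congr 1; ring
  · intro x hx
    have hd := h0 x (Set.Ioo_subset_Icc_self hx)
    have h3 := sub_pos.2 hu.2
    have h4 := hu.1
    positivity

noncomputable def SS (x : ℝ) : ℝ := x * eul (5/4) (1/4) (1/4) (x ^ 2)
noncomputable def WW (x : ℝ) : ℝ := 1/2 * eul (1/4) (1/4) (-(3/4)) (x ^ 2)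

lemma sq_lt {x : ℝ} (h : x ∈ Set.Ioo (-1:ℝ) 1) : x ^ 2 < 1 := by nlinarith [h.1, h.2]

lemma WW_deriv {x : ℝ} (h : x ∈ Set.Ioo (-1:ℝ) 1) : HasDerivAt WW (-(3/4) * SS x) x := by
  have h1 := eul_deriv (a := 1/4) (b := 1/4) (-(3/4)) (by norm_num) (by norm_num) (sq_lt h)
  have h2 := (HasDerivAt.comp (h := fun x : ℝ => x ^ 2) x h1 (hasDerivAt_pow 2 x)).const_mul (1/2)
  convert! h2 using 1
  unfold SS; norm_num; ring

lemma SS_deriv {x : ℝ} (h : x ∈ Set.Ioo (-1:ℝ) 1) : HasDerivAt SS (WW x / (1 - x ^ 2)) x := by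
  have ht := sq_lt h
  have h1 := eul_deriv (a := 5/4) (b := 1/4) (1/4) (by norm_num) (by norm_num) ht
  have h2 := (hasDerivAt_id x).mul (HasDerivAt.comp (h := fun x : ℝ => x ^ 2) x h1 (hasDerivAt_pow 2 x))
  convert! h2 using 1
  have p0 := eul_parts (a := 1/4) (b := 1/4) (1/4) (by norm_num) (by norm_num) ht
  have p1 := eul_b (a := 1/4) (b := 1/4) (1/4) (by norm_num) (by norm_num) ht
  have p2 := eul_b (a := 5/4) (b := 1/4) (5/4) (by norm_num) (by norm_num) ht
  have p3 := eul_c (a := 1/4) (b := 1/4) (1/4) (by norm_num) (by norm_num) ht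
  have p4 := eul_c (a := 5/4) (b := 1/4) (1/4) (by norm_num) (by norm_num) ht
  have p5 := eul_c (a := 1/4) (b := 1/4) (-(3/4)) (by norm_num) (by norm_num) ht
  unfold WW
  norm_num at p0 p1 p2 p3 p4 p5 ⊢
  rw [p1, p2, p3, p4] at p0
  rw [p5, p3, p4, div_eq_iff (by linarith)]
  linear_combination 2 * p0

lemma refl_half {x : ℝ} (h : x ∈ Set.Ioo (-1:ℝ) 1) : (1 - x)/2 ∈ UU ∧ (1 + x)/2 ∈ UU := by
  refine ⟨⟨?_, ?_⟩, ⟨?_, ?_⟩⟩ <;> linarith [h.1, h.2]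

noncomputable def DD (x : ℝ) : ℝ := MM ((1 - x)/2) - MM ((1 + x)/2)
noncomputable def YY (x : ℝ) : ℝ := -2 * (VV ((1 - x)/2) + VV ((1 + x)/2))

lemma DD_deriv {x : ℝ} (h : x ∈ Set.Ioo (-1:ℝ) 1) : HasDerivAt DD (YY x / (1 - x ^ 2)) x := by
  obtain ⟨h1, h2⟩ := refl_half h
  have d1 := ((hasDerivAt_id x).const_sub 1).div_const 2
  have d2 := ((hasDerivAt_id x).const_add 1).div_const 2
  have := (HasDerivAt.comp x (MM_deriv h1) d1).sub (HasDerivAt.comp x (MM_deriv h2) d2)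
  convert! this using 1
  have k1 : (1 - x) ≠ 0 := by linarith [h.2]
  have k2 : (1 + x) ≠ 0 := by linarith [h.1]
  unfold YY
  simp only [id]
  rw [show 1 - (1 - x)/2 = (1 + x)/2 by ring, show 1 - (1 + x)/2 = (1 - x)/2 by ring,
    show 1 - x^2 = (1 - x) * (1 + x) by ring]
  field_simp
  ring

lemma YY_deriv {x : ℝ} (h : x ∈ Set.Ioo (-1:ℝ) 1) : HasDerivAt YY (-(3/4) * DD x) x := by
  obtain ⟨h1, h2⟩ := refl_half h
  have d1 := ((hasDerivAt_id x).const_sub 1).div_const 2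
  have d2 := ((hasDerivAt_id x).const_add 1).div_const 2
  have := ((HasDerivAt.comp x (VV_deriv h1.2) d1).add (HasDerivAt.comp x (VV_deriv h2.2) d2)).const_mul (-2)
  convert! this using 1
  unfold DD; simp only [id]; ring

lemma zero_mem_I : (0:ℝ) ∈ Set.Ioo (-1:ℝ) 1 := by norm_num

lemma wronsk {x : ℝ} (h : x ∈ Set.Ioo (-1:ℝ) 1) : DD x * WW x = SS x * YY x := by
  have hd : ∀ x ∈ Set.Ioo (-1:ℝ) 1, HasDerivAt (fun x => DD x * WW x - SS x * YY x) 0 x := by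
    intro x hx
    convert! ((DD_deriv hx).mul (WW_deriv hx)).sub ((SS_deriv hx).mul (YY_deriv hx)) using 1
    ring
  have := (convex_Ioo (-1:ℝ) 1).is_const_of_fderivWithin_eq_zero (𝕜 := ℝ)
    (f := fun x => DD x * WW x - SS x * YY x) (fun x hx => (hd x hx).differentiableAt.differentiableWithinAt)
    (fun x hx => by
      rw [fderivWithin_of_isOpen isOpen_Ioo hx]
      ext; simpa using (hd x hx).deriv) h zero_mem_I
  have h0 : SS 0 = 0 := by simp [SS]
  have h1 : DD 0 = 0 := by simp [DD]
  simp only [h0, h1] at this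
  linarith

lemma WW_pos {x : ℝ} (h : x ∈ Set.Ioo (-1:ℝ) 1) : 0 < WW x :=
  mul_pos (by norm_num) (eul_pos _ (by norm_num) (by norm_num) (sq_lt h))

lemma DD_eq {x : ℝ} (h : x ∈ Set.Ioo (-1:ℝ) 1) : DD x = YY 0 / WW 0 * SS x := by
  have hd : ∀ x ∈ Set.Ioo (-1:ℝ) 1, HasDerivAt (fun x => YY x / WW x) 0 x := by
    intro x hx
    convert! (YY_deriv hx).div (WW_deriv hx) (WW_pos hx).ne' using 1
    rw [eq_comm, div_eq_zero_iff]; left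
    linear_combination (-(3/4)) * wronsk hx
  have := (convex_Ioo (-1:ℝ) 1).is_const_of_fderivWithin_eq_zero (𝕜 := ℝ)
    (f := fun x => YY x / WW x) (fun x hx => (hd x hx).differentiableAt.differentiableWithinAt)
    (fun x hx => by
      rw [fderivWithin_of_isOpen isOpen_Ioo hx]
      ext; simpa using (hd x hx).deriv) h zero_mem_I
  rw [← this]
  have := (WW_pos h).ne'
  have := wronsk h
  field_simp
  linarith

/-- value of K at the lemniscatic point -/
lemma KK_half : KK (1/2) = √2 / 4 * (Real.Gamma (1/4) * Real.Gamma (1/2) / Real.Gamma (3/4)) := by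
  have h := beta_val (a := 1/4) (b := 1/2) (by norm_num) (by norm_num)
  rw [show (1/4:ℝ) + 1/2 = 3/4 by norm_num] at h
  rw [← h]
  unfold KK eul
  rw [cov_refl]
  have := cov (f := fun p : ℝ => p ^ 2) (f' := fun p => 2 * p) (a := 0) (b := 1) zero_lt_one (by fun_prop)
    (fun x _ => by simpa using hasDerivAt_pow 2 x) (fun x hx => by have := hx.1; positivity)
    (fun t => t ^ ((1/4:ℝ) - 1) * (1 - t) ^ ((1/2:ℝ) - 1))
  norm_num only at this
  norm_num only
  rw [this, ← MeasureTheory.integral_const_mul, ← MeasureTheory.integral_const_mul]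
  refine setIntegral_congr_fun measurableSet_Ioo ?_
  intro x hx
  have h1 := hx.1
  have h2 := sub_pos.2 hx.2
  simp only
  rw [show (1:ℝ) - (1 - x) = x by ring, show 1 - 1/2 * (1 - x) = (1 + x) * 2⁻¹ by ring,
    show 1 - x^2 = (1 - x) * (1 + x) by ring, Real.mul_rpow h2.le (by positivity),
    Real.mul_rpow (by positivity) (by positivity), Real.inv_rpow (by norm_num),
    Real.rpow_neg (show (0:ℝ) ≤ 2 by norm_num) (1/2), inv_inv, ← Real.sqrt_eq_rpow, ← Real.rpow_natCast x 2, ← Real.rpow_mul h1.le]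
  have : x ^ (-1/2:ℝ) = x ^ (((2:ℕ):ℝ) * (-3/4)) * x := by
    rw [← Real.rpow_add_one h1.ne']; norm_num
  norm_num only at this ⊢
  rw [this]
  ring

lemma YY_zero : YY 0 = KK (1/2) := by
  unfold YY VV; norm_num; ring
lemma WW_zero : WW 0 = 1/2 * (Real.Gamma (1/4) * Real.Gamma (1/4) / Real.Gamma (1/2)) := by
  have h := beta_val (a := 1/4) (b := 1/4) (by norm_num) (by norm_num)
  rw [show (1/4:ℝ) + 1/4 = 1/2 by norm_num] at h
  rw [← h]
  unfold WW eul
  simp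

lemma eul_swap {a b v : ℝ} (hv : v < 1) (hv0 : 0 ≤ v) : eul b a a v = eul a b b v := euler_swap hv hv0

/-- F6 -/
lemma F6 {x : ℝ} (h : x ∈ UU) : DD x = KK (1/2) / WW 0 * (x * eul (1/4) (5/4) (5/4) (x^2)) := by
  have h' : x ∈ Set.Ioo (-1:ℝ) 1 := ⟨by linarith [h.1], h.2⟩
  rw [DD_eq h', YY_zero, SS, eul_swap (sq_lt h') (sq_nonneg x)]

noncomputable def Bt (a b : ℝ) : ℝ := Real.Gamma a * Real.Gamma b / Real.Gamma (a + b)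

lemma mul_mem_U {u τ : ℝ} (hu : u ∈ UU) (hτ : τ ∈ UU) : u * τ ∈ UU :=
  ⟨mul_pos hu.1 hτ.1, by nlinarith [hu.1, hu.2, hτ.1, hτ.2]⟩

lemma refl_mem {u : ℝ} (hu : u ∈ UU) : 1 - u ∈ UU := ⟨by linarith [hu.2], by linarith [hu.1]⟩

/-- domination for the beta type kernels -/
lemma dom_ker {a b p q c δ u τ x : ℝ} (hδ : 0 ≤ δ) (hδc : δ ≤ c) (hu : u ∈ UU) (hτ : τ ∈ UU) (hx : x ∈ UU) :
    |τ ^ (a - 1) * (1 - τ) ^ (b - 1) * (x ^ (p - 1) * (1 - x) ^ (q - 1) * (1 - (1 - u * τ) * x) ^ (-c))| ≤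
    (u ^ (-δ) * (τ ^ (a - δ - 1) * (1 - τ) ^ (b - 1))) * (x ^ (p - 1) * (1 - x) ^ (q - c + δ - 1)) := by
  have hm := mul_mem_U hu hτ
  have hm' := refl_mem hm
  have h := split_bd hδ hδc hm'.2 hm'.1.le hx
  have a1 := Real.rpow_pos_of_pos hτ.1 (a - 1)
  have a2 := Real.rpow_pos_of_pos (sub_pos.2 hτ.2) (b - 1)
  have a3 := Real.rpow_pos_of_pos hx.1 (p - 1)
  have a4 := Real.rpow_pos_of_pos (sub_pos.2 hx.2) (q - 1)
  have a5 := Real.rpow_pos_of_pos (one_sub_pos hm'.2 hx) (-c)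
  rw [abs_of_pos (by positivity)]
  rw [show 1 - (1 - u * τ) = u * τ by ring] at h
  calc _ ≤ τ ^ (a - 1) * (1 - τ) ^ (b - 1) * (x ^ (p - 1) * (1 - x) ^ (q - 1) * ((u * τ) ^ (-δ) * (1 - x) ^ (-(c - δ)))) := by
        gcongr
    _ = _ := by
        rw [Real.mul_rpow hu.1.le hτ.1.le, show a - δ - 1 = (a - 1) + -δ by ring, Real.rpow_add hτ.1,
          show q - c + δ - 1 = (q - 1) + -(c - δ) by ring, Real.rpow_add (sub_pos.2 hx.2)]
        ring

lemma frac {a b p q δ u : ℝ} (ha : 0 < a) (hb : 0 < b) (hp : 0 < p) (hδ : 0 ≤ δ)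
    (hδa : δ < a) (hq : 0 < q - (a + b) + δ) (hu : u ∈ UU) :
    ∫ τ in UU, τ ^ (a - 1) * (1 - τ) ^ (b - 1) * eul p q (a + b) (1 - u * τ) = Bt a b * eul p (q - b) a (1 - u) := by
  unfold eul
  simp_rw [← MeasureTheory.integral_const_mul]
  rw [swap_dom (A := fun τ => u ^ (-δ) * (τ ^ (a - δ - 1) * (1 - τ) ^ (b - 1)))
    (B := fun x => x ^ (p - 1) * (1 - x) ^ (q - (a + b) + δ - 1))]
  · refine setIntegral_congr_fun measurableSet_Ioo ?_
    intro x hx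
    have hu' := refl_mem hu
    have h1 : 0 < 1 - x := sub_pos.2 hx.2
    have h2 := (beta_lin (a := a) (b := b) (A := 1 - x) (B := u * x) ha hb h1 (by nlinarith [mul_mem_U hu hx |>.1])).2
    have e : ∀ τ : ℝ, τ ^ (a - 1) * (1 - τ) ^ (b - 1) * (x ^ (p - 1) * (1 - x) ^ (q - 1) * (1 - (1 - u * τ) * x) ^ (-(a + b)))
       = (x ^ (p - 1) * (1 - x) ^ (q - 1)) * (τ ^ (a - 1) * (1 - τ) ^ (b - 1) * (1 - x + u * x * τ) ^ (-(a + b))) := by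
      intro τ; rw [show 1 - (1 - u * τ) * x = 1 - x + u * x * τ by ring]; ring
    simp only
    simp_rw [e]
    rw [MeasureTheory.integral_const_mul, h2, show q - b - 1 = (q - 1) + -b by ring, Real.rpow_add h1,
      show 1 - (1 - u) * x = 1 - x + u * x by ring]
    unfold Bt; ring
  · simp only [Function.uncurry_def]; fun_prop
  · exact (beta_intg (by linarith) hb).const_mul _
  · exact beta_intg hp hq
  · intro τ hτ x hx
    exact dom_ker hδ (by linarith) hu hτ hx

lemma eul_bd {a b c δ : ℝ} (ha : 0 < a) (hb : 0 < b) (hδ : 0 ≤ δ) (hδc : δ ≤ c)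
    (hbc : 0 < b - c + δ) : ∃ C : ℝ, 0 < C ∧ ∀ y ∈ UU, |eul a b c (1 - y)| ≤ C * y ^ (-δ) := by
  refine ⟨Real.Gamma a * Real.Gamma (b - c + δ) / Real.Gamma (a + (b - c + δ)), ?_, ?_⟩
  · have := Real.Gamma_pos_of_pos ha
    have := Real.Gamma_pos_of_pos hbc
    have := Real.Gamma_pos_of_pos (add_pos ha hbc)
    positivity
  intro y hy
  have hy' := refl_mem hy
  rw [abs_of_pos (eul_pos _ ha hb hy'.2)]
  have := eul_bound ha hb hδ hδc hbc hy'.2 hy'.1.le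
  rwa [show 1 - (1 - y) = y by ring] at this

/-- integrability of M against powers -/
lemma MM_int_bd {p : ℝ} (hp : -(15/16) < p) : IntegrableOn (fun u => MM (1 - u) * u ^ p) UU := by
  obtain ⟨C, hC, h⟩ := MM_bound
  refine Integrable.mono' ((beta_intg (a := p + 15/16) (b := 1) (by linarith) one_pos).const_mul C) (by fun_prop) ?_
  refine (ae_restrict_iff' measurableSet_Ioo).2 (Filter.Eventually.of_forall ?_)
  intro u hu
  have h1 := refl_mem hu
  have h2 := h (1 - u) h1.1.le h1.2
  rw [show 1 - (1 - u) = u by ring] at h2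
  have h3 := Real.rpow_pos_of_pos hu.1 p
  rw [Real.norm_eq_abs, abs_mul, abs_of_pos h3]
  calc _ ≤ C * u ^ (-(1/16:ℝ)) * u ^ p := by gcongr
    _ = _ := by
      rw [mul_assoc, ← Real.rpow_add hu.1, sub_self, Real.rpow_zero, mul_one]; congr 2; ring

noncomputable def gg (y : ℝ) : ℝ := y ^ (-(1/4:ℝ)) * eul (1/4) (5/4) (5/4) (1 - y)
noncomputable def g2 (y : ℝ) : ℝ := y ^ (-(1/4:ℝ)) * eul (3/4) (1/4) (1/4) (1 - y)

@[fun_prop] lemma gg_meas : Measurable gg := by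
  unfold gg
  have := (eul_meas (1/4) (5/4) (5/4)).comp (measurable_const.sub measurable_id : Measurable fun y : ℝ => 1 - y)
  exact Measurable.mul (by fun_prop) this
@[fun_prop] lemma g2_meas : Measurable g2 := by
  unfold g2
  have := (eul_meas (3/4) (1/4) (1/4)).comp (measurable_const.sub measurable_id : Measurable fun y : ℝ => 1 - y)
  exact Measurable.mul (by fun_prop) this

lemma gg_bd : ∃ C : ℝ, 0 < C ∧ ∀ y ∈ UU, |gg y| ≤ C * y ^ (-(3/8:ℝ)) := by
  obtain ⟨C, hC, h⟩ := eul_bd (a := 1/4) (b := 5/4) (c := 5/4) (δ := 1/8) (by norm_num) (by norm_num) (by norm_num)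
    (by norm_num) (by norm_num)
  refine ⟨C, hC, fun y hy => ?_⟩
  have h1 := Real.rpow_pos_of_pos hy.1 (-(1/4:ℝ))
  unfold gg
  rw [abs_mul, abs_of_pos h1]
  calc _ ≤ y ^ (-(1/4:ℝ)) * (C * y ^ (-(1/8:ℝ))) := by gcongr; exact h y hy
    _ = C * (y ^ (-(1/4:ℝ)) * y ^ (-(1/8:ℝ))) := by ring
    _ = _ := by rw [← Real.rpow_add hy.1]; norm_num

lemma g2_bd : ∃ C : ℝ, 0 < C ∧ ∀ y ∈ UU, |g2 y| ≤ C * y ^ (-(1/2:ℝ)) := by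
  obtain ⟨C, hC, h⟩ := eul_bd (a := 3/4) (b := 1/4) (c := 1/4) (δ := 1/4) (by norm_num) (by norm_num) (by norm_num)
    (by norm_num) (by norm_num)
  refine ⟨C, hC, fun y hy => ?_⟩
  have h1 := Real.rpow_pos_of_pos hy.1 (-(1/4:ℝ))
  unfold g2
  rw [abs_mul, abs_of_pos h1]
  calc _ ≤ y ^ (-(1/4:ℝ)) * (C * y ^ (-(1/4:ℝ))) := by gcongr; exact h y hy
    _ = C * (y ^ (-(1/4:ℝ)) * y ^ (-(1/4:ℝ))) := by ring
    _ = _ := by rw [← Real.rpow_add hy.1]; norm_num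

lemma gg_bd' : ∃ C : ℝ, 0 < C ∧ ∀ y ∈ UU, |gg y| ≤ C * y ^ (-(1/2:ℝ)) := by
  obtain ⟨C, hC, h⟩ := gg_bd
  refine ⟨C, hC, fun y hy => (h y hy).trans ?_⟩
  gcongr ?_ * ?_
  exact Real.rpow_le_rpow_of_exponent_ge hy.1 hy.2.le (by norm_num)

noncomputable def k1 (τ : ℝ) : ℝ := (1 - τ) ^ (-(1/2:ℝ))
noncomputable def k2 (τ : ℝ) : ℝ := 1/2 * ((2 * τ - 1) * (1 - τ) ^ (-(1/2:ℝ)))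

@[fun_prop] lemma k1_meas : Measurable k1 := by unfold k1; fun_prop
@[fun_prop] lemma k2_meas : Measurable k2 := by unfold k2; fun_prop

lemma k1_int : IntegrableOn (fun u => k1 u * u ^ (-(1/2:ℝ))) UU := by
  have := beta_intg (a := 1/2) (b := 1/2) (by norm_num) (by norm_num)
  norm_num at this
  unfold k1
  refine this.congr_fun (fun x hx => ?_) measurableSet_Ioo
  norm_num; ring

lemma k2_int : IntegrableOn (fun u => k2 u * u ^ (-(1/2:ℝ))) UU := by
  have := beta_pos_int (a := 1/2) (b := 1/2) 1 (g := fun x => 1/2 * (2 * x - 1)) (by norm_num) (by norm_num) (by fun_prop)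
    (fun x hx => by rw [abs_le]; constructor <;> linarith [hx.1, hx.2])
  norm_num at this
  unfold k2
  refine this.congr_fun (fun x hx => ?_) measurableSet_Ioo
  norm_num; ring

lemma step1 : IntegrableOn (fun y => gg y * mconv (fun u => MM (1 - u)) k1 y) UU ∧
    ∫ y in UU, gg y * mconv (fun u => MM (1 - u)) k1 y = Bt (3/4) (1/2) * ∫ u in UU, g2 u * MM (1 - u) := by
  obtain ⟨C, hC, h⟩ := gg_bd'
  have := mellin_conv (m := fun u => MM (1 - u)) (k := k1) (g := gg) (by fun_prop) (by fun_prop) (by fun_prop)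
    (MM_int_bd (by norm_num)) k1_int h
  refine ⟨this.1, ?_⟩
  rw [this.2, ← MeasureTheory.integral_const_mul]
  refine setIntegral_congr_fun measurableSet_Ioo ?_
  intro u hu
  simp only
  have h2 := frac (a := 3/4) (b := 1/2) (p := 1/4) (q := 5/4) (δ := 1/8) (u := u) (by norm_num) (by norm_num) (by norm_num)
    (by norm_num) (by norm_num) (by norm_num) hu
  have hu' := refl_mem hu
  have h3 : ∫ τ in UU, k1 τ * gg (u * τ) = u ^ (-(1/4:ℝ)) *
     ∫ τ in UU, τ ^ ((3/4:ℝ) - 1) * (1 - τ) ^ ((1/2:ℝ) - 1) * eul (1/4) (5/4) (3/4 + 1/2) (1 - u * τ) := by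
    rw [← MeasureTheory.integral_const_mul]
    refine setIntegral_congr_fun measurableSet_Ioo ?_
    intro τ hτ
    simp only [k1, gg]
    rw [Real.mul_rpow hu.1.le hτ.1.le]
    norm_num
    ring
  rw [h3, h2]
  unfold g2
  rw [eul_swap (a := 1/4) (b := 3/4) hu'.2 hu'.1.le]
  norm_num
  ring

/-- integration by parts in tau -/
lemma tau_parts {A B : ℝ} (hA : 0 < A) (hB : 0 < B) :
    IntegrableOn (fun τ : ℝ => τ ^ (-(1/4:ℝ)) * (1 - τ) ^ (1/2:ℝ) * (A + B * τ) ^ (-(5/4:ℝ))) UU ∧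
    ∫ τ in UU, (2 * τ - 1) * (1 - τ) ^ (-(1/2:ℝ)) * τ ^ (-(1/4:ℝ)) * (A + B * τ) ^ (-(1/4:ℝ)) =
    A / 2 * ∫ τ in UU, τ ^ (-(1/4:ℝ)) * (1 - τ) ^ (1/2:ℝ) * (A + B * τ) ^ (-(5/4:ℝ)) := by
  have hd : ∀ τ ∈ Set.Icc (0:ℝ) 1, A ≤ A + B * τ := by intro τ hτ; nlinarith [hτ.1]
  have bd : ∀ (p : ℝ), p ≤ 0 → ∀ τ ∈ UU, |(A + B * τ) ^ p| ≤ A ^ p := by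
    intro p hp τ hτ
    have h1 := hd τ (Set.Ioo_subset_Icc_self hτ)
    rw [abs_of_pos (Real.rpow_pos_of_pos (by linarith) _)]
    exact Real.rpow_le_rpow_of_nonpos hA h1 hp
  have i1 : IntegrableOn (fun τ : ℝ => τ ^ (-(1/4:ℝ)) * (1 - τ) ^ (1/2:ℝ) * (A + B * τ) ^ (-(5/4:ℝ))) UU := by
    have := beta_pos_int (a := 3/4) (b := 3/2) (A ^ (-(5/4:ℝ))) (g := fun τ => (A + B * τ) ^ (-(5/4:ℝ)))
      (by norm_num) (by norm_num) (by fun_prop) (bd _ (by norm_num))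
    norm_num at this
    norm_num
    exact this
  have i2 : IntegrableOn (fun τ : ℝ => (2 * τ - 1) * (1 - τ) ^ (-(1/2:ℝ)) * τ ^ (-(1/4:ℝ)) * (A + B * τ) ^ (-(1/4:ℝ))) UU := by
    have := beta_pos_int (a := 3/4) (b := 1/2) (A ^ (-(1/4:ℝ))) (g := fun τ => (2 * τ - 1) * (A + B * τ) ^ (-(1/4:ℝ)))
      (by norm_num) (by norm_num) (by fun_prop) (fun τ hτ => by
        rw [abs_mul]
        have h1 := bd (-(1/4)) (by norm_num) τ hτ
        have h2 : |2 * τ - 1| ≤ 1 := by rw [abs_le]; constructor <;> linarith [hτ.1, hτ.2]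
        have := mul_le_mul h2 h1 (abs_nonneg _) (by norm_num)
        linarith)
    norm_num at this
    norm_num
    refine this.congr_fun (fun x hx => ?_) measurableSet_Ioo
    simp only; ring
  refine ⟨i1, ?_⟩
  have h := intervalIntegral.integral_eq_sub_of_hasDerivAt_of_le (a := 0) (b := 1) zero_le_one
    (f := fun τ => -2 * (τ ^ (3/4:ℝ) * (1 - τ) ^ (1/2:ℝ) * (A + B * τ) ^ (-(1/4:ℝ))))
    (f' := fun τ => (2 * τ - 1) * (1 - τ) ^ (-(1/2:ℝ)) * τ ^ (-(1/4:ℝ)) * (A + B * τ) ^ (-(1/4:ℝ)) -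
       A / 2 * (τ ^ (-(1/4:ℝ)) * (1 - τ) ^ (1/2:ℝ) * (A + B * τ) ^ (-(5/4:ℝ)))) ?_ ?_ ?_
  · rw [intervalIntegral.integral_of_le zero_le_one, integral_Ioc_eq_integral_Ioo,
      MeasureTheory.integral_sub i2 (i1.const_mul _), MeasureTheory.integral_const_mul] at h
    norm_num at h
    norm_num
    linarith
  · refine continuousOn_const.mul (ContinuousOn.mul (ContinuousOn.mul ?_ ?_) ?_)
    · exact continuousOn_id.rpow_const fun x _ => Or.inr (by norm_num)
    · exact (continuousOn_const.sub continuousOn_id).rpow_const fun x _ => Or.inr (by norm_num)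
    · refine ContinuousOn.rpow_const (by fun_prop) fun x hx => Or.inl ?_
      have := hd x hx
      linarith
  · intro x hx
    have h1 := hd x (Set.Ioo_subset_Icc_self hx)
    have h1' : 0 < A + B * x := by linarith
    have h2 := sub_pos.2 hx.2
    have h3 := hx.1
    have d1 := (hasDerivAt_id x).rpow_const (p := 3/4) (Or.inl h3.ne')
    have d2 := ((hasDerivAt_id x).const_sub 1).rpow_const (p := 1/2) (Or.inl h2.ne')
    have d3 := (((hasDerivAt_id x).const_mul B).const_add A).rpow_const (p := -(1/4)) (Or.inl h1'.ne')
    convert! ((d1.mul d2).mul d3).const_mul (-2) using 1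
    simp only [id, Pi.mul_apply]
    rw [show (3/4:ℝ) - 1 = -(1/4) by norm_num, show (1/2:ℝ) - 1 = -(1/2) by norm_num,
      show -(1/4:ℝ) - 1 = -(5/4) by norm_num, show (3/4:ℝ) = -(1/4) + 1 by norm_num,
      Real.rpow_add_one h3.ne', show (1/2:ℝ) = -(1/2) + 1 by norm_num, Real.rpow_add_one h2.ne',
      show (-(1/4:ℝ)) = -(5/4) + 1 by norm_num, Real.rpow_add_one h1'.ne']
    norm_num
    ring
  · rw [intervalIntegrable_iff_integrableOn_Ioo_of_le zero_le_one]
    exact i2.sub (i1.const_mul _)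

lemma inner2 {w : ℝ} (hw : w ∈ UU) : ∫ τ in UU, k2 τ * g2 (w * τ) =
    1/4 * w ^ (-(1/4:ℝ)) * ∫ τ in UU, τ ^ ((3/4:ℝ) - 1) * (1 - τ) ^ ((3/2:ℝ) - 1) * eul (3/4) (5/4) (5/4) (1 - w * τ) := by
  have s1 : ∫ τ in UU, k2 τ * g2 (w * τ) = 1/2 * w ^ (-(1/4:ℝ)) * ∫ τ in UU, ∫ x in UU,
      (2 * τ - 1) * (τ ^ ((3/4:ℝ) - 1) * (1 - τ) ^ ((1/2:ℝ) - 1) *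
        (x ^ ((3/4:ℝ) - 1) * (1 - x) ^ ((1/4:ℝ) - 1) * (1 - (1 - w * τ) * x) ^ (-(1/4:ℝ)))) := by
    simp_rw [MeasureTheory.integral_const_mul]
    rw [← MeasureTheory.integral_const_mul]
    refine setIntegral_congr_fun measurableSet_Ioo ?_
    intro τ hτ
    simp only [k2, g2]
    rw [Real.mul_rpow hw.1.le hτ.1.le]
    unfold eul
    norm_num only
    ring
  have s2 := swap_dom (F := fun τ x => (2 * τ - 1) * (τ ^ ((3/4:ℝ) - 1) * (1 - τ) ^ ((1/2:ℝ) - 1) *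
        (x ^ ((3/4:ℝ) - 1) * (1 - x) ^ ((1/4:ℝ) - 1) * (1 - (1 - w * τ) * x) ^ (-(1/4:ℝ)))))
    (by simp only [Function.uncurry_def]; fun_prop)
    ((beta_intg (a := 3/4 - 1/8) (b := 1/2) (by norm_num) (by norm_num)).const_mul (w ^ (-(1/8:ℝ))))
    (beta_intg (a := 3/4) (b := 1/4 - 1/4 + 1/8) (by norm_num) (by norm_num)) (by
      intro τ hτ x hx
      have := dom_ker (a := 3/4) (b := 1/2) (p := 3/4) (q := 1/4) (c := 1/4) (δ := 1/8) (by norm_num) (by norm_num) hw hτ hx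
      rw [abs_mul]
      refine le_trans (mul_le_of_le_one_left (abs_nonneg _) ?_) this
      rw [abs_le]; constructor <;> linarith [hτ.1, hτ.2])
  have s3 := swap_dom (F := fun τ x => (τ ^ ((3/4:ℝ) - 1) * (1 - τ) ^ ((3/2:ℝ) - 1) *
        (x ^ ((3/4:ℝ) - 1) * (1 - x) ^ ((5/4:ℝ) - 1) * (1 - (1 - w * τ) * x) ^ (-(5/4:ℝ)))))
    (by simp only [Function.uncurry_def]; fun_prop)
    ((beta_intg (a := 3/4 - 1/8) (b := 3/2) (by norm_num) (by norm_num)).const_mul (w ^ (-(1/8:ℝ))))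
    (beta_intg (a := 3/4) (b := 5/4 - 5/4 + 1/8) (by norm_num) (by norm_num)) (by
      intro τ hτ x hx
      exact dom_ker (a := 3/4) (b := 3/2) (p := 3/4) (q := 5/4) (c := 5/4) (δ := 1/8) (by norm_num) (by norm_num) hw hτ hx)
  rw [s1, s2]
  unfold eul
  simp_rw [← MeasureTheory.integral_const_mul ((_:ℝ) ^ ((3/4:ℝ) - 1) * (1 - _) ^ ((3/2:ℝ) - 1))]
  rw [s3, show 1/4 * w ^ (-(1/4:ℝ)) = 1/2 * w ^ (-(1/4:ℝ)) * (1/2) by ring, mul_assoc (1/2 * w ^ (-(1/4:ℝ)))]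
  congr 1
  rw [← MeasureTheory.integral_const_mul]
  refine setIntegral_congr_fun measurableSet_Ioo ?_
  intro x hx
  have h1 := sub_pos.2 hx.2
  have := (tau_parts (A := 1 - x) (B := w * x) h1 (mul_pos hw.1 hx.1)).2
  have e1 : ∀ τ : ℝ, (2 * τ - 1) * (τ ^ ((3/4:ℝ) - 1) * (1 - τ) ^ ((1/2:ℝ) - 1) *
        (x ^ ((3/4:ℝ) - 1) * (1 - x) ^ ((1/4:ℝ) - 1) * (1 - (1 - w * τ) * x) ^ (-(1/4:ℝ)))) =
        (x ^ ((3/4:ℝ) - 1) * (1 - x) ^ ((1/4:ℝ) - 1)) *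
       ((2 * τ - 1) * (1 - τ) ^ (-(1/2:ℝ)) * τ ^ (-(1/4:ℝ)) * (1 - x + w * x * τ) ^ (-(1/4:ℝ))) := by
    intro τ
    rw [show 1 - (1 - w * τ) * x = 1 - x + w * x * τ by ring]; norm_num only; ring
  have e2 : ∀ τ : ℝ, (τ ^ ((3/4:ℝ) - 1) * (1 - τ) ^ ((3/2:ℝ) - 1) *
        (x ^ ((3/4:ℝ) - 1) * (1 - x) ^ ((5/4:ℝ) - 1) * (1 - (1 - w * τ) * x) ^ (-(5/4:ℝ)))) =
        (x ^ ((3/4:ℝ) - 1) * (1 - x) ^ ((5/4:ℝ) - 1)) *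
        (τ ^ (-(1/4:ℝ)) * (1 - τ) ^ (1/2:ℝ) * (1 - x + w * x * τ) ^ (-(5/4:ℝ))) := by
    intro τ
    rw [show 1 - (1 - w * τ) * x = 1 - x + w * x * τ by ring]; norm_num only; ring
  simp only
  simp_rw [e1, e2]
  rw [MeasureTheory.integral_const_mul, MeasureTheory.integral_const_mul, this,
    show (5/4:ℝ) - 1 = (1/4 - 1) + 1 by norm_num, Real.rpow_add_one h1.ne']
  ring

lemma mconv_Z {q : ℝ} (hq : q ∈ UU) : mconv (fun u => u ^ (1/2:ℝ) * (1 - u) ^ (-(1/4:ℝ)))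
    (fun x => x ^ (-(1/4:ℝ)) * (1 - x) ^ (-(1/4:ℝ))) q = Bt (3/4) (3/4) * (q ^ (-(1/4:ℝ)) * (1 - q) ^ (1/2:ℝ)) := by
  rw [mconv_eq _ _ hq]
  have h := beta_val (a := 3/4) (b := 3/4) (by norm_num) (by norm_num)
  have hq' := refl_mem hq
  have := cov (f := fun s => q + (1 - q) * s) (f' := fun _ => 1 - q) (a := 0) (b := 1) zero_lt_one (by fun_prop)
    (fun x _ => by simpa using ((hasDerivAt_id x).const_mul (1 - q)).const_add q) (fun x hx => hq'.1)
    (fun u => u ^ (1/2:ℝ) * (1 - u) ^ (-(1/4:ℝ)) * ((q/u) ^ (-(1/4:ℝ)) * (1 - q/u) ^ (-(1/4:ℝ))) / u)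
  rw [show q + (1 - q) * 0 = q by ring, show q + (1 - q) * 1 = 1 by ring] at this
  rw [this]
  unfold Bt
  rw [← h, ← MeasureTheory.integral_mul_const]
  refine setIntegral_congr_fun measurableSet_Ioo ?_
  intro s hs
  have h1 := sub_pos.2 hs.2
  have h2 := hs.1
  have h3 := hq.1
  have h4 := hq'.1
  have h5 : 0 < q + (1 - q) * s := by positivity
  simp only
  have e1 : 1 - q / (q + (1 - q) * s) = (1 - q) * s / (q + (1 - q) * s) := by
    rw [eq_div_iff h5.ne', sub_mul, div_mul_cancel₀ _ h5.ne']; ring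
  rw [e1, show 1 - (q + (1 - q) * s) = (1 - q) * (1 - s) by ring, Real.mul_rpow h4.le h1.le,
    Real.div_rpow h3.le h5.le, Real.div_rpow (by positivity) h5.le, Real.mul_rpow h4.le h2.le]
  have e3 : (q + (1 - q) * s) ^ (1/2:ℝ) = (q + (1 - q) * s) ^ (-(1/4:ℝ)) * (q + (1 - q) * s) ^ (-(1/4:ℝ)) * (q + (1 - q) * s) := by
    rw [← Real.rpow_add h5, ← Real.rpow_add_one h5.ne']; norm_num
  have e4 : (1 - q) ^ (1/2:ℝ) = (1 - q) ^ (-(1/4:ℝ)) * (1 - q) ^ (-(1/4:ℝ)) * (1 - q) := by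
    rw [← Real.rpow_add h4, ← Real.rpow_add_one h4.ne']; norm_num
  rw [e3, e4]
  have p1 := Real.rpow_pos_of_pos h5 (-(1/4:ℝ))
  norm_num only
  norm_num only at p1
  field_simp

lemma Z_val : ∫ τ in UU, τ ^ ((3/4:ℝ) - 1) * (1 - τ) ^ ((3/2:ℝ) - 1) * eul (3/4) (3/4) (3/4) (1 - τ) = Bt (3/4) (3/4) ^ 2 := by
  rw [cov_refl]
  have := (mellin_conv0 (m := fun u => u ^ (1/2:ℝ) * (1 - u) ^ (-(1/4:ℝ)))
     (k := fun x => x ^ (-(1/4:ℝ)) * (1 - x) ^ (-(1/4:ℝ))) (g := fun q => (1 - q) ^ (-(3/4:ℝ))) (by fun_prop) (by fun_prop) (by fun_prop)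
     (beta_intg (a := 3/2) (b := 3/8) (by norm_num) (by norm_num)) (beta_intg (a := 3/4) (b := 3/8) (by norm_num) (by norm_num)) (by
      intro u hu x hx
      have h := split_bd (c := 3/4) (δ := 3/8) (by norm_num) (by norm_num) hu.2 hu.1.le hx
      have a1 := Real.rpow_pos_of_pos hu.1 (1/2)
      have a2 := Real.rpow_pos_of_pos (sub_pos.2 hu.2) (-(1/4))
      have a3 := Real.rpow_pos_of_pos hx.1 (-(1/4))
      have a4 := Real.rpow_pos_of_pos (sub_pos.2 hx.2) (-(1/4))
      have a5 := Real.rpow_pos_of_pos (one_sub_pos hu.2 hx) (-(3/4))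
      rw [abs_of_pos (by positivity)]
      calc _ ≤ u ^ (1/2:ℝ) * (1 - u) ^ (-(1/4:ℝ)) * (x ^ (-(1/4:ℝ)) * (1 - x) ^ (-(1/4:ℝ)) *
              ((1 - u) ^ (-(3/8:ℝ)) * (1 - x) ^ (-(3/4 - 3/8:ℝ)))) := by gcongr
        _ = _ := by
          rw [show (3/8:ℝ) - 1 = -(1/4) + -(3/8) by norm_num, Real.rpow_add (sub_pos.2 hu.2), Real.rpow_add (sub_pos.2 hx.2)]
          norm_num only; ring)).2
  have e : ∫ x in UU, (1 - x) ^ ((3/4:ℝ) - 1) * (1 - (1 - x)) ^ ((3/2:ℝ) - 1) * eul (3/4) (3/4) (3/4) (1 - (1 - x)) =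
     ∫ u in UU, (fun u => u ^ (1/2:ℝ) * (1 - u) ^ (-(1/4:ℝ))) u * ∫ τ in UU,
     (fun x => x ^ (-(1/4:ℝ)) * (1 - x) ^ (-(1/4:ℝ))) τ * (fun q => (1 - q) ^ (-(3/4:ℝ))) (u * τ) := by
    refine setIntegral_congr_fun measurableSet_Ioo ?_
    intro u hu
    simp only [eul]
    rw [show 1 - (1 - u) = u by ring]
    norm_num only
    ring
  rw [e, ← this, sq]
  nth_rewrite 2 [Bt]
  have hh := beta_val (a := 3/4) (b := 3/4) (by norm_num) (by norm_num)
  rw [← hh, ← MeasureTheory.integral_const_mul]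
  refine setIntegral_congr_fun measurableSet_Ioo ?_
  intro q hq
  simp only
  rw [mconv_Z hq]
  have h4 := sub_pos.2 hq.2
  have : (1 - q) ^ (-(3/4:ℝ)) * (1 - q) ^ (1/2:ℝ) = (1 - q) ^ (-(1/4:ℝ)) := by
    rw [← Real.rpow_add h4]; norm_num
  rw [show (3/4:ℝ) - 1 = -(1/4) by norm_num, ← this]
  ring

lemma step2 : ∫ u in UU, g2 u * MM (1 - u) = 1/4 * Bt (3/4) (1/2) * Bt (3/4) (3/4) ^ 2 := by
  obtain ⟨C, hC, h⟩ := g2_bd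
  have s0 : ∫ u in UU, g2 u * MM (1 - u) = ∫ u in UU, g2 u * mconv k1 k2 u := by
    refine setIntegral_congr_fun measurableSet_Ioo ?_
    intro u hu
    simp only
    rw [F5 hu]; rfl
  rw [s0, (mellin_conv (by fun_prop) (by fun_prop) (by fun_prop) k1_int k2_int h).2]
  obtain ⟨C', hC', h'⟩ := eul_bd (a := 3/4) (b := 5/4) (c := 5/4) (δ := 1/8) (by norm_num) (by norm_num) (by norm_num)
    (by norm_num) (by norm_num)
  have mE := eul_meas (3/4) (5/4) (5/4)
  have s1 : ∫ w in UU, k1 w * ∫ τ in UU, k2 τ * g2 (w * τ) = 1/4 * ∫ w in UU, ∫ τ in UU,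
     (w ^ ((3/4:ℝ) - 1) * (1 - w) ^ ((1/2:ℝ) - 1) * (τ ^ ((3/4:ℝ) - 1) * (1 - τ) ^ ((3/2:ℝ) - 1) * eul (3/4) (5/4) (5/4) (1 - w * τ))) := by
    simp_rw [MeasureTheory.integral_const_mul]
    rw [← MeasureTheory.integral_const_mul]
    refine setIntegral_congr_fun measurableSet_Ioo ?_
    intro w hw
    simp only
    rw [inner2 hw, k1]
    norm_num only
    ring
  rw [s1, swap_dom (A := fun w => C' * (w ^ ((5/8:ℝ) - 1) * (1 - w) ^ ((1/2:ℝ) - 1)))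
     (B := fun τ => τ ^ ((5/8:ℝ) - 1) * (1 - τ) ^ ((3/2:ℝ) - 1)), ← Z_val, mul_assoc]
  · refine congrArg (fun z => 1/4 * z) ?_
    rw [← MeasureTheory.integral_const_mul]
    refine setIntegral_congr_fun measurableSet_Ioo ?_
    intro τ hτ
    have h2 := frac (a := 3/4) (b := 1/2) (p := 3/4) (q := 5/4) (δ := 1/8) (u := τ) (by norm_num) (by norm_num) (by norm_num)
      (by norm_num) (by norm_num) (by norm_num) hτ
    norm_num only at h2
    have e : ∀ w : ℝ, (w ^ ((3/4:ℝ) - 1) * (1 - w) ^ ((1/2:ℝ) - 1) * (τ ^ ((3/4:ℝ) - 1) * (1 - τ) ^ ((3/2:ℝ) - 1) * eul (3/4) (5/4) (5/4) (1 - w * τ)))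
       = (τ ^ ((3/4:ℝ) - 1) * (1 - τ) ^ ((3/2:ℝ) - 1)) * (w ^ (-(1/4:ℝ)) * (1 - w) ^ (-(1/2:ℝ)) * eul (3/4) (5/4) (5/4) (1 - τ * w)) := by
      intro w; rw [mul_comm w τ]; norm_num only; ring
    simp only
    simp_rw [e]
    rw [MeasureTheory.integral_const_mul, h2]
    ring
  · simp only [Function.uncurry_def]
    have : Measurable fun p : ℝ × ℝ => eul (3/4) (5/4) (5/4) (1 - p.1 * p.2) := mE.comp (by fun_prop)
    fun_prop
  · exact (beta_intg (by norm_num) (by norm_num)).const_mul _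
  · exact beta_intg (by norm_num) (by norm_num)
  · intro w hw τ hτ
    have a1 := Real.rpow_pos_of_pos hw.1 (3/4 - 1)
    have a2 := Real.rpow_pos_of_pos (sub_pos.2 hw.2) (1/2 - 1)
    have a3 := Real.rpow_pos_of_pos hτ.1 (3/4 - 1)
    have a4 := Real.rpow_pos_of_pos (sub_pos.2 hτ.2) (3/2 - 1)
    have a5 := h' _ (mul_mem_U hw hτ)
    rw [abs_mul, abs_of_pos (mul_pos a1 a2), abs_mul, abs_of_pos (mul_pos a3 a4)]
    calc _ ≤ w ^ ((3/4:ℝ) - 1) * (1 - w) ^ ((1/2:ℝ) - 1) * (τ ^ ((3/4:ℝ) - 1) * (1 - τ) ^ ((3/2:ℝ) - 1) *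
             (C' * (w * τ) ^ (-(1/8:ℝ)))) := by gcongr
      _ = _ := by
        rw [Real.mul_rpow hw.1.le hτ.1.le, show (5/8:ℝ) - 1 = (3/4 - 1) + -(1/8) by norm_num, Real.rpow_add hw.1,
          Real.rpow_add hτ.1]; ring

lemma step12 : IntegrableOn (fun y => gg y * mconv (fun u => MM (1 - u)) k1 y) UU ∧
    ∫ y in UU, gg y * mconv (fun u => MM (1 - u)) k1 y = 1/4 * Bt (3/4) (1/2) ^ 2 * Bt (3/4) (3/4) ^ 2 := by
  refine ⟨step1.1, ?_⟩
  rw [step1.2, step2]; ring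

lemma poly_det {h : ℝ → ℝ} (hi : IntegrableOn h UU) (hm : ∀ n : ℕ, ∫ y in UU, y ^ n * h y = 0) :
    ∀ᵐ y, y ∈ UU → h y = 0 := by
  have him : ∀ n : ℕ, IntegrableOn (fun y => y ^ n * h y) UU := by
    intro n
    refine Integrable.bdd_mul (c := 1) hi (by fun_prop) ?_
    refine (ae_restrict_iff' measurableSet_Ioo).2 (Filter.Eventually.of_forall ?_)
    intro y hy
    rw [Real.norm_eq_abs, abs_of_nonneg (pow_nonneg hy.1.le _)]
    exact pow_le_one₀ hy.1.le hy.2.le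
  have hp : ∀ p : Polynomial ℝ, IntegrableOn (fun y => p.eval y * h y) UU ∧ ∫ y in UU, p.eval y * h y = 0 := by
    intro p
    have e : ∀ y, p.eval y * h y = ∑ i ∈ Finset.range (p.natDegree + 1), p.coeff i * (y ^ i * h y) := by
      intro y; rw [Polynomial.eval_eq_sum_range, Finset.sum_mul]
      refine Finset.sum_congr rfl fun i _ => by ring
    simp_rw [e]
    refine ⟨integrable_finsetSum _ fun i _ => (him i).const_mul _, ?_⟩
    rw [integral_finsetSum _ fun i _ => (him i).const_mul _]
    refine Finset.sum_eq_zero fun i _ => ?_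
    rw [MeasureTheory.integral_const_mul, hm, mul_zero]
  refine isOpen_Ioo.ae_eq_zero_of_integral_contDiff_smul_eq_zero hi.locallyIntegrableOn ?_
  intro g hg hgs hgt
  have e : ∫ x, g x • h x = ∫ x in UU, g x * h x := by
    rw [← setIntegral_eq_integral_of_forall_compl_eq_zero (s := UU)]
    · rfl
    · intro x hx
      rw [image_eq_zero_of_notMem_tsupport (fun hh => hx (hgt hh)), zero_smul]
  rw [e]
  have gi : IntegrableOn (fun y => g y * h y) UU := by
    obtain ⟨C, hC⟩ := hgs.exists_bound_of_continuous hg.continuous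
    exact Integrable.bdd_mul (c := C) hi hg.continuous.aestronglyMeasurable (Filter.Eventually.of_forall hC)
  by_contra hne
  have hpos : 0 < |∫ x in UU, g x * h x| := abs_pos.2 hne
  set I := |∫ x in UU, g x * h x|
  set N := ∫ x in UU, |h x| with hN
  have hN0 : 0 ≤ N := MeasureTheory.integral_nonneg fun x => abs_nonneg _
  obtain ⟨p, hp2⟩ := exists_polynomial_near_of_continuousOn 0 1 g hg.continuous.continuousOn (I / (N + 1)) (by positivity)
  have : I ≤ I / (N + 1) * N := by
    have e2 : ∫ x in UU, g x * h x = ∫ x in UU, (g x * h x - p.eval x * h x) := by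
      rw [MeasureTheory.integral_sub gi (hp p).1, (hp p).2, sub_zero]
    calc I = |∫ x in UU, (g x * h x - p.eval x * h x)| := by rw [← e2]
      _ ≤ ∫ x in UU, |g x * h x - p.eval x * h x| := abs_integral_le_integral_abs
      _ ≤ ∫ x in UU, I / (N + 1) * |h x| := by
        refine setIntegral_mono_on (gi.sub (hp p).1).abs (hi.abs.const_mul _) measurableSet_Ioo ?_
        intro x hx
        rw [← sub_mul, abs_mul, abs_sub_comm]
        have := (hp2 x ⟨hx.1.le, hx.2.le⟩).le
        gcongr
      _ = _ := by rw [MeasureTheory.integral_const_mul]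
  have h3 : I / (N + 1) * N < I := by
    rw [div_mul_eq_mul_div, div_lt_iff₀ (by positivity)]; nlinarith
  linarith

lemma cov4 (G : ℝ → ℝ) : ∫ y in UU, G y = ∫ t in Set.Ioo (0:ℝ) (1/2), 4 * (1 - 2 * t) * G (4 * (t * (1 - t))) := by
  have := cov (f := fun t => 4 * (t * (1 - t))) (f' := fun t => 4 * (1 - 2 * t)) (a := 0) (b := 1/2) (by norm_num) (by fun_prop)
    (fun x _ => by
      convert! ((hasDerivAt_id x).mul ((hasDerivAt_id x).const_sub 1)).const_mul 4 using 1
      simp only [id]; ring) (fun x hx => by linarith [hx.2]) G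
  norm_num at this ⊢
  exact this

lemma cov4_int (G : ℝ → ℝ) : IntegrableOn G UU ↔ IntegrableOn (fun t => 4 * (1 - 2 * t) * G (4 * (t * (1 - t)))) (Set.Ioo (0:ℝ) (1/2)) := by
  have := cov_int (f := fun t => 4 * (t * (1 - t))) (f' := fun t => 4 * (1 - 2 * t)) (a := 0) (b := 1/2) (by norm_num) (by fun_prop)
    (fun x _ => by
      convert! ((hasDerivAt_id x).mul ((hasDerivAt_id x).const_sub 1)).const_mul 4 using 1
      simp only [id]; ring) (fun x hx => by linarith [hx.2]) G
  norm_num at this ⊢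
  exact this

lemma half_full {φ : ℝ → ℝ} (h : IntegrableOn φ UU) : ∫ t in Set.Ioo (0:ℝ) (1/2), (φ t + φ (1 - t)) = ∫ t in UU, φ t := by
  have h1 : IntegrableOn φ (Set.Ioo (0:ℝ) (1/2)) := h.mono_set (Set.Ioo_subset_Ioo_right (by norm_num))
  have h2 : IntegrableOn (fun t => φ (1 - t)) (Set.Ioo (0:ℝ) (1/2)) :=
    ((cov_refl_int φ).1 h).mono_set (Set.Ioo_subset_Ioo_right (by norm_num))
  rw [MeasureTheory.integral_add h1 h2]
  rw [← integral_Ioc_eq_integral_Ioo, ← integral_Ioc_eq_integral_Ioo, ← integral_Ioc_eq_integral_Ioo,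
    ← intervalIntegral.integral_of_le (by norm_num), ← intervalIntegral.integral_of_le (by norm_num),
     ← intervalIntegral.integral_of_le (by norm_num)]
  rw [intervalIntegral.integral_comp_sub_left (fun t => φ t) 1]
  norm_num
  have h3 := (intervalIntegrable_iff_integrableOn_Ioo_of_le (a := (0:ℝ)) (b := 1) (μ := volume) zero_le_one).2 h
  rw [intervalIntegral.integral_add_adjacent_intervals]
  · refine h3.mono_set ?_
    rw [Set.uIcc_of_le (by norm_num), Set.uIcc_of_le (by norm_num)]
    exact Set.Icc_subset_Icc (by norm_num) (by norm_num)
  · refine h3.mono_set ?_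
    rw [Set.uIcc_of_le (by norm_num), Set.uIcc_of_le (by norm_num)]
    exact Set.Icc_subset_Icc (by norm_num) (by norm_num)

lemma ftc {F F' : ℝ → ℝ} (hc : ContinuousOn F (Set.Icc 0 1)) (hd : ∀ t ∈ UU, HasDerivAt F (F' t) t) (hi : IntegrableOn F' UU) :
    ∫ t in UU, F' t = F 1 - F 0 := by
  rw [← integral_Ioc_eq_integral_Ioo, ← intervalIntegral.integral_of_le zero_le_one]
  exact intervalIntegral.integral_eq_sub_of_hasDerivAt_of_le zero_le_one hc hd
    ((intervalIntegrable_iff_integrableOn_Ioo_of_le zero_le_one).2 hi)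

lemma MMp_int {p : ℝ → ℝ} (hp : Continuous p) (k : ℕ) (hk : k ≤ 3) : IntegrableOn (fun t => p t * MM t ^ k) UU := by
  obtain ⟨C, hC, h⟩ := MM_bound
  obtain ⟨D, hD⟩ := (isCompact_Icc (a := (0:ℝ)) (b := 1)).exists_bound_of_continuousOn hp.continuousOn
  refine Integrable.mono' ((beta_intg (a := 1) (b := 1 - k * (1/16)) one_pos (by
    have : (k:ℝ) ≤ 3 := by exact_mod_cast hk
    linarith)).const_mul (D * C ^ k)) (by have := hp.measurable; fun_prop) ?_
  refine (ae_restrict_iff' measurableSet_Ioo).2 (Filter.Eventually.of_forall ?_)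
  intro t ht
  have h2 := h t ht.1.le ht.2
  have h3 := hD t ⟨ht.1.le, ht.2.le⟩
  rw [norm_mul, norm_pow]
  have h5 : (1 - t) ^ (1 - k * (1/16:ℝ) - 1) = ((1 - t) ^ (-(1/16:ℝ))) ^ k := by
    rw [← Real.rpow_mul_natCast (by linarith [ht.2])]; congr 1; ring
  rw [h5]
  norm_num
  calc ‖p t‖ * |MM t| ^ k ≤ D * (C * (1 - t) ^ (-(1/16:ℝ))) ^ k := by
        have : 0 ≤ D := (norm_nonneg _).trans h3
        gcongr
    _ = _ := by rw [mul_pow]; norm_num; ring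

noncomputable def AA (n : ℕ) : ℝ := ∫ t in UU, (1 - 2 * t) * (t * (1 - t)) ^ n * MM t ^ 2
noncomputable def en (n : ℕ) : ℝ := ∫ t in UU, (1 - t) ^ n * MM t

lemma AA_int (n : ℕ) : IntegrableOn (fun t => (1 - 2 * t) * (t * (1 - t)) ^ n * MM t ^ 2) UU :=
  MMp_int (by fun_prop) 2 (by norm_num)
lemma en_int (n : ℕ) : IntegrableOn (fun t => (1 - t) ^ n * MM t) UU := by
  simpa using MMp_int (p := fun t => (1 - t) ^ n) (by fun_prop) 1 (by norm_num)

lemma AA_zero : AA 0 = 1/3 := by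
  have := ftc (F := fun t => VV t ^ 2 + 3/4 * (t * ((1 - t) * MM t ^ 2))) (F' := fun t => 3/4 * ((1 - 2 * t) * (t * (1 - t)) ^ 0 * MM t ^ 2))
    (by
      have := VV_contI
      have := oneM2_cont
      fun_prop) (by
      intro t ht
      have h1 := ht.1.ne'
      have h2 := (sub_pos.2 ht.2).ne'
      convert! ((VV_deriv ht.2).pow 2).add (((hasDerivAt_id t).mul (((hasDerivAt_id t).const_sub 1).mul ((MM_deriv ht).pow 2))).const_mul (3/4)) using 1
      simp only [id, Pi.mul_apply, Pi.pow_apply, Pi.add_apply, Pi.sub_apply]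
      push_cast
      field_simp
      ring) ((AA_int 0).const_mul _)
  rw [MeasureTheory.integral_const_mul] at this
  simp only [VV_one, VV_zero] at this
  norm_num at this
  unfold AA
  norm_num
  linarith

lemma AA_succ (m : ℕ) : ((m:ℝ) + 1) ^ 3 * AA m = 4 * (m + 1 + 3/2) * ((m + 1) ^ 2 - 1/4) * AA (m + 1) := by
  have := ftc (F := fun t => (t * (1 - t)) ^ (m+1) * VV t ^ 2 - (m + 1) * (t * (1 - t)) ^ m * t * (1 - 2 * t) * ((1 - t) * MM t) * VV t
       + ((m+1)^2/2 * (t * (1 - t)) ^ m + (3/4 - 2 * (m+1)^2 - (m+1)) * (t * (1 - t)) ^ (m+1)) * (t * ((1 - t) * MM t ^ 2)))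
    (F' := fun t => ((m:ℝ)+1)^3/2 * ((1 - 2 * t) * (t * (1 - t)) ^ m * MM t ^ 2)
       - 2 * ((m:ℝ) + 1 + 3/2) * ((m + 1) ^ 2 - 1/4) * ((1 - 2 * t) * (t * (1 - t)) ^ (m+1) * MM t ^ 2))
    (by
      have := VV_contI
      have := oneM2_cont
      have := oneM_cont
      fun_prop) (by
      intro t ht
      have h1 := ht.1.ne'
      have h2 := (sub_pos.2 ht.2).ne'
      have dq := (hasDerivAt_id t).mul ((hasDerivAt_id t).const_sub 1)
      have d1 := (hasDerivAt_id t).const_sub 1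
      have d2 := ((hasDerivAt_id t).const_mul 2).const_sub 1
      have dM := MM_deriv ht
      have dV := VV_deriv ht.2
      have e : (fun t => (t * (1 - t)) ^ (m+1) * VV t ^ 2 - (m + 1) * (t * (1 - t)) ^ m * t * (1 - 2 * t) * ((1 - t) * MM t) * VV t
       + ((m+1)^2/2 * (t * (1 - t)) ^ m + (3/4 - 2 * (m+1)^2 - (m+1)) * (t * (1 - t)) ^ (m+1)) * (t * ((1 - t) * MM t ^ 2))) =
        (fun t => (t * (1 - t)) ^ (m+1) * (VV t ^ 2 - (m + 1) * ((1 - 2 * t) * (MM t * VV t))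
       + ((m+1)^2/2 + (3/4 - 2 * (m+1)^2 - (m+1)) * (t * (1 - t))) * MM t ^ 2)) := by
        ext t; ring
      rw [e]
      convert! (dq.pow (m+1)).mul (((dV.pow 2).sub ((d2.mul (dM.mul dV)).const_mul ((m:ℝ)+1))).add
        (((dq.const_mul ((3/4:ℝ) - 2 * ((m:ℝ)+1)^2 - (m+1))).const_add (((m:ℝ)+1)^2/2)).mul (dM.pow 2))) using 1
      simp only [id, Nat.add_sub_cancel, Pi.mul_apply, Pi.pow_apply, Pi.add_apply, Pi.sub_apply]
      push_cast
      field_simp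
      ring) (Integrable.sub ((AA_int m).const_mul _) ((AA_int (m+1)).const_mul _))
  rw [MeasureTheory.integral_sub ((AA_int m).const_mul _) ((AA_int (m+1)).const_mul _), MeasureTheory.integral_const_mul, MeasureTheory.integral_const_mul] at this
  simp only [VV_zero] at this
  unfold AA
  norm_num at this ⊢
  linarith

lemma en_zero : en 0 = 2/3 := by
  have := ftc (F := VV) (F' := fun t => -(3/4) * MM t) VV_contI (fun t ht => VV_deriv ht.2) (by
      have h := en_int 0
      simp only [pow_zero, one_mul] at h
      exact Integrable.const_mul h _)
  rw [MeasureTheory.integral_const_mul] at this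
  simp only [VV_one, VV_zero] at this
  unfold en
  norm_num
  linarith

lemma en_succ (m : ℕ) : ((m:ℝ) + 1) ^ 2 * en m = (m + 1 + 3/2) * ((m + 1) - 1/2) * en (m + 1) := by
  have := ftc (F := fun t => (1 - t) ^ (m+1) * VV t + (m + 1) * t * (1 - t) ^ m * ((1 - t) * MM t))
    (F' := fun t => ((m:ℝ) + 1 + 3/2) * ((m + 1) - 1/2) * ((1 - t) ^ (m+1) * MM t) - (m+1)^2 * ((1 - t) ^ m * MM t))
    (by
      have := VV_contI
      have := oneM_cont
      fun_prop) (by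
      intro t ht
      have h1 := ht.1.ne'
      have h2 := (sub_pos.2 ht.2).ne'
      have d1 := (hasDerivAt_id t).const_sub 1
      have dM := MM_deriv ht
      have dV := VV_deriv ht.2
      have e : (fun t => (1 - t) ^ (m+1) * VV t + (m + 1) * t * (1 - t) ^ m * ((1 - t) * MM t)) =
        (fun t => (1 - t) ^ (m+1) * (VV t + (m + 1) * t * MM t)) := by
        ext t; ring
      rw [e]
      convert! (d1.pow (m+1)).mul (dV.add (((hasDerivAt_id t).const_mul ((m:ℝ)+1)).mul dM)) using 1
      simp only [id, Nat.add_sub_cancel, Pi.mul_apply, Pi.pow_apply, Pi.add_apply]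
      push_cast
      field_simp
      ring) (Integrable.sub ((en_int (m+1)).const_mul _) ((en_int m).const_mul _))
  rw [MeasureTheory.integral_sub ((en_int (m+1)).const_mul _) ((en_int m).const_mul _), MeasureTheory.integral_const_mul, MeasureTheory.integral_const_mul] at this
  simp only [VV_zero] at this
  unfold en
  norm_num at this ⊢
  linarith

noncomputable def ff (y : ℝ) : ℝ := MM ((1 - √(1 - y))/2) ^ 2 - MM ((1 + √(1 - y))/2) ^ 2

lemma sqrt_q {t : ℝ} (ht : t < 1/2) : √(1 - 4 * (t * (1 - t))) = 1 - 2 * t := by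
  rw [show 1 - 4 * (t * (1 - t)) = (1 - 2 * t) ^ 2 by ring, Real.sqrt_sq (by linarith)]

lemma ff_q {t : ℝ} (ht : t < 1/2) : ff (4 * (t * (1 - t))) = MM t ^ 2 - MM (1 - t) ^ 2 := by
  unfold ff
  rw [sqrt_q ht]; congr 3 <;> ring

lemma ff_int : IntegrableOn ff UU := by
  rw [cov4_int]
  have h0 := (AA_int 0)
  have h1 := (cov_refl_int _).1 h0
  have h2 := (Integrable.add h0 h1).const_mul 4
  have h3 : IntegrableOn _ (Set.Ioo (0:ℝ) (1/2)) := IntegrableOn.mono_set h2 (Set.Ioo_subset_Ioo_right (by norm_num))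
  refine h3.congr_fun ?_ measurableSet_Ioo
  intro t ht
  simp only [Pi.add_apply]
  rw [ff_q ht.2]; ring

lemma ff_mom (n : ℕ) : ∫ y in UU, y ^ n * ff y = 4 ^ (n+1) * AA n := by
  rw [cov4, AA, ← half_full (AA_int n), ← MeasureTheory.integral_const_mul]
  refine setIntegral_congr_fun measurableSet_Ioo ?_
  intro t ht
  simp only
  rw [ff_q ht.2, mul_pow 4 (t * (1 - t)), show (1 - t) * (1 - (1 - t)) = t * (1 - t) by ring]
  ring

noncomputable def ffR : ℝ → ℝ := mconv (fun u => MM (1 - u)) k1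

lemma ffR_mom (n : ℕ) : IntegrableOn (fun y => y ^ n * ffR y) UU ∧ ∫ y in UU, y ^ n * ffR y = Bt (n+1) (1/2) * en n := by
  have := mellin_conv (m := fun u => MM (1 - u)) (k := k1) (g := fun y => y ^ n) (C := 1) (by fun_prop) (by fun_prop) (by fun_prop)
    (MM_int_bd (by norm_num)) k1_int (by
      intro y hy
      rw [abs_of_nonneg (pow_nonneg hy.1.le _), one_mul]
      exact (pow_le_one₀ hy.1.le hy.2.le).trans (Real.one_le_rpow_of_pos_of_le_one_of_nonpos hy.1 hy.2.le (by norm_num)))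
  refine ⟨this.1, ?_⟩
  unfold ffR
  rw [this.2, en, cov_refl (fun t => (1 - t) ^ n * MM t), ← MeasureTheory.integral_const_mul]
  refine setIntegral_congr_fun measurableSet_Ioo ?_
  intro u hu
  simp only
  have hb := beta_val (a := (n:ℝ) + 1) (b := 1/2) (by positivity) (by norm_num)
  have : ∫ τ in UU, k1 τ * (u * τ) ^ n = u ^ n * Bt (n+1) (1/2) := by
    rw [Bt, ← hb, ← MeasureTheory.integral_const_mul]
    refine setIntegral_congr_fun measurableSet_Ioo ?_
    intro τ hτ
    simp only [k1]
    rw [mul_pow, add_sub_cancel_right, Real.rpow_natCast]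
    norm_num only
    ring
  rw [this, sub_sub_cancel]; ring

lemma Bt_succ (m : ℕ) : (m + 1 + 1/2) * Bt (m + 1 + 1) (1/2) = (m + 1) * Bt (m + 1) (1/2) := by
  unfold Bt
  have h1 : ((m:ℝ) + 1) ≠ 0 := by positivity
  have h2 : ((m:ℝ) + 1 + 1/2) ≠ 0 := by positivity
  rw [Real.Gamma_add_one h1, show (m:ℝ) + 1 + 1 + 1/2 = (m + 1 + 1/2) + 1 by ring, Real.Gamma_add_one h2]
  have h3 : Real.Gamma (m + 1 + 1/2) ≠ 0 := (Real.Gamma_pos_of_pos (by positivity)).ne'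
  field_simp

lemma mom_eq (n : ℕ) : 4 ^ (n+1) * AA n = Bt (n+1) (1/2) * en n := by
  induction n with
  | zero =>
    rw [AA_zero, en_zero]
    unfold Bt
    norm_num
    rw [show (3/2:ℝ) = 1/2 + 1 by norm_num, Real.Gamma_add_one (by norm_num)]
    have h3 : Real.Gamma (1/2) ≠ 0 := (Real.Gamma_pos_of_pos (by positivity)).ne'
    field_simp
    norm_num
  | succ m ih =>
    have h1 := AA_succ m
    have h2 := en_succ m
    have h3 := Bt_succ m
    push_cast
    have c1 : ((m:ℝ) + 1 + 3/2) * ((m + 1) - 1/2) * (m + 1 + 1/2) ≠ 0 := by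
      have : (0:ℝ) < (m:ℝ) + 1 - 1/2 := by linarith [Nat.cast_nonneg (α := ℝ) m]
      positivity
    apply mul_left_cancel₀ c1
    rw [pow_succ]
    linear_combination (-(4:ℝ) ^ (m + 1)) * h1 + ((m:ℝ)+1)^3 * ih + ((m:ℝ)+1) * Bt (m+1) (1/2) * h2 - ((m:ℝ) + 1 + 3/2) * ((m + 1) - 1/2) * en (m+1) * h3

lemma F4 : ∀ᵐ y, y ∈ UU → ff y = ffR y := by
  have hR := (ffR_mom 0).1
  simp only [pow_zero, one_mul] at hR
  have := poly_det (h := fun y => ff y - ffR y) (Integrable.sub ff_int hR) (by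
    intro n
    have hi : IntegrableOn (fun y => y ^ n * ff y) UU := by
      refine Integrable.bdd_mul (c := 1) ff_int (by fun_prop) ?_
      refine (ae_restrict_iff' measurableSet_Ioo).2 (Filter.Eventually.of_forall ?_)
      intro y hy
      rw [Real.norm_eq_abs, abs_of_nonneg (pow_nonneg hy.1.le _)]
      exact pow_le_one₀ hy.1.le hy.2.le
    simp_rw [mul_sub]
    rw [MeasureTheory.integral_sub hi (ffR_mom n).1, ff_mom, (ffR_mom n).2, mom_eq, sub_self])
  filter_upwards [this] with y hy h
  exact sub_eq_zero.1 (hy h)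

noncomputable def rho (t : ℝ) : ℝ := (t * (1 - t)) ^ (-(1/4:ℝ))

/-- the triple product with difference kernel -/
lemma F46 : ∫ t in Set.Ioo (0:ℝ) (1/2), (MM t ^ 2 - MM (1 - t) ^ 2) * (MM t - MM (1 - t)) * rho t =
    √2 / 4 * (KK (1/2) / WW 0) * (1/4 * Bt (3/4) (1/2) ^ 2 * Bt (3/4) (3/4) ^ 2) := by
  rw [← step12.2, ← MeasureTheory.integral_const_mul]
  have : ∫ y in UU, √2 / 4 * (KK (1/2) / WW 0) * (gg y * mconv (fun u => MM (1 - u)) k1 y) =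
      ∫ y in UU, √2 / 4 * (KK (1/2) / WW 0) * (gg y * ff y) := by
    refine setIntegral_congr_ae measurableSet_Ioo ?_
    filter_upwards [F4] with y hy h
    rw [hy h]; rfl
  rw [this, cov4]
  refine setIntegral_congr_fun measurableSet_Ioo ?_
  intro t ht
  simp only
  have hx : 1 - 2 * t ∈ UU := ⟨by linarith [ht.2], by linarith [ht.1]⟩
  have h6 := F6 hx
  unfold DD at h6
  rw [show (1 - (1 - 2 * t))/2 = t by ring, show (1 + (1 - 2 * t))/2 = 1 - t by ring] at h6
  have hq : 0 < t * (1 - t) := mul_pos ht.1 (by linarith [ht.2])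
  rw [ff_q ht.2, h6, gg, rho, show 1 - 4 * (t * (1 - t)) = (1 - 2 * t) ^ 2 by ring, Real.mul_rpow (by norm_num) hq.le]
  have : √2 * (4:ℝ) ^ (-(1/4:ℝ)) = 1 := by
    rw [show (4:ℝ) = 2 ^ (2:ℝ) by norm_num, ← Real.rpow_mul (by norm_num), Real.sqrt_eq_rpow, ← Real.rpow_add (by norm_num)]
    norm_num
  linear_combination (-(MM t ^ 2 - MM (1 - t) ^ 2) * (KK (1/2) / WW 0) * (1 - 2 * t) * eul (1/4) (5/4) (5/4) ((1 - 2 * t)^2) *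
    (t * (1 - t)) ^ (-(1/4:ℝ))) * this

lemma meh_aux {θ φ : ℝ} (hθ : θ ∈ Set.Ioo 0 π) (hφ : φ ∈ Set.Ioo 0 θ) (p : ℝ → ℝ) :
    Real.sin (φ/2) * Real.cos (φ/2) / Real.sin (θ/2) ^ 2 * (1/2 * (p (1 - 2 * Real.sin (θ/2) ^ 2 * (Real.sin (φ/2) ^ 2 / Real.sin (θ/2) ^ 2)) *
      ((Real.sin (φ/2) ^ 2 / Real.sin (θ/2) ^ 2) ^ (-(1/2:ℝ)) * (1 - Real.sin (φ/2) ^ 2 / Real.sin (θ/2) ^ 2) ^ (-(1/2:ℝ)) *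
      (1 - Real.sin (θ/2) ^ 2 * (Real.sin (φ/2) ^ 2 / Real.sin (θ/2) ^ 2)) ^ (-(1/2:ℝ))))) =
    p (Real.cos φ) * (2 * (Real.cos φ - Real.cos θ)) ^ (-(1/2:ℝ)) := by
  have s1 : 0 < Real.sin (θ/2) := Real.sin_pos_of_pos_of_lt_pi (by linarith [hθ.1]) (by linarith [hθ.2, Real.pi_pos])
  have s2 : 0 < Real.sin (φ/2) := Real.sin_pos_of_pos_of_lt_pi (by linarith [hφ.1]) (by linarith [hθ.2, hφ.2, Real.pi_pos])
  have s3 : 0 < Real.cos (φ/2) := Real.cos_pos_of_mem_Ioo ⟨by linarith [hφ.1, Real.pi_pos], by linarith [hθ.2, hφ.2, Real.pi_pos]⟩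
  have s4 : Real.sin (φ/2) < Real.sin (θ/2) := Real.sin_lt_sin_of_lt_of_le_pi_div_two (by linarith [hφ.1, Real.pi_pos]) (by linarith [hθ.2]) (by linarith [hφ.2])
  have c1 : Real.cos φ = 1 - 2 * Real.sin (φ/2) ^ 2 := by
    have := Real.cos_two_mul (φ/2); rw [show 2 * (φ/2) = φ by ring] at this
    nlinarith [Real.sin_sq_add_cos_sq (φ/2)]
  have c2 : Real.cos θ = 1 - 2 * Real.sin (θ/2) ^ 2 := by
    have := Real.cos_two_mul (θ/2); rw [show 2 * (θ/2) = θ by ring] at this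
    nlinarith [Real.sin_sq_add_cos_sq (θ/2)]
  have hd : 0 < Real.sin (θ/2) ^ 2 - Real.sin (φ/2) ^ 2 := by nlinarith
  have m : ∀ z : ℝ, 0 ≤ z → z ^ (-(1/2:ℝ)) = (√z)⁻¹ := fun z hz => by rw [Real.rpow_neg hz, Real.sqrt_eq_rpow]
  have e1 : 1 - 2 * Real.sin (θ/2) ^ 2 * (Real.sin (φ/2) ^ 2 / Real.sin (θ/2) ^ 2) = Real.cos φ := by
    rw [c1]; field_simp
  have e2 : 1 - Real.sin (θ/2) ^ 2 * (Real.sin (φ/2) ^ 2 / Real.sin (θ/2) ^ 2) = Real.cos (φ/2) ^ 2 := by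
    have := Real.sin_sq_add_cos_sq (φ/2)
    field_simp; linarith
  have e3 : 1 - Real.sin (φ/2) ^ 2 / Real.sin (θ/2) ^ 2 = (Real.sin (θ/2) ^ 2 - Real.sin (φ/2) ^ 2) / Real.sin (θ/2) ^ 2 := by
    field_simp
  have e4 : 2 * (Real.cos φ - Real.cos θ) = 2 ^ 2 * (Real.sin (θ/2) ^ 2 - Real.sin (φ/2) ^ 2) := by rw [c1, c2]; ring
  rw [e1, e2, e3, e4, m _ (by positivity), m _ (by positivity), m _ (by positivity), m _ (by positivity)]
  rw [Real.sqrt_div (by positivity), Real.sqrt_div hd.le, Real.sqrt_mul (by positivity), Real.sqrt_sq s1.le, Real.sqrt_sq s2.le, Real.sqrt_sq s3.le,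
    Real.sqrt_sq (by norm_num)]
  have := Real.sqrt_pos.2 hd
  field_simp

lemma meh {θ : ℝ} (hθ : θ ∈ Set.Ioo 0 π) (p : ℝ → ℝ) :
    (IntegrableOn (fun x => 1/2 * (p (1 - 2 * Real.sin (θ/2) ^ 2 * x) * (x ^ (-(1/2:ℝ)) * (1 - x) ^ (-(1/2:ℝ)) * (1 - Real.sin (θ/2) ^ 2 * x) ^ (-(1/2:ℝ))))) UU ↔
      IntegrableOn (fun φ => p (Real.cos φ) * (2 * (Real.cos φ - Real.cos θ)) ^ (-(1/2:ℝ))) (Set.Ioo 0 θ)) ∧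
    ∫ x in UU, 1/2 * (p (1 - 2 * Real.sin (θ/2) ^ 2 * x) * (x ^ (-(1/2:ℝ)) * (1 - x) ^ (-(1/2:ℝ)) * (1 - Real.sin (θ/2) ^ 2 * x) ^ (-(1/2:ℝ)))) =
    ∫ φ in Set.Ioo 0 θ, p (Real.cos φ) * (2 * (Real.cos φ - Real.cos θ)) ^ (-(1/2:ℝ)) := by
  have s1 : 0 < Real.sin (θ/2) := Real.sin_pos_of_pos_of_lt_pi (by linarith [hθ.1]) (by linarith [hθ.2, Real.pi_pos])
  have hc : ContinuousOn (fun φ => Real.sin (φ/2) ^ 2 / Real.sin (θ/2) ^ 2) (Set.Icc 0 θ) := by fun_prop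
  have hd : ∀ φ ∈ Set.Ioo 0 θ, HasDerivAt (fun φ => Real.sin (φ/2) ^ 2 / Real.sin (θ/2) ^ 2) (Real.sin (φ/2) * Real.cos (φ/2) / Real.sin (θ/2) ^ 2) φ := by
    intro φ hφ
    convert! (((hasDerivAt_id φ).div_const 2).sin.pow 2).div_const (Real.sin (θ/2) ^ 2) using 1
    simp only [id]; push_cast; ring
  have hp : ∀ φ ∈ Set.Ioo 0 θ, 0 < Real.sin (φ/2) * Real.cos (φ/2) / Real.sin (θ/2) ^ 2 := by
    intro φ hφ
    have s2 : 0 < Real.sin (φ/2) := Real.sin_pos_of_pos_of_lt_pi (by linarith [hφ.1]) (by linarith [hθ.2, hφ.2, Real.pi_pos])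
    have s3 : 0 < Real.cos (φ/2) := Real.cos_pos_of_mem_Ioo ⟨by linarith [hφ.1, Real.pi_pos], by linarith [hθ.2, hφ.2, Real.pi_pos]⟩
    positivity
  have v0 : Real.sin (0/2) ^ 2 / Real.sin (θ/2) ^ 2 = 0 := by simp
  have v1 : Real.sin (θ/2) ^ 2 / Real.sin (θ/2) ^ 2 = 1 := by field_simp
  have h1 := cov hθ.1 hc hd hp (fun x => 1/2 * (p (1 - 2 * Real.sin (θ/2) ^ 2 * x) * (x ^ (-(1/2:ℝ)) * (1 - x) ^ (-(1/2:ℝ)) * (1 - Real.sin (θ/2) ^ 2 * x) ^ (-(1/2:ℝ)))))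
  have h2 := cov_int hθ.1 hc hd hp (fun x => 1/2 * (p (1 - 2 * Real.sin (θ/2) ^ 2 * x) * (x ^ (-(1/2:ℝ)) * (1 - x) ^ (-(1/2:ℝ)) * (1 - Real.sin (θ/2) ^ 2 * x) ^ (-(1/2:ℝ)))))
  rw [v0, v1] at h1 h2
  rw [h1, h2]
  exact ⟨integrableOn_congr_fun (fun φ hφ => meh_aux hθ hφ p) measurableSet_Ioo,
    setIntegral_congr_fun measurableSet_Ioo (fun φ hφ => meh_aux hθ hφ p)⟩

lemma sin_half_lt {θ : ℝ} (hθ : θ ∈ Set.Ioo 0 π) : Real.sin (θ/2) ^ 2 ∈ UU := by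
  have s1 : 0 < Real.sin (θ/2) := Real.sin_pos_of_pos_of_lt_pi (by linarith [hθ.1]) (by linarith [hθ.2, Real.pi_pos])
  have s3 : 0 < Real.cos (θ/2) := Real.cos_pos_of_mem_Ioo ⟨by linarith [hθ.1, Real.pi_pos], by linarith [hθ.2]⟩
  exact ⟨by positivity, by nlinarith [Real.sin_sq_add_cos_sq (θ/2)]⟩

lemma meh_K {θ : ℝ} (hθ : θ ∈ Set.Ioo 0 π) :
    IntegrableOn (fun φ => (2 * (Real.cos φ - Real.cos θ)) ^ (-(1/2:ℝ))) (Set.Ioo 0 θ) ∧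
    ∫ φ in Set.Ioo 0 θ, (2 * (Real.cos φ - Real.cos θ)) ^ (-(1/2:ℝ)) = KK (Real.sin (θ/2) ^ 2) := by
  have h := meh hθ (fun _ => 1)
  simp only [one_mul] at h
  refine ⟨h.1.1 ?_, ?_⟩
  · have := (eul_intg (a := 1/2) (b := 1/2) (1/2) (by norm_num) (by norm_num) (sin_half_lt hθ).2).const_mul (1/2)
    norm_num only at this ⊢
    exact this
  · rw [← h.2, MeasureTheory.integral_const_mul, KK, eul]
    norm_num only

lemma meh_M {θ : ℝ} (hθ : θ ∈ Set.Ioo 0 π) :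
    ∫ φ in Set.Ioo 0 θ, Real.cos φ * (2 * (Real.cos φ - Real.cos θ)) ^ (-(1/2:ℝ)) = MM (Real.sin (θ/2) ^ 2) := by
  rw [MM_int (sin_half_lt hθ).2]
  exact (meh hθ id).2.symm

lemma refl_pi (θ : ℝ) (g : ℝ → ℝ) : (IntegrableOn g (Set.Ioo θ π) ↔ IntegrableOn (fun φ => g (π - φ)) (Set.Ioo 0 (π - θ))) ∧
    ∫ φ in Set.Ioo θ π, g φ = ∫ φ in Set.Ioo 0 (π - θ), g (π - φ) := by
  have hi : (fun φ => π - φ) '' (Set.Ioo 0 (π - θ)) = Set.Ioo θ π := by simp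
  have h1 := integral_image_eq_integral_deriv_smul_of_antitoneOn (s := Set.Ioo 0 (π - θ)) (f := fun x => π - x)
    (f' := fun _ => -1) measurableSet_Ioo
    (fun x _ => by simpa using ((hasDerivAt_id x).const_sub π).hasDerivWithinAt)
    (fun x _ y _ h => by simp only; linarith) g
  have h2 := integrableOn_image_iff_integrableOn_deriv_smul_of_antitoneOn (s := Set.Ioo 0 (π - θ)) (f := fun x => π - x)
    (f' := fun _ => -1) measurableSet_Ioo
    (fun x _ => by simpa using ((hasDerivAt_id x).const_sub π).hasDerivWithinAt)
    (fun x _ y _ h => by simp only; linarith) g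
  rw [hi] at h1 h2
  rw [h1, h2]
  simp

lemma sin_half_refl (θ : ℝ) : Real.sin ((π - θ)/2) ^ 2 = 1 - Real.sin (θ/2) ^ 2 := by
  rw [show (π - θ)/2 = π/2 - θ/2 by ring, Real.sin_pi_div_two_sub]
  nlinarith [Real.sin_sq_add_cos_sq (θ/2)]

lemma meh_K' {θ : ℝ} (hθ : θ ∈ Set.Ioo 0 π) :
    IntegrableOn (fun φ => (2 * (Real.cos θ - Real.cos φ)) ^ (-(1/2:ℝ))) (Set.Ioo θ π) ∧
    ∫ φ in Set.Ioo θ π, (2 * (Real.cos θ - Real.cos φ)) ^ (-(1/2:ℝ)) = KK (1 - Real.sin (θ/2) ^ 2) := by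
  have h := meh_K (θ := π - θ) ⟨by linarith [hθ.2], by linarith [hθ.1]⟩
  rw [(refl_pi θ _).1, (refl_pi θ _).2, ← sin_half_refl, ← h.2]
  simp only [Real.cos_pi_sub] at h ⊢
  have e : ∀ φ, 2 * (Real.cos θ - -Real.cos φ) = 2 * (Real.cos φ - -Real.cos θ) := fun φ => by ring
  simp_rw [e]
  exact ⟨h.1, trivial⟩

lemma meh_M' {θ : ℝ} (hθ : θ ∈ Set.Ioo 0 π) :
    ∫ φ in Set.Ioo θ π, Real.cos φ * (2 * (Real.cos θ - Real.cos φ)) ^ (-(1/2:ℝ)) = - MM (1 - Real.sin (θ/2) ^ 2) := by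
  have h := meh_M (θ := π - θ) ⟨by linarith [hθ.2], by linarith [hθ.1]⟩
  rw [(refl_pi θ _).2, ← sin_half_refl, ← h, ← MeasureTheory.integral_neg]
  simp only [Real.cos_pi_sub] at h ⊢
  have e : ∀ φ, 2 * (Real.cos θ - -Real.cos φ) = 2 * (Real.cos φ - -Real.cos θ) := fun φ => by ring
  simp_rw [e, neg_mul]

noncomputable def ker (w : ℂ) (φ : ℝ) : ℂ :=
  (1 - w * Complex.exp (φ * I)) ^ (-(1/2:ℂ)) * (1 - w * Complex.exp (-φ * I)) ^ (-(1/2:ℂ))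
noncomputable def BB (w : ℂ) : ℂ := ∫ φ in Set.Ioo 0 π, (Real.cos φ : ℂ) * ker w φ

lemma norm_lb {r α : ℝ} (h0 : 0 ≤ r) : |Real.sin (α/2)| ≤ ‖1 - (r:ℂ) * Complex.exp (α * I)‖ := by
  have c1 : Real.cos α = 1 - 2 * Real.sin (α/2) ^ 2 := by
    have := Real.cos_two_mul (α/2); rw [show 2 * (α/2) = α by ring] at this
    nlinarith [Real.sin_sq_add_cos_sq (α/2)]
  apply abs_le_of_sq_le_sq' _ (norm_nonneg _) |>.2
  rw [← Complex.normSq_eq_norm_sq, Complex.normSq_apply, sq_abs]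
  simp [Complex.exp_ofReal_mul_I_re, Complex.exp_ofReal_mul_I_im]
  set s := Real.sin (α/2) ^ 2 with hs
  have hs1 : s ≤ 1 := Real.sin_sq_le_one _
  have hs0 : 0 ≤ s := sq_nonneg _
  have : (1 - r * Real.cos α) * (1 - r * Real.cos α) + r * Real.sin α * (r * Real.sin α) = (1 - r)^2 + 4 * r * s := by
    have := Real.sin_sq_add_cos_sq α
    rw [c1] at *
    linear_combination r^2 * this
  rw [this]
  nlinarith [sq_nonneg (1 - r - s), sq_nonneg (r - 1 + 2 * s), mul_nonneg h0 hs0, mul_nonneg (sub_nonneg.2 hs1) hs0]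

lemma polar_cpow {ρ β : ℝ} (c : ℝ) (hρ : 0 < ρ) (h0 : -π < β) (h1 : β ≤ π) :
    ((ρ:ℂ) * Complex.exp (β * I)) ^ (c:ℂ) = ((ρ ^ c : ℝ) : ℂ) * Complex.exp ((β * c : ℝ) * I) := by
  have hne : (ρ:ℂ) * Complex.exp (β * I) ≠ 0 := mul_ne_zero (by exact_mod_cast hρ.ne') (Complex.exp_ne_zero _)
  rw [Complex.cpow_def_of_ne_zero hne, Complex.log_ofReal_mul hρ (Complex.exp_ne_zero _),
    Complex.log_exp (by simpa using h0) (by simpa using h1), Real.rpow_def_of_pos hρ, Complex.ofReal_exp, ← Complex.exp_add]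
  congr 1
  push_cast
  ring

lemma one_sub_exp (α : ℝ) : 1 - Complex.exp (α * I) = ((2 * Real.sin (α/2) : ℝ) : ℂ) * Complex.exp (((α - π)/2 : ℝ) * I) := by
  have e1 : Complex.exp (((α - π)/2 : ℝ) * I) = Complex.exp ((α/2:ℝ) * I) * (-I) := by
    have : ((((α - π)/2 : ℝ) : ℂ)) * I = ((α/2:ℝ):ℂ) * I - ((π:ℝ):ℂ)/2 * I := by push_cast; ring
    rw [this, Complex.exp_sub, Complex.exp_pi_div_two_mul_I, div_eq_mul_inv, Complex.inv_I]
  have e2 : Complex.exp (α * I) = Complex.exp ((α/2:ℝ) * I) * Complex.exp ((α/2:ℝ) * I) := by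
    rw [← Complex.exp_add]; congr 1; push_cast; ring
  have e3 : Complex.exp ((α/2:ℝ) * I) * Complex.exp (-((α/2:ℝ) * I)) = 1 := by
    rw [← Complex.exp_add]; simp
  rw [e1, e2]
  push_cast
  rw [Complex.sin]
  push_cast at e3
  rw [neg_mul]
  linear_combination (-1) * e3 + (Complex.exp (↑α / 2 * I) * Complex.exp (-(↑α / 2 * I)) - Complex.exp (↑α / 2 * I)^2) * I_sq

lemma pol {α : ℝ} (c : ℝ) (h0 : 0 < α) (h1 : α < 2 * π) : (1 - Complex.exp (α * I)) ^ (c:ℂ) =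
    (((2 * Real.sin (α/2)) ^ c : ℝ) : ℂ) * Complex.exp (((α - π)/2 * c : ℝ) * I) := by
  have s1 : 0 < Real.sin (α/2) := Real.sin_pos_of_pos_of_lt_pi (by linarith) (by linarith)
  rw [one_sub_exp, polar_cpow c (by positivity) (by linarith) (by linarith)]

lemma ker_bdry (θ φ : ℝ) : ker (Complex.exp (θ * I)) φ = (1 - Complex.exp ((θ + φ : ℝ) * I)) ^ ((-(1/2):ℝ):ℂ) *
    (1 - Complex.exp ((θ - φ : ℝ) * I)) ^ ((-(1/2):ℝ):ℂ) := by
  unfold ker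
  rw [← Complex.exp_add, ← Complex.exp_add]
  push_cast
  ring_nf

lemma sin_prod (θ φ : ℝ) : 2 * Real.sin ((θ + φ)/2) * (2 * Real.sin ((θ - φ)/2)) = 2 * (Real.cos φ - Real.cos θ) := by
  rw [Real.cos_sub_cos, show (φ - θ)/2 = -((θ - φ)/2) by ring, Real.sin_neg, add_comm φ θ]; ring

lemma ker_lt {θ φ : ℝ} (h0 : 0 < φ) (h1 : φ < θ) (h2 : θ < π) : Complex.exp ((θ/2:ℝ) * I) * ker (Complex.exp (θ * I)) φ =
    I * (((2 * (Real.cos φ - Real.cos θ)) ^ (-(1/2):ℝ) : ℝ) : ℂ) := by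
  have p1 := Real.sin_pos_of_pos_of_lt_pi (x := (θ + φ)/2) (by linarith) (by linarith)
  have p2 := Real.sin_pos_of_pos_of_lt_pi (x := (θ - φ)/2) (by linarith) (by linarith)
  rw [ker_bdry, pol _ (by linarith) (by linarith), pol _ (by linarith) (by linarith), ← sin_prod,
    Real.mul_rpow (x := 2 * Real.sin ((θ + φ)/2)) (y := 2 * Real.sin ((θ - φ)/2)) (by positivity) (by positivity)]
  · have : Complex.exp ((π:ℝ)/2 * I) = Complex.exp ((θ/2:ℝ) * I) * Complex.exp (((θ + φ - π)/2 * (-(1/2)) : ℝ) * I) * Complex.exp (((θ - φ - π)/2 * (-(1/2)) : ℝ) * I) := by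
      rw [← Complex.exp_add, ← Complex.exp_add]; congr 1; push_cast; ring
    rw [Complex.exp_pi_div_two_mul_I] at this
    rw [Complex.ofReal_mul ((2 * Real.sin ((θ + φ)/2)) ^ (-(1/2):ℝ))]
    linear_combination (-((2 * Real.sin ((θ + φ)/2)) ^ (-(1/2):ℝ) : ℝ) : ℂ) * (((2 * Real.sin ((θ - φ)/2)) ^ (-(1/2):ℝ) : ℝ) : ℂ) * this

lemma ker_gt {θ φ : ℝ} (h0 : 0 < θ) (h1 : θ < φ) (h2 : φ < π) : Complex.exp ((θ/2:ℝ) * I) * ker (Complex.exp (θ * I)) φ =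
    (((2 * (Real.cos θ - Real.cos φ)) ^ (-(1/2):ℝ) : ℝ) : ℂ) := by
  have hp : Complex.exp ((θ - φ : ℝ) * I) = Complex.exp ((θ - φ + 2 * π : ℝ) * I) := by
    rw [show ((θ - φ + 2 * π : ℝ):ℂ) * I = ((θ - φ : ℝ):ℂ) * I + 2 * π * I by push_cast; ring, Complex.exp_periodic]
  have hs : Real.sin ((θ - φ + 2 * π)/2) = Real.sin ((φ - θ)/2) := by
    rw [show (θ - φ + 2 * π)/2 = π - (φ - θ)/2 by ring, Real.sin_pi_sub]
  have p1 := Real.sin_pos_of_pos_of_lt_pi (x := (φ + θ)/2) (by linarith) (by linarith)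
  have p2 := Real.sin_pos_of_pos_of_lt_pi (x := (φ - θ)/2) (by linarith) (by linarith)
  rw [ker_bdry, hp, pol _ (by linarith) (by linarith), pol _ (by linarith) (by linarith), hs, ← sin_prod,
    Real.mul_rpow (x := 2 * Real.sin ((φ + θ)/2)) (y := 2 * Real.sin ((φ - θ)/2)) (by positivity) (by positivity)]
  · have : 1 = Complex.exp ((θ/2:ℝ) * I) * Complex.exp (((θ + φ - π)/2 * (-(1/2)) : ℝ) * I) * Complex.exp (((θ - φ + 2 * π - π)/2 * (-(1/2)) : ℝ) * I) := by
      rw [← Complex.exp_add, ← Complex.exp_add, eq_comm, Complex.exp_eq_one_iff]; use 0; push_cast; ring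
    rw [add_comm φ θ, Complex.ofReal_mul ((2 * Real.sin ((θ + φ)/2)) ^ (-(1/2):ℝ))]
    linear_combination (-((2 * Real.sin ((θ + φ)/2)) ^ (-(1/2):ℝ) : ℝ) : ℂ) * (((2 * Real.sin ((φ - θ)/2)) ^ (-(1/2):ℝ) : ℝ) : ℂ) * this

lemma split_pi {E : Type*} [NormedAddCommGroup E] [NormedSpace ℝ E] {g : ℝ → E} {θ : ℝ} (hθ : θ ∈ Set.Ioo 0 π)
   (h1 : IntegrableOn g (Set.Ioo 0 θ)) (h2 : IntegrableOn g (Set.Ioo θ π)) : IntegrableOn g (Set.Ioo 0 π) ∧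
   ∫ φ in Set.Ioo 0 π, g φ = (∫ φ in Set.Ioo 0 θ, g φ) + ∫ φ in Set.Ioo θ π, g φ := by
  rw [← Set.Ioc_union_Ioo_eq_Ioo hθ.1.le hθ.2]
  have h1' : IntegrableOn g (Set.Ioc 0 θ) := by rw [integrableOn_Ioc_iff_integrableOn_Ioo]; exact h1
  refine ⟨h1'.union h2, ?_⟩
  rw [setIntegral_union _ measurableSet_Ioo h1' h2, integral_Ioc_eq_integral_Ioo]
  rw [Set.disjoint_left]
  intro x hx hx'
  linarith [hx.2, hx'.1]

lemma norm_ker {r θ φ : ℝ} (h0 : 0 ≤ r) (hne : 0 < |Real.cos φ - Real.cos θ|) :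
    ‖ker (r * Complex.exp (θ * I)) φ‖ ≤ 2 * (2 * |Real.cos φ - Real.cos θ|) ^ (-(1/2):ℝ) := by
  have e : ker (r * Complex.exp (θ * I)) φ = (1 - r * Complex.exp ((θ + φ : ℝ) * I)) ^ ((-(1/2):ℝ):ℂ) *
    (1 - r * Complex.exp ((θ - φ : ℝ) * I)) ^ ((-(1/2):ℝ):ℂ) := by
    unfold ker
    rw [mul_assoc, ← Complex.exp_add, mul_assoc, ← Complex.exp_add]
    push_cast
    ring_nf
  rw [e, norm_mul, Complex.norm_cpow_real, Complex.norm_cpow_real]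
  have hs := sin_prod θ φ
  have ha : 0 < |Real.sin ((θ + φ)/2)| := by
    rw [abs_pos]; intro h; rw [h] at hs; rw [abs_pos] at hne; apply hne; linarith
  have hb : 0 < |Real.sin ((θ - φ)/2)| := by
    rw [abs_pos]; intro h; rw [h] at hs; rw [abs_pos] at hne; apply hne; linarith
  calc _ ≤ |Real.sin ((θ + φ)/2)| ^ (-(1/2):ℝ) * |Real.sin ((θ - φ)/2)| ^ (-(1/2):ℝ) := by
        gcongr ?_ * ?_
        · exact Real.rpow_le_rpow_of_nonpos ha (norm_lb h0) (by norm_num)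
        · exact Real.rpow_le_rpow_of_nonpos hb (norm_lb h0) (by norm_num)
    _ = _ := by
      rw [← Real.mul_rpow ha.le hb.le, ← abs_mul]
      have : Real.cos φ - Real.cos θ = 2 * (Real.sin ((θ + φ)/2) * Real.sin ((θ - φ)/2)) := by linarith
      rw [this, abs_mul 2, abs_two, ← mul_assoc, Real.mul_rpow (by norm_num) (abs_nonneg _)]
      have h4 : ((2:ℝ) * 2) ^ (-(1/2):ℝ) = 1/2 := by
        rw [show (2:ℝ) * 2 = 2 ^ (2:ℝ) by norm_num, ← Real.rpow_mul (by norm_num)]; norm_num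
      rw [h4]; ring

lemma cos_lt' {θ φ : ℝ} (h0 : 0 ≤ φ) (h1 : φ < θ) (h2 : θ ≤ π) : Real.cos θ < Real.cos φ :=
  Real.cos_lt_cos_of_nonneg_of_le_pi h0 h2 h1

lemma dom_int {θ : ℝ} (hθ : θ ∈ Set.Ioo 0 π) :
    IntegrableOn (fun φ => 2 * (2 * |Real.cos φ - Real.cos θ|) ^ (-(1/2):ℝ)) (Set.Ioo 0 π) ∧
    ∫ φ in Set.Ioo 0 π, 2 * (2 * |Real.cos φ - Real.cos θ|) ^ (-(1/2):ℝ) = 2 * (KK (Real.sin (θ/2) ^ 2) + KK (1 - Real.sin (θ/2) ^ 2)) := by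
  have e1 : Set.EqOn (fun φ => 2 * (2 * |Real.cos φ - Real.cos θ|) ^ (-(1/2):ℝ)) (fun φ => 2 * (2 * (Real.cos φ - Real.cos θ)) ^ (-(1/2):ℝ)) (Set.Ioo 0 θ) := by
    intro φ hφ
    simp only
    rw [abs_of_pos (sub_pos.2 (cos_lt' hφ.1.le hφ.2 hθ.2.le))]
  have e2 : Set.EqOn (fun φ => 2 * (2 * |Real.cos φ - Real.cos θ|) ^ (-(1/2):ℝ)) (fun φ => 2 * (2 * (Real.cos θ - Real.cos φ)) ^ (-(1/2):ℝ)) (Set.Ioo θ π) := by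
    intro φ hφ
    simp only
    rw [abs_sub_comm, abs_of_pos (sub_pos.2 (cos_lt' hθ.1.le hφ.1 hφ.2.le))]
  have i1 := meh_K hθ
  have i2 := meh_K' hθ
  have := split_pi hθ ((integrableOn_congr_fun e1 measurableSet_Ioo).2 (i1.1.const_mul 2)) ((integrableOn_congr_fun e2 measurableSet_Ioo).2 (i2.1.const_mul 2))
  refine ⟨this.1, ?_⟩
  rw [this.2, setIntegral_congr_fun measurableSet_Ioo e1, setIntegral_congr_fun measurableSet_Ioo e2, MeasureTheory.integral_const_mul, MeasureTheory.integral_const_mul,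
    i1.2, i2.2]
  ring

@[fun_prop] lemma ker_meas (w : ℂ) : Measurable (ker w) := by
  unfold ker
  fun_prop

lemma slit {z : ℂ} (h : ‖z‖ < 1) : 1 - z ∈ Complex.slitPlane := by
  left
  have := Complex.re_le_norm z
  simp; linarith

lemma BB_bdry {θ : ℝ} (hθ : θ ∈ Set.Ioo 0 π) : Complex.exp ((θ/2:ℝ) * I) * BB (Complex.exp (θ * I)) =
    I * (MM (Real.sin (θ/2) ^ 2) : ℂ) - (MM (1 - Real.sin (θ/2) ^ 2) : ℂ) := by
  unfold BB
  rw [← MeasureTheory.integral_const_mul]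
  have e1 : Set.EqOn (fun φ : ℝ => Complex.exp ((θ/2:ℝ) * I) * ((Real.cos φ : ℂ) * ker (Complex.exp (θ * I)) φ))
     (fun φ => I * ((Real.cos φ * (2 * (Real.cos φ - Real.cos θ)) ^ (-(1/2):ℝ) : ℝ) : ℂ)) (Set.Ioo 0 θ) := by
    intro φ hφ
    have := ker_lt hφ.1 hφ.2 hθ.2
    simp only
    rw [Complex.ofReal_mul]
    linear_combination (Real.cos φ : ℂ) * this
  have e2 : Set.EqOn (fun φ : ℝ => Complex.exp ((θ/2:ℝ) * I) * ((Real.cos φ : ℂ) * ker (Complex.exp (θ * I)) φ))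
     (fun φ => ((Real.cos φ * (2 * (Real.cos θ - Real.cos φ)) ^ (-(1/2):ℝ) : ℝ) : ℂ)) (Set.Ioo θ π) := by
    intro φ hφ
    have := ker_gt hθ.1 hφ.1 hφ.2
    simp only
    rw [Complex.ofReal_mul]
    linear_combination (Real.cos φ : ℂ) * this
  have i1 : IntegrableOn (fun φ => Real.cos φ * (2 * (Real.cos φ - Real.cos θ)) ^ (-(1/2):ℝ)) (Set.Ioo 0 θ) :=
    Integrable.bdd_mul (c := 1) (meh_K hθ).1 (by fun_prop) (Filter.Eventually.of_forall fun φ => Real.abs_cos_le_one φ)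
  have i2 : IntegrableOn (fun φ => Real.cos φ * (2 * (Real.cos θ - Real.cos φ)) ^ (-(1/2):ℝ)) (Set.Ioo θ π) :=
    Integrable.bdd_mul (c := 1) (meh_K' hθ).1 (by fun_prop) (Filter.Eventually.of_forall fun φ => Real.abs_cos_le_one φ)
  rw [(split_pi hθ ((integrableOn_congr_fun e1 measurableSet_Ioo).2 ((Integrable.ofReal i1).const_mul I))
    ((integrableOn_congr_fun e2 measurableSet_Ioo).2 (Integrable.ofReal i2))).2,
    setIntegral_congr_fun measurableSet_Ioo e1, setIntegral_congr_fun measurableSet_Ioo e2, MeasureTheory.integral_const_mul,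
    integral_complex_ofReal, integral_complex_ofReal, meh_M hθ, meh_M' hθ]
  push_cast
  ring

lemma cos_ne {θ φ : ℝ} (hθ : θ ∈ Set.Ioo 0 π) (hφ : φ ∈ Set.Ioo 0 π) (h : φ ≠ θ) : 0 < |Real.cos φ - Real.cos θ| := by
  rw [abs_pos, sub_ne_zero]
  intro hc
  exact h (Real.injOn_cos ⟨hφ.1.le, hφ.2.le⟩ ⟨hθ.1.le, hθ.2.le⟩ hc)

lemma ker_ae {r θ : ℝ} (h0 : 0 ≤ r) (hθ : θ ∈ Set.Ioo 0 π) : ∀ᵐ φ ∂(volume.restrict (Set.Ioo 0 π)),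
    ‖(Real.cos φ : ℂ) * ker (r * Complex.exp (θ * I)) φ‖ ≤ 2 * (2 * |Real.cos φ - Real.cos θ|) ^ (-(1/2):ℝ) := by
  rw [ae_restrict_iff' measurableSet_Ioo]
  filter_upwards [compl_mem_ae_iff.2 (measure_singleton θ)] with φ hne hφ
  rw [norm_mul, Complex.norm_real, Real.norm_eq_abs]
  calc _ ≤ 1 * ‖ker (r * Complex.exp (θ * I)) φ‖ := by gcongr; exact Real.abs_cos_le_one φ
    _ ≤ _ := by rw [one_mul]; exact norm_ker h0 (cos_ne hθ hφ hne)

lemma BB_norm {r θ : ℝ} (h0 : 0 ≤ r) (hθ : θ ∈ Set.Ioo 0 π) : ‖BB (r * Complex.exp (θ * I))‖ ≤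
    2 * (KK (Real.sin (θ/2) ^ 2) + KK (1 - Real.sin (θ/2) ^ 2)) := by
  rw [← (dom_int hθ).2]
  exact norm_integral_le_of_norm_le (dom_int hθ).1 (ker_ae h0 hθ)

lemma slit_exp {α : ℝ} (h : Real.cos α ≠ 1) : 1 - Complex.exp (α * I) ∈ Complex.slitPlane := by
  left
  simp [Complex.exp_ofReal_mul_I_re]
  exact lt_of_le_of_ne (Real.cos_le_one α) h

lemma BB_tendsto {θ : ℝ} (hθ : θ ∈ Set.Ioo 0 π) : Filter.Tendsto (fun r : ℝ => BB (r * Complex.exp (θ * I))) (nhdsWithin 1 (Set.Iio 1))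
    (nhds (BB (Complex.exp (θ * I)))) := by
  unfold BB
  refine tendsto_integral_filter_of_dominated_convergence _ (Filter.Eventually.of_forall fun r => by fun_prop) ?_ (dom_int hθ).1 ?_
  · have : ∀ᶠ r : ℝ in nhdsWithin 1 (Set.Iio 1), 0 ≤ r := by
      refine nhdsWithin_le_nhds ?_
      filter_upwards [lt_mem_nhds (show (0:ℝ) < 1 by norm_num)] with r hr using hr.le
    filter_upwards [this] with r hr using ker_ae hr hθ
  · rw [ae_restrict_iff' measurableSet_Ioo]
    filter_upwards [compl_mem_ae_iff.2 (measure_singleton θ)] with φ hne hφ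
    have hne' : φ ≠ θ := hne
    refine Filter.Tendsto.const_mul _ ?_
    refine Filter.Tendsto.mono_left ?_ nhdsWithin_le_nhds
    have c : ContinuousAt (fun r : ℝ => ker (r * Complex.exp (θ * I)) φ) 1 := by
      unfold ker
      refine ContinuousAt.mul ?_ ?_
      · refine ContinuousAt.cpow (by fun_prop) (by fun_prop) ?_
        have : 1 - ((1:ℝ):ℂ) * Complex.exp (θ * I) * Complex.exp (φ * I) = 1 - Complex.exp ((θ + φ : ℝ) * I) := by
          rw [ofReal_one, one_mul, ← Complex.exp_add]; push_cast; ring_nf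
        rw [this]
        refine slit_exp fun h => ?_
        rw [Real.cos_eq_one_iff_of_lt_of_lt (by linarith [hθ.1, hφ.1, Real.pi_pos]) (by linarith [hθ.2, hφ.2])] at h
        linarith [hθ.1, hφ.1]
      · refine ContinuousAt.cpow (by fun_prop) (by fun_prop) ?_
        have : 1 - ((1:ℝ):ℂ) * Complex.exp (θ * I) * Complex.exp (-φ * I) = 1 - Complex.exp ((θ - φ : ℝ) * I) := by
          rw [ofReal_one, one_mul, ← Complex.exp_add]; push_cast; ring_nf
        rw [this]
        refine slit_exp fun h => ?_
        rw [Real.cos_eq_one_iff_of_lt_of_lt (by linarith [hθ.1, hφ.2, Real.pi_pos]) (by linarith [hθ.2, hφ.1, Real.pi_pos])] at h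
        exact hne' (by linarith)
    have c' := c.tendsto
    simpa using c'

lemma BB_odd (w : ℂ) : BB (-w) = - BB w := by
  unfold BB
  have h1 := integral_image_eq_integral_deriv_smul_of_antitoneOn (s := Set.Ioo 0 π) (f := fun x => π - x)
    (f' := fun _ => -1) measurableSet_Ioo
    (fun x _ => by simpa using ((hasDerivAt_id x).const_sub π).hasDerivWithinAt)
    (fun x _ y _ h => by simp only; linarith) (fun φ => (Real.cos φ : ℂ) * ker w φ)
  have hi : (fun φ => π - φ) '' (Set.Ioo 0 π) = Set.Ioo 0 π := by simp
  rw [hi] at h1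
  rw [h1, ← MeasureTheory.integral_neg]
  congr 1
  ext φ
  have e1 : Complex.exp (((π - φ : ℝ) : ℂ) * I) = - Complex.exp (-φ * I) := by
    rw [show (((π - φ : ℝ) : ℂ) * I) = π * I + -φ * I by push_cast; ring, Complex.exp_add, Complex.exp_pi_mul_I]; ring
  have e2 : Complex.exp (-((π - φ : ℝ) : ℂ) * I) = - Complex.exp (φ * I) := by
    rw [show (-((π - φ : ℝ) : ℂ) * I) = φ * I - π * I by push_cast; ring, Complex.exp_sub, Complex.exp_pi_mul_I]; ring
  rw [Real.cos_pi_sub]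
  unfold ker
  rw [e1, e2]
  simp
  left; ring

lemma BB_diff {w : ℂ} (hw : ‖w‖ < 1) : DifferentiableAt ℂ BB w := by
  obtain ⟨R, h1, h2⟩ := exists_between hw
  have hR : 0 < 1 - R := by linarith
  have ne : ∀ φ : ℝ, ‖Complex.exp (φ * I)‖ = 1 := fun φ => Complex.norm_exp_ofReal_mul_I φ
  have ne' : ∀ φ : ℝ, ‖Complex.exp (-φ * I)‖ = 1 := fun φ => by simpa using Complex.norm_exp_ofReal_mul_I (-φ)
  have nb : ∀ z e : ℂ, ‖z‖ < R → ‖e‖ = 1 → 1 - R ≤ ‖1 - z * e‖ := by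
    intro z e hz he
    have := norm_sub_norm_le 1 (z * e)
    rw [norm_mul, he, norm_one] at this
    linarith
  have sl : ∀ z e : ℂ, ‖z‖ < R → ‖e‖ = 1 → 1 - z * e ∈ Complex.slitPlane := by
    intro z e hz he
    refine slit ?_
    rw [norm_mul, he]; linarith
  have nc : ∀ (z e : ℂ) (c : ℝ), c ≤ 0 → ‖z‖ < R → ‖e‖ = 1 → ‖(1 - z * e) ^ (c:ℂ)‖ ≤ (1 - R) ^ c := by
    intro z e c hc hz he
    rw [Complex.norm_cpow_real]
    exact Real.rpow_le_rpow_of_nonpos hR (nb z e hz he) hc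
  have ex1 : (-(1/2:ℂ)) = ((-(1/2):ℝ):ℂ) := by push_cast; ring
  have ex2 : (-(1/2:ℂ)) - 1 = ((-(3/2):ℝ):ℂ) := by push_cast; ring
  have key := _root_.hasDerivAt_integral_of_dominated_loc_of_deriv_le (μ := volume.restrict (Set.Ioo 0 π)) (𝕜 := ℂ)
    (F := fun z φ => (Real.cos φ : ℂ) * ker z φ)
    (F' := fun z φ => (Real.cos φ : ℂ) * ((-(1/2:ℂ) * (1 - z * Complex.exp (φ * I)) ^ (-(1/2:ℂ) - 1) * (-Complex.exp (φ * I))) * (1 - z * Complex.exp (-φ * I)) ^ (-(1/2:ℂ))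
       + (1 - z * Complex.exp (φ * I)) ^ (-(1/2:ℂ)) * (-(1/2:ℂ) * (1 - z * Complex.exp (-φ * I)) ^ (-(1/2:ℂ) - 1) * (-Complex.exp (-φ * I)))))
    (x₀ := w) (s := Metric.ball 0 R) (bound := fun _ => (1 - R) ^ (-(3/2):ℝ) * (1 - R) ^ (-(1/2):ℝ))
    (Metric.isOpen_ball.mem_nhds (by simpa using h1)) (Filter.Eventually.of_forall fun z => by fun_prop) ?_ (by fun_prop) ?_ ?_ ?_
  · exact key.2.differentiableAt
  · refine Integrable.mono' (g := fun _ => (1 - R) ^ (-(1/2):ℝ) * (1 - R) ^ (-(1/2):ℝ)) (integrable_const _) (by fun_prop) (Filter.Eventually.of_forall fun φ => ?_)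
    rw [norm_mul, Complex.norm_real, Real.norm_eq_abs]
    calc _ ≤ 1 * ‖ker w φ‖ := by gcongr; exact Real.abs_cos_le_one φ
      _ ≤ _ := by
        rw [one_mul, ker, norm_mul, ex1]
        gcongr
        · exact nc _ _ _ (by norm_num) h1 (ne φ)
        · exact nc _ _ _ (by norm_num) h1 (ne' φ)
  · refine Filter.Eventually.of_forall fun φ z hz => ?_
    have hz' : ‖z‖ < R := by simpa using hz
    rw [norm_mul, Complex.norm_real, Real.norm_eq_abs]
    calc _ ≤ 1 * (1/2 * (1 - R) ^ (-(3/2):ℝ) * 1 * (1 - R) ^ (-(1/2):ℝ) + (1 - R) ^ (-(1/2):ℝ) * (1/2 * (1 - R) ^ (-(3/2):ℝ) * 1)) := by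
          gcongr
          · exact Real.abs_cos_le_one φ
          · refine (norm_add_le _ _).trans ?_
            rw [ex2, ex1]
            simp only [norm_mul, norm_neg, ne, ne']
            have n1 := nc z _ (-(3/2)) (by norm_num) hz' (ne φ)
            have n2 := nc z _ (-(3/2)) (by norm_num) hz' (ne' φ)
            have n3 := nc z _ (-(1/2)) (by norm_num) hz' (ne φ)
            have n4 := nc z _ (-(1/2)) (by norm_num) hz' (ne' φ)
            have n5 : ‖((-(1/2):ℝ):ℂ)‖ = 1/2 := by rw [Complex.norm_real]; norm_num
            rw [n5]
            gcongr
      _ = _ := by ring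
  · exact integrable_const _
  · refine Filter.Eventually.of_forall fun φ z hz => ?_
    have hz' : ‖z‖ < R := by simpa using hz
    refine HasDerivAt.const_mul _ ?_
    have d1 : HasDerivAt (fun z : ℂ => 1 - z * Complex.exp (φ * I)) (-Complex.exp (φ * I)) z := by
      simpa using ((hasDerivAt_id z).mul_const (Complex.exp (φ * I))).const_sub 1
    have d2 : HasDerivAt (fun z : ℂ => 1 - z * Complex.exp (-φ * I)) (-Complex.exp (-φ * I)) z := by
      simpa using ((hasDerivAt_id z).mul_const (Complex.exp (-φ * I))).const_sub 1
    exact (d1.cpow_const (sl z _ hz' (ne φ))).mul (d2.cpow_const (sl z _ hz' (ne' φ)))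

noncomputable def GG (w : ℂ) : ℂ := w * BB w ^ 3 * (1 - w ^ 2) ^ ((1/2:ℝ):ℂ)

lemma GG_even (w : ℂ) : GG (-w) = GG w := by
  unfold GG
  rw [BB_odd]; ring_nf

lemma GG_diff {w : ℂ} (hw : ‖w‖ < 1) : DifferentiableAt ℂ (fun w => BB w ^ 3 * (1 - w ^ 2) ^ ((1/2:ℝ):ℂ)) w := by
  refine ((BB_diff hw).pow 3).mul ?_
  refine DifferentiableAt.cpow (by fun_prop) (by fun_prop) ?_
  refine slit ?_
  rw [norm_pow]
  nlinarith [norm_nonneg w]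

lemma GG_cont {r : ℝ} (h0 : 0 ≤ r) (h1 : r < 1) : Continuous (fun θ : ℝ => GG (r * Complex.exp (θ * I))) := by
  refine continuous_iff_continuousAt.2 fun θ => ?_
  have hn : ‖(r:ℂ) * Complex.exp (θ * I)‖ < 1 := by
    rw [norm_mul, Complex.norm_exp_ofReal_mul_I, Complex.norm_real, Real.norm_eq_abs, abs_of_nonneg h0]; linarith
  have h : ContinuousAt GG ((r:ℂ) * Complex.exp (θ * I)) := by
    have := (GG_diff hn).continuousAt
    refine (continuousAt_id.mul this).congr (Filter.Eventually.of_forall fun w => ?_)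
    simp only [GG, id, Pi.mul_apply]; ring
  exact ContinuousAt.comp (f := fun θ : ℝ => (r:ℂ) * Complex.exp (θ * I)) h (by fun_prop)

lemma GG_zero {r : ℝ} (h0 : 0 < r) (h1 : r < 1) : ∫ θ in Set.Ioo 0 π, GG (r * Complex.exp (θ * I)) = 0 := by
  have hc := GG_cont h0.le h1
  have h := Complex.circleIntegral_eq_zero_of_differentiable_on_off_countable (E := ℂ) (c := 0) (R := r) h0.le Set.countable_empty
    (f := fun w => BB w ^ 3 * (1 - w ^ 2) ^ ((1/2:ℝ):ℂ))
    (fun z hz => (GG_diff (by have : ‖z‖ ≤ r := by simpa using hz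
                              linarith)).continuousAt.continuousWithinAt)
    (fun z hz => GG_diff (by have : ‖z‖ < r := by simpa using hz.1
                             linarith))
  rw [circleIntegral] at h
  have e : ∀ θ : ℝ, deriv (circleMap 0 r) θ • ((fun w => BB w ^ 3 * (1 - w ^ 2) ^ ((1/2:ℝ):ℂ)) (circleMap 0 r θ)) = I * GG (r * Complex.exp (θ * I)) := by
    intro θ
    rw [deriv_circleMap]
    simp only [circleMap, zero_add, smul_eq_mul, GG]; ring
  simp_rw [e] at h
  rw [intervalIntegral.integral_const_mul] at h
  have h' := (mul_eq_zero.1 h).resolve_left I_ne_zero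
  rw [← intervalIntegral.integral_add_adjacent_intervals (b := π) (hc.intervalIntegrable _ _) (hc.intervalIntegrable _ _)] at h'
  have h2 : ∫ θ in π..(2*π), GG (r * Complex.exp (θ * I)) = ∫ θ in (0:ℝ)..π, GG (r * Complex.exp (θ * I)) := by
    have := intervalIntegral.integral_comp_add_right (a := 0) (b := π) (fun θ : ℝ => GG (r * Complex.exp (θ * I))) π
    rw [zero_add, ← two_mul] at this
    rw [← this]
    congr 1
    ext θ
    rw [← GG_even]
    congr 1
    push_cast
    rw [add_mul, Complex.exp_add, Complex.exp_pi_mul_I]; ring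
  rw [h2, ← two_mul] at h'
  rw [← integral_Ioc_eq_integral_Ioo, ← intervalIntegral.integral_of_le Real.pi_pos.le]
  exact (mul_eq_zero.1 h').resolve_left two_ne_zero

lemma cov_th (h : ℝ → ℝ) :
    (IntegrableOn (fun t => h t * (t * (1 - t)) ^ (-(1/2:ℝ))) UU ↔ IntegrableOn (fun θ => h (Real.sin (θ/2) ^ 2)) (Set.Ioo 0 π)) ∧
    ∫ t in UU, h t * (t * (1 - t)) ^ (-(1/2:ℝ)) = ∫ θ in Set.Ioo 0 π, h (Real.sin (θ/2) ^ 2) := by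
  have hc : ContinuousOn (fun θ => Real.sin (θ/2) ^ 2) (Set.Icc 0 π) := by fun_prop
  have hd : ∀ θ ∈ Set.Ioo 0 π, HasDerivAt (fun θ => Real.sin (θ/2) ^ 2) (Real.sin (θ/2) * Real.cos (θ/2)) θ := by
    intro θ _
    convert! (((Real.hasDerivAt_sin _).comp θ ((hasDerivAt_id θ).div_const 2)).pow 2) using 1
    simp; ring
  have pos : ∀ θ ∈ Set.Ioo 0 π, 0 < Real.sin (θ/2) * Real.cos (θ/2) := by
    intro θ hθ
    have s1 : 0 < Real.sin (θ/2) := Real.sin_pos_of_pos_of_lt_pi (by linarith [hθ.1]) (by linarith [hθ.2, Real.pi_pos])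
    have s3 : 0 < Real.cos (θ/2) := Real.cos_pos_of_mem_Ioo ⟨by linarith [hθ.1, Real.pi_pos], by linarith [hθ.2]⟩
    positivity
  have e : Set.EqOn (fun θ => Real.sin (θ/2) * Real.cos (θ/2) * (h (Real.sin (θ/2) ^ 2) * (Real.sin (θ/2) ^ 2 * (1 - Real.sin (θ/2) ^ 2)) ^ (-(1/2:ℝ))))
      (fun θ => h (Real.sin (θ/2) ^ 2)) (Set.Ioo 0 π) := by
    intro θ hθ
    have p := pos θ hθ
    simp only
    have : Real.sin (θ/2) ^ 2 * (1 - Real.sin (θ/2) ^ 2) = (Real.sin (θ/2) * Real.cos (θ/2)) ^ 2 := by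
      rw [mul_pow, Real.cos_sq']
    rw [this, Real.rpow_neg (by positivity), ← Real.sqrt_eq_rpow, Real.sqrt_sq p.le]
    have := p.ne'
    rw [mul_comm, mul_assoc, inv_mul_cancel₀ this, mul_one]
  have a := cov_int Real.pi_pos hc hd pos (fun t => h t * (t * (1 - t)) ^ (-(1/2:ℝ)))
  have b := cov Real.pi_pos hc hd pos (fun t => h t * (t * (1 - t)) ^ (-(1/2:ℝ)))
  simp only [zero_div, Real.sin_zero, Real.sin_pi_div_two, one_pow, ne_eq, OfNat.ofNat_ne_zero, not_false_eq_true, zero_pow] at a b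
  rw [a, b, integrableOn_congr_fun e measurableSet_Ioo, setIntegral_congr_fun measurableSet_Ioo e]
  exact ⟨Iff.rfl, rfl⟩

lemma GG_bd : ∃ g : ℝ → ℝ, IntegrableOn g (Set.Ioo 0 π) ∧ ∀ r θ : ℝ, 0 ≤ r → r ≤ 1 → θ ∈ Set.Ioo 0 π → ‖GG (r * Complex.exp (θ * I))‖ ≤ g θ := by
  obtain ⟨C, hC, h⟩ := KK_bound
  refine ⟨fun θ => (fun t => 128 * C ^ 3 * (t * (1 - t)) ^ (-(3/16:ℝ))) (Real.sin (θ/2) ^ 2), ?_, ?_⟩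
  · refine (cov_th (fun t => 128 * C ^ 3 * (t * (1 - t)) ^ (-(3/16:ℝ)))).1.1 ?_
    refine IntegrableOn.congr_fun ((beta_intg (a := 5/16) (b := 5/16) (by norm_num) (by norm_num)).const_mul (128 * C ^ 3)) ?_ measurableSet_Ioo
    intro t ht
    have h1 : 0 < 1 - t := by linarith [ht.2]
    simp only
    rw [mul_assoc (128 * C ^ 3), ← Real.rpow_add (mul_pos ht.1 h1), Real.mul_rpow ht.1.le h1.le]
    norm_num
  · intro r θ h0 h1 hθ
    have ht := sin_half_lt hθ
    set t := Real.sin (θ/2) ^ 2 with ht'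
    have b := BB_norm h0 hθ
    rw [← ht'] at b
    have hn : ‖(r:ℂ) * Complex.exp (θ * I)‖ ≤ 1 := by
      rw [norm_mul, Complex.norm_exp_ofReal_mul_I, Complex.norm_real, Real.norm_eq_abs, abs_of_nonneg h0]; linarith
    set w := (r:ℂ) * Complex.exp (θ * I)
    have t1 : 0 < 1 - t := by linarith [ht.2]
    have k1 := h t ht.1.le ht.2
    have k2 := h (1 - t) t1.le (by linarith [ht.1])
    rw [show 1 - (1 - t) = t by ring] at k2
    have o1 : 1 ≤ t ^ (-(1/16:ℝ)) := Real.one_le_rpow_of_pos_of_le_one_of_nonpos ht.1 ht.2.le (by norm_num)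
    have o2 : 1 ≤ (1-t) ^ (-(1/16:ℝ)) := Real.one_le_rpow_of_pos_of_le_one_of_nonpos t1 (by linarith [ht.1]) (by norm_num)
    have m : ‖BB w‖ ≤ 4 * C * (t * (1 - t)) ^ (-(1/16:ℝ)) := by
      rw [Real.mul_rpow ht.1.le t1.le]
      set x := t ^ (-(1/16:ℝ))
      set y := (1-t) ^ (-(1/16:ℝ))
      have : C * y ≤ C * (x * y) := by gcongr; nlinarith
      have : C * x ≤ C * (x * y) := by gcongr; nlinarith
      linarith
    have q : ‖(1 - w ^ 2) ^ ((1/2:ℝ):ℂ)‖ ≤ 2 := by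
      rw [Complex.norm_cpow_real]
      have : ‖1 - w ^ 2‖ ≤ 2 := by
        refine (norm_sub_le _ _).trans ?_
        rw [norm_one, norm_pow]; nlinarith [norm_nonneg w]
      calc ‖1 - w ^ 2‖ ^ (1/2:ℝ) ≤ 2 ^ (1/2:ℝ) := by gcongr
        _ ≤ 2 ^ (1:ℝ) := by gcongr <;> norm_num
        _ = 2 := by simp
    simp only
    have e : (t * (1 - t)) ^ (-(3/16:ℝ)) = ((t * (1 - t)) ^ (-(1/16:ℝ))) ^ 3 := by
      rw [← Real.rpow_natCast, ← Real.rpow_mul (mul_pos ht.1 t1).le]; norm_num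
    rw [GG, norm_mul, norm_mul, norm_pow, e]
    calc ‖w‖ * ‖BB w‖ ^ 3 * ‖(1 - w ^ 2) ^ ((1/2:ℝ):ℂ)‖ ≤ 1 * (4 * C * (t * (1 - t)) ^ (-(1/16:ℝ))) ^ 3 * 2 := by gcongr
      _ = _ := by ring

lemma GG_bdry {θ : ℝ} (hθ : θ ∈ Set.Ioo 0 π) : Complex.exp ((π/4:ℝ) * I) * GG (Complex.exp (θ * I)) =
    (I * (MM (Real.sin (θ/2) ^ 2) : ℂ) - (MM (1 - Real.sin (θ/2) ^ 2) : ℂ)) ^ 3 * (((2 * Real.sin θ) ^ (1/2:ℝ) : ℝ) : ℂ) := by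
  rw [← BB_bdry hθ, GG]
  have h := pol (α := 2 * θ) (1/2) (by linarith [hθ.1]) (by linarith [hθ.2])
  have e : Complex.exp (((2 * θ : ℝ):ℂ) * I) = Complex.exp (θ * I) ^ 2 := by
    rw [← Complex.exp_nat_mul]; push_cast; ring_nf
  rw [e, show 2 * θ / 2 = θ by ring] at h
  rw [h, mul_pow, ← Complex.exp_nat_mul]
  have e2 : Complex.exp ((π/4:ℝ) * I) * Complex.exp (θ * I) * Complex.exp (((2 * θ - π) / 2 * (1/2) : ℝ) * I) = Complex.exp ((3:ℕ) * ((θ/2:ℝ) * I)) := by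
    rw [← Complex.exp_add, ← Complex.exp_add]; push_cast; ring_nf
  rw [← e2]; ring

lemma GG_lim : ∫ θ in Set.Ioo 0 π, GG (Complex.exp (θ * I)) = 0 := by
  obtain ⟨g, hg, hb⟩ := GG_bd
  have ev : ∀ᶠ r : ℝ in nhdsWithin 1 (Set.Iio 1), 0 < r ∧ r < 1 := by
    filter_upwards [nhdsWithin_le_nhds (lt_mem_nhds (show (0:ℝ) < 1 by norm_num)), self_mem_nhdsWithin] with r hr hr'
    exact ⟨hr, hr'⟩
  have T : Filter.Tendsto (fun r : ℝ => ∫ θ in Set.Ioo 0 π, GG (r * Complex.exp (θ * I))) (nhdsWithin 1 (Set.Iio 1))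
      (nhds (∫ θ in Set.Ioo 0 π, GG (Complex.exp (θ * I)))) := by
    refine tendsto_integral_filter_of_dominated_convergence g ?_ ?_ hg ?_
    · filter_upwards [ev] with r hr
      exact (GG_cont hr.1.le hr.2).aestronglyMeasurable
    · filter_upwards [ev] with r hr
      exact (ae_restrict_iff' measurableSet_Ioo).2 (Filter.Eventually.of_forall fun θ hθ => hb r θ hr.1.le hr.2.le hθ)
    · refine (ae_restrict_iff' measurableSet_Ioo).2 (Filter.Eventually.of_forall fun θ hθ => ?_)
      unfold GG
      have id1 : Filter.Tendsto (fun r : ℝ => (r:ℂ) * Complex.exp (θ * I)) (nhdsWithin 1 (Set.Iio 1)) (nhds (Complex.exp (θ * I))) := by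
        have : ContinuousAt (fun r : ℝ => (r:ℂ) * Complex.exp (θ * I)) 1 := by fun_prop
        have := this.tendsto
        simp only [ofReal_one, one_mul] at this
        exact this.mono_left nhdsWithin_le_nhds
      refine (id1.mul ((BB_tendsto hθ).pow 3)).mul ?_
      refine Filter.Tendsto.cpow (tendsto_const_nhds.sub (id1.pow 2)) tendsto_const_nhds ?_
      have e : Complex.exp (θ * I) ^ 2 = Complex.exp (((2 * θ : ℝ):ℂ) * I) := by
        rw [← Complex.exp_nat_mul]; push_cast; ring_nf
      rw [e]
      refine slit_exp fun h => ?_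
      rw [Real.cos_eq_one_iff_of_lt_of_lt (by linarith [hθ.1, Real.pi_pos]) (by linarith [hθ.2])] at h
      linarith [hθ.1]
  refine tendsto_nhds_unique (T.congr' ?_) tendsto_const_nhds
  filter_upwards [ev] with r hr using GG_zero hr.1 hr.2

lemma F3 : ∫ t in UU, (3 * MM t * MM (1 - t) ^ 2 - MM t ^ 3) * rho t = 0 := by
  obtain ⟨g, hg, hb⟩ := GG_bd
  have e1 : Set.EqOn (fun θ : ℝ => Complex.exp ((π/4:ℝ) * I) * GG (Complex.exp (θ * I)))
     (fun θ => (I * (MM (Real.sin (θ/2) ^ 2) : ℂ) - (MM (1 - Real.sin (θ/2) ^ 2) : ℂ)) ^ 3 * (((2 * Real.sin θ) ^ (1/2:ℝ) : ℝ) : ℂ)) (Set.Ioo 0 π) :=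
    fun θ hθ => GG_bdry hθ
  have h := GG_lim
  have h2 : ∫ θ in Set.Ioo 0 π, Complex.exp ((π/4:ℝ) * I) * GG (Complex.exp (θ * I)) = 0 := by
    rw [MeasureTheory.integral_const_mul, h, mul_zero]
  rw [setIntegral_congr_fun measurableSet_Ioo e1] at h2
  have hi : IntegrableOn (fun θ => (I * (MM (Real.sin (θ/2) ^ 2) : ℂ) - (MM (1 - Real.sin (θ/2) ^ 2) : ℂ)) ^ 3 * (((2 * Real.sin θ) ^ (1/2:ℝ) : ℝ) : ℂ)) (Set.Ioo 0 π) := by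
    refine Integrable.mono' hg (by fun_prop) ((ae_restrict_iff' measurableSet_Ioo).2 (Filter.Eventually.of_forall fun θ hθ => ?_))
    have := e1 hθ
    simp only at this
    rw [← this, norm_mul, Complex.norm_exp_ofReal_mul_I, one_mul]
    simpa using hb 1 θ zero_le_one le_rfl hθ
  have h3 := integral_im hi
  rw [h2] at h3
  have e2 : Set.EqOn (fun θ : ℝ => RCLike.im ((I * (MM (Real.sin (θ/2) ^ 2) : ℂ) - (MM (1 - Real.sin (θ/2) ^ 2) : ℂ)) ^ 3 * (((2 * Real.sin θ) ^ (1/2:ℝ) : ℝ) : ℂ)))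
    (fun θ => (fun t => 2 * ((3 * MM t * MM (1 - t) ^ 2 - MM t ^ 3) * (t * (1 - t)) ^ (1/4:ℝ))) (Real.sin (θ/2) ^ 2)) (Set.Ioo 0 π) := by
    intro θ hθ
    have s1 : 0 < Real.sin (θ/2) := Real.sin_pos_of_pos_of_lt_pi (by linarith [hθ.1]) (by linarith [hθ.2, Real.pi_pos])
    have s3 : 0 < Real.cos (θ/2) := Real.cos_pos_of_mem_Ioo ⟨by linarith [hθ.1, Real.pi_pos], by linarith [hθ.2]⟩
    simp only
    have es : Real.sin θ = 2 * (Real.sin (θ/2) * Real.cos (θ/2)) := by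
      have := Real.sin_two_mul (θ/2)
      rw [show 2 * (θ/2) = θ by ring] at this
      rw [this]; ring
    have e3 : (2 * Real.sin θ) ^ (1/2:ℝ) = 2 * (Real.sin (θ/2) ^ 2 * (1 - Real.sin (θ/2) ^ 2)) ^ (1/4:ℝ) := by
      have : Real.sin (θ/2) ^ 2 * (1 - Real.sin (θ/2) ^ 2) = (Real.sin (θ/2) * Real.cos (θ/2)) ^ 2 := by
        rw [mul_pow, Real.cos_sq']
      rw [this, es, ← Real.rpow_natCast (_ * _) 2, ← Real.rpow_mul (by positivity), ← mul_assoc, Real.mul_rpow (by norm_num) (by positivity),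
        ← Real.sqrt_eq_rpow, show (2:ℝ) * 2 = 2 ^ 2 by norm_num, Real.sqrt_sq (by norm_num)]
      norm_num
    rw [e3]
    change ((_:ℂ) * _).im = _
    rw [Complex.im_mul_ofReal]
    have : ∀ a b : ℝ, ((I * (a:ℂ) - (b:ℂ)) ^ 3).im = 3 * a * b ^ 2 - a ^ 3 := by
      intro a b
      simp [pow_succ, Complex.mul_im, Complex.mul_re]; ring
    rw [this]; ring
  rw [setIntegral_congr_fun measurableSet_Ioo e2, ← (cov_th (fun t => 2 * ((3 * MM t * MM (1 - t) ^ 2 - MM t ^ 3) * (t * (1 - t)) ^ (1/4:ℝ)))).2] at h3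
  have e4 : Set.EqOn (fun t : ℝ => 2 * ((3 * MM t * MM (1 - t) ^ 2 - MM t ^ 3) * (t * (1 - t)) ^ (1/4:ℝ)) * (t * (1 - t)) ^ (-(1/2:ℝ)))
     (fun t => 2 * ((3 * MM t * MM (1 - t) ^ 2 - MM t ^ 3) * rho t)) UU := by
    intro t ht
    have : 0 < t * (1 - t) := mul_pos ht.1 (by linarith [ht.2])
    simp only [rho]
    rw [show (-(1/4:ℝ)) = 1/4 + -(1/2) by norm_num, Real.rpow_add this]; ring
  rw [setIntegral_congr_fun measurableSet_Ioo e4, MeasureTheory.integral_const_mul] at h3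
  simp at h3
  linarith

lemma rho_refl (t : ℝ) : rho (1 - t) = rho t := by
  unfold rho; congr 1; ring

lemma ab_int (i j : ℕ) (hij : i + j = 3) : IntegrableOn (fun t => MM t ^ i * MM (1 - t) ^ j * rho t) UU := by
  obtain ⟨C, hC, h⟩ := MM_bound
  have m : Measurable (fun t => MM t ^ i * MM (1 - t) ^ j * rho t) := by unfold rho; fun_prop
  refine Integrable.mono' ((beta_intg (a := 9/16) (b := 9/16) (by norm_num) (by norm_num)).const_mul (C ^ 3)) m.aestronglyMeasurable
    ((ae_restrict_iff' measurableSet_Ioo).2 (Filter.Eventually.of_forall fun t ht => ?_))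
  have t1 : 0 < 1 - t := by linarith [ht.2]
  have k1 := h t ht.1.le ht.2
  have k2 := h (1 - t) t1.le (by linarith [ht.1])
  rw [show 1 - (1 - t) = t by ring] at k2
  have o1 : 1 ≤ t ^ (-(1/16:ℝ)) := Real.one_le_rpow_of_pos_of_le_one_of_nonpos ht.1 ht.2.le (by norm_num)
  have o2 : 1 ≤ (1-t) ^ (-(1/16:ℝ)) := Real.one_le_rpow_of_pos_of_le_one_of_nonpos t1 (by linarith [ht.1]) (by norm_num)
  have e : C ^ 3 * (t ^ ((9/16:ℝ) - 1) * (1 - t) ^ ((9/16:ℝ) - 1)) = (C * (t ^ (-(1/16:ℝ)) * (1-t) ^ (-(1/16:ℝ)))) ^ 3 * rho t := by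
    unfold rho
    rw [Real.mul_rpow ht.1.le t1.le, mul_pow, mul_pow, ← Real.rpow_natCast, ← Real.rpow_natCast (t ^ _), ← Real.rpow_natCast ((1 - t) ^ _), ← Real.rpow_mul ht.1.le, ← Real.rpow_mul t1.le]
    rw [show (9/16:ℝ) - 1 = -(1/16) * (3:ℕ) + -(1/4) by norm_num, Real.rpow_add ht.1, Real.rpow_add t1]; ring
  have r0 : 0 < rho t := Real.rpow_pos_of_pos (mul_pos ht.1 t1) _
  rw [e, norm_mul, norm_mul, norm_pow, norm_pow, Real.norm_eq_abs, Real.norm_eq_abs, Real.norm_eq_abs, abs_of_pos r0, ← hij, pow_add]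
  set x := t ^ (-(1/16:ℝ))
  set y := (1-t) ^ (-(1/16:ℝ))
  have : C * y ≤ C * (x * y) := by gcongr; nlinarith
  have : C * x ≤ C * (x * y) := by gcongr; nlinarith
  gcongr <;> linarith

lemma J3_eq : ∫ t in UU, MM t ^ 3 * rho t = 3/2 * (√2/4*(KK (1/2)/WW 0)*(1/4*Bt (3/4) (1/2)^2*Bt (3/4) (3/4)^2)) := by
  rw [← F46]
  have i30 := ab_int 3 0 rfl
  have i21 := ab_int 2 1 rfl
  have i12 := ab_int 1 2 rfl
  have i03 := ab_int 0 3 rfl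
  simp only [pow_zero, pow_one, one_mul, mul_one] at i30 i21 i12 i03
  have r1 := cov_refl (fun t => MM t ^ 3 * rho t)
  have r2 := cov_refl (fun t => MM t * MM (1 - t) ^ 2 * rho t)
  simp only [rho_refl, sub_sub_cancel] at r1 r2
  have f3 := F3
  have e1 : ∫ t in UU, (3 * MM t * MM (1 - t) ^ 2 - MM t ^ 3) * rho t = 3 * (∫ t in UU, MM t * MM (1 - t) ^ 2 * rho t) - ∫ t in UU, MM t ^ 3 * rho t := by
    rw [← MeasureTheory.integral_const_mul, ← MeasureTheory.integral_sub (i12.const_mul 3) i30]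
    congr 1; ext t; ring
  have hf := half_full (φ := fun t => (MM t^2 - MM (1-t)^2)*(MM t - MM (1-t))*rho t) (by
    have := ((i30.sub i21).sub i12).add i03
    refine this.congr_fun (fun t _ => ?_) measurableSet_Ioo
    simp only [Pi.add_apply, Pi.sub_apply]; ring)
  simp only [rho_refl, sub_sub_cancel] at hf
  have e2 : ∫ t in UU, (MM t^2 - MM (1-t)^2)*(MM t - MM (1-t))*rho t = (∫ t in UU, MM t ^ 3 * rho t) - (∫ t in UU, MM t ^ 2 * MM (1 - t) * rho t) - (∫ t in UU, MM t * MM (1 - t) ^ 2 * rho t) + ∫ t in UU, MM (1 - t) ^ 3 * rho t := by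
    have j1 := i30.sub i21
    have j2 := j1.sub i12
    rw [← MeasureTheory.integral_sub i30 i21]
    refine Eq.trans ?_ (congrArg₂ (· + ·) (MeasureTheory.integral_sub j1 i12) rfl)
    refine Eq.trans ?_ (MeasureTheory.integral_add j2 i03)
    congr 1; ext t; ring
  have e3 : ∫ t in Set.Ioo (0:ℝ) (1/2), ((MM t^2 - MM (1-t)^2)*(MM t - MM (1-t))*rho t + (MM (1-t)^2 - MM t^2)*(MM (1-t) - MM t)*rho t) =
     2 * ∫ t in Set.Ioo (0:ℝ) (1/2), (MM t^2 - MM (1-t)^2)*(MM t - MM (1-t))*rho t := by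
    rw [← MeasureTheory.integral_const_mul]
    congr 1; ext t; ring
  have e4 : ∫ t in UU, MM (1 - t) * MM t ^ 2 * rho t = ∫ t in UU, MM t ^ 2 * MM (1 - t) * rho t := by
    congr 1; ext t; ring
  rw [e3, e2, ← r1] at hf
  rw [e4] at r2
  linarith

lemma J3_val : √2 * ∫ t in UU, MM t ^ 3 * rho t = 48 * π ^ 6 / Real.Gamma (1/4) ^ 8 := by
  rw [J3_eq, KK_half, WW_zero]
  unfold Bt
  have g := Real.Gamma_mul_Gamma_one_sub (1/4)
  rw [show π * (1/4) = π/4 by ring, Real.sin_pi_div_four, show (1:ℝ) - 1/4 = 3/4 by norm_num] at g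
  have g5 : Real.Gamma (3/4 + 1/2) = 1/4 * Real.Gamma (1/4) := by
    rw [← Real.Gamma_add_one (by norm_num)]; norm_num
  have g3 : Real.Gamma (3/4 + 3/4) = 1/2 * √π := by
    rw [← Real.Gamma_one_half_eq, ← Real.Gamma_add_one (by norm_num)]; norm_num
  rw [g5, g3, Real.Gamma_one_half_eq]
  have p1 : 0 < Real.Gamma (1/4) := Real.Gamma_pos_of_pos (by norm_num)
  have p2 : 0 < √π := Real.sqrt_pos.2 Real.pi_pos
  have p3 : 0 < √2 := Real.sqrt_pos.2 (by norm_num)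
  have q1 : √2 ^ 2 = 2 := Real.sq_sqrt (by norm_num)
  have q2 : π = √π ^ 2 := (Real.sq_sqrt Real.pi_pos.le).symm
  have g' : Real.Gamma (3/4) = √2 * π / Real.Gamma (1/4) := by
    rw [eq_div_iff p1.ne', mul_comm, g]
    field_simp
    linarith
  rw [g', q2, Real.sqrt_sq p2.le]
  generalize √π = s at *
  generalize Real.Gamma (1/4) = G at *
  generalize √2 = c at *
  field_simp
  have c8 : c ^ 8 = 16 := by rw [show c ^ 8 = (c^2)^4 by ring, q1]; norm_num
  ring_nf
  rw [c8]; norm_num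

lemma part1 : (∫ t in (0:ℝ)..1, Real.sqrt 2 * (2 * ellipticE (Real.sqrt t) - ellipticK (Real.sqrt t)) ^ 3 /
        (t * (1 - t)) ^ ((1:ℝ)/4)) = 48 * π ^ 6 / Real.Gamma (1/4) ^ 8 := by
  rw [← J3_val, intervalIntegral.integral_of_le zero_le_one, integral_Ioc_eq_integral_Ioo, ← MeasureTheory.integral_const_mul]
  refine setIntegral_congr_fun measurableSet_Ioo fun t ht => ?_
  have t1 : 0 < 1 - t := by linarith [ht.2]
  rw [ellK ht.1.le, ellE ht.1.le, rho, Real.rpow_neg (mul_pos ht.1 t1).le, MM]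
  ring

noncomputable def PP (n : ℕ) : ℝ := (ascPochhammer ℝ n).eval (1/2)

lemma PP_zero : PP 0 = 1 := by simp [PP]
lemma PP_succ (n : ℕ) : PP (n+1) = PP n * (1/2 + n) := by
  unfold PP; rw [ascPochhammer_succ_eval]

lemma PP_pos (n : ℕ) : 0 < PP n := by
  induction n with
  | zero => rw [PP_zero]; norm_num
  | succ n ih => rw [PP_succ]; positivity

lemma Gam_half (n : ℕ) : Real.Gamma (n + 1/2) = PP n * √π := by
  induction n with
  | zero => rw [PP_zero]; norm_num [Real.Gamma_one_half_eq]
  | succ n ih =>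
    rw [PP_succ, show ((n+1:ℕ):ℝ) + 1/2 = (n + 1/2) + 1 by push_cast; ring, Real.Gamma_add_one (by positivity), ih]; ring

lemma hs_congr {f g : ℕ → ℝ} {a b : ℝ} (h : HasSum g b) (hf : ∀ n, f n = g n) (ha : a = b) : HasSum f a := by
  rw [ha, funext hf]; exact h

lemma sum1 {z : ℝ} (hz : |z| < 1) : HasSum (fun n : ℕ => PP n / n.factorial * z ^ n) ((1 - z) ^ (-(1/2:ℝ))) := by
  have h := (Real.one_div_one_sub_rpow_hasFPowerSeriesOnBall_zero (1/2)).hasSum (y := z) (by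
    rw [Metric.mem_eball, edist_zero_right, ← ofReal_norm, Real.norm_eq_abs, ENNReal.ofReal_lt_one]; exact hz)
  simp only [zero_add] at h
  rw [Real.rpow_neg (by linarith [le_abs_self z]), ← one_div]
  refine hs_congr h (fun n => ?_) rfl
  simp only [FormalMultilinearSeries.ofScalars_apply_eq, smul_eq_mul]
  have := Ring.factorial_nsmul_multichoose_eq_ascPochhammer (1/2:ℝ) n
  rw [Polynomial.ascPochhammer_smeval_eq_eval] at this
  rw [Ring.choose, show (1/2:ℝ) + n - 1 - n + 1 = 1/2 by ring, PP, ← this]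
  simp only [nsmul_eq_mul]
  have : (n.factorial : ℝ) ≠ 0 := by positivity
  field_simp

noncomputable def qq (n : ℕ) : ℝ := PP n / n.factorial * ((2 * n + 1) / (1 - 2 * n))

lemma odd_ne (n : ℕ) : (1 - 2 * n : ℝ) ≠ 0 := by
  intro h
  have : (1:ℤ) = 2 * n := by
    have : (1:ℝ) = 2 * n := by linarith
    exact_mod_cast this
  omega

lemma sum2 {z : ℝ} (hz : |z| < 1) : HasSum (fun n : ℕ => qq n * z ^ n) ((1 - 2 * z) * (1 - z) ^ (-(1/2:ℝ))) := by
  have h := sum1 hz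
  have h2 : HasSum (fun n : ℕ => PP n / n.factorial * (2 * n / (2 * n - 1)) * z ^ n) (z * (1 - z) ^ (-(1/2:ℝ))) := by
    rw [← hasSum_nat_add_iff' 1]
    simp only [Finset.sum_range_one, Nat.cast_zero, mul_zero, zero_div, zero_mul, sub_zero]
    refine hs_congr (h.mul_left z) (fun n => ?_) rfl
    rw [PP_succ, Nat.factorial_succ]
    have h3 : (2 * ((n+1:ℕ):ℝ) - 1) ≠ 0 := by have := odd_ne (n+1); intro h; exact this (by linarith)
    push_cast at h3 ⊢
    field_simp
    ring
  refine hs_congr (h.sub (h2.mul_left 2)) (fun n => ?_) ?_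
  · unfold qq
    have := odd_ne n
    have h3 : (2 * n - 1 : ℝ) ≠ 0 := fun h => this (by linarith)
    rw [show (2 * n - 1 : ℝ) = -(1 - 2 * n) by ring]
    field_simp
    ring
  · ring

lemma mom (n : ℕ) : IntegrableOn (fun x : ℝ => x ^ n * (x ^ (-(1/2:ℝ)) * (1 - x) ^ (-(1/2:ℝ)))) UU ∧
    ∫ x in UU, x ^ n * (x ^ (-(1/2:ℝ)) * (1 - x) ^ (-(1/2:ℝ))) = π * (PP n / n.factorial) := by
  have e : Set.EqOn (fun x : ℝ => x ^ ((n + 1/2 : ℝ) - 1) * (1 - x) ^ ((1/2:ℝ) - 1)) (fun x : ℝ => x ^ n * (x ^ (-(1/2:ℝ)) * (1 - x) ^ (-(1/2:ℝ)))) UU := by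
    intro x hx
    simp only
    rw [show (n + 1/2 : ℝ) - 1 = n + -(1/2) by ring, Real.rpow_add hx.1, Real.rpow_natCast]
    norm_num [mul_assoc]
  have hp : (0:ℝ) < n + 1/2 := by positivity
  refine ⟨(beta_intg hp (by norm_num)).congr_fun e measurableSet_Ioo, ?_⟩
  rw [← setIntegral_congr_fun measurableSet_Ioo e, beta_val hp (by norm_num), Gam_half, Real.Gamma_one_half_eq,
    show (n + 1/2 + 1/2 : ℝ) = n + 1 by ring, Real.Gamma_nat_eq_factorial, mul_assoc, Real.mul_self_sqrt Real.pi_pos.le]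
  ring

lemma MM_sum {t : ℝ} (ht : t ∈ UU) : HasSum (fun n : ℕ => π/2 * (qq n * (PP n / n.factorial)) * t ^ n) (MM t) := by
  have hs := sum2 (z := t) (by rw [abs_of_pos ht.1]; exact ht.2)
  have hi : ∀ n : ℕ, IntegrableOn (fun x : ℝ => 1/2 * (qq n * t ^ n) * (x ^ n * (x ^ (-(1/2:ℝ)) * (1 - x) ^ (-(1/2:ℝ))))) UU :=
    fun n => (mom n).1.const_mul _
  have key := hasSum_integral_of_summable_integral_norm hi ?_
  · rw [MM_int ht.2]
    refine hs_congr key (fun n => ?_) ?_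
    · rw [MeasureTheory.integral_const_mul, (mom n).2]; ring
    · refine setIntegral_congr_fun measurableSet_Ioo fun x hx => ?_
      have htx : |t * x| < 1 := by
        rw [abs_of_pos (mul_pos ht.1 hx.1)]; nlinarith [ht.1, ht.2, hx.1, hx.2]
      have := ((sum2 htx).mul_right (1/2 * (x ^ (-(1/2:ℝ)) * (1 - x) ^ (-(1/2:ℝ))))).tsum_eq
      rw [show 1 - 2 * t * x = 1 - 2 * (t * x) by ring]
      refine Eq.trans (by ring) (this.symm.trans (tsum_congr fun n => ?_))
      rw [mul_pow]; ring
  · refine Summable.of_nonneg_of_le (f := fun n => |qq n * t ^ n| * (1/2 * π)) (fun n => integral_nonneg fun _ => norm_nonneg _) (fun n => ?_) (hs.summable.abs.mul_right _)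
    have : ∀ x ∈ UU, ‖1/2 * (qq n * t ^ n) * (x ^ n * (x ^ (-(1/2:ℝ)) * (1 - x) ^ (-(1/2:ℝ))))‖ = 1/2 * |qq n * t ^ n| * (x ^ n * (x ^ (-(1/2:ℝ)) * (1 - x) ^ (-(1/2:ℝ)))) := by
      intro x hx
      have := Real.rpow_pos_of_pos hx.1 (-(1/2))
      have := Real.rpow_pos_of_pos (show 0 < 1 - x by linarith [hx.2]) (-(1/2))
      have h0 := hx.1
      rw [norm_mul, norm_mul, Real.norm_eq_abs (qq n * t ^ n), Real.norm_of_nonneg (by positivity), Real.norm_of_nonneg (by positivity)]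
    rw [setIntegral_congr_fun measurableSet_Ioo this, MeasureTheory.integral_const_mul]
    have m0 : ∫ x in UU, x ^ n * (x ^ (-(1/2:ℝ)) * (1 - x) ^ (-(1/2:ℝ))) ≤ π := by
      have := (mom 0).2
      simp only [PP_zero, Nat.factorial_zero, Nat.cast_one, div_one, mul_one] at this
      rw [← this]
      refine setIntegral_mono_on (mom n).1 (mom 0).1 measurableSet_Ioo fun x hx => ?_
      have := Real.rpow_pos_of_pos hx.1 (-(1/2))
      have := Real.rpow_pos_of_pos (show 0 < 1 - x by linarith [hx.2]) (-(1/2))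
      have : x ^ n ≤ x ^ 0 := pow_le_pow_of_le_one hx.1.le hx.2.le (Nat.zero_le n)
      gcongr
    calc _ ≤ 1/2 * |qq n * t ^ n| * π := by gcongr
      _ = _ := by ring

lemma coef (n : ℕ) : (ascPochhammer ℂ n).eval (-(1/2)) * (ascPochhammer ℂ n).eval (1/2 + 1) = ((PP n ^ 2 * ((2 * n + 1) / (1 - 2 * n)) : ℝ) : ℂ) := by
  induction n with
  | zero => simp [PP_zero]
  | succ n ih =>
    rw [ascPochhammer_succ_eval, ascPochhammer_succ_eval]
    have : (ascPochhammer ℂ n).eval (-(1/2)) * (-(1/2) + n) * ((ascPochhammer ℂ n).eval (1/2 + 1) * (1/2 + 1 + n)) =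
      ((ascPochhammer ℂ n).eval (-(1/2)) * (ascPochhammer ℂ n).eval (1/2 + 1)) * (((-(1/2) + n) * (1/2 + 1 + n) : ℝ):ℂ) := by push_cast; ring
    rw [this, ih, ← ofReal_mul]
    congr 1
    rw [PP_succ]
    have h1 := odd_ne n
    have h2 : (1 - 2 * ((n + 1 : ℕ) : ℝ)) ≠ 0 := odd_ne (n+1)
    have h3 : (2 * n + 1 : ℝ) ≠ 0 := by positivity
    have e : (1 - 2 * ((n + 1 : ℕ) : ℝ)) = -(2 * n + 1) := by push_cast; ring
    rw [e]
    push_cast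
    field_simp
    ring

lemma leg_eq {x : ℝ} (hx : x ∈ Set.Ioo (-1:ℝ) 1) : legendreP (1/2) (x:ℂ) = ((2/π * MM ((1 - x)/2) : ℝ) : ℂ) := by
  have ht : (1 - x)/2 ∈ UU := ⟨by linarith [hx.2], by linarith [hx.1]⟩
  have h := ((MM_sum ht).mul_left (2/π)).tsum_eq
  rw [← h, Complex.ofReal_tsum, legendreP, ordinaryHypergeometric_eq_tsum]
  refine tsum_congr fun n => ?_
  rw [mul_assoc (_⁻¹) , coef, smul_eq_mul, ascPochhammer_eval_one]
  unfold qq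
  push_cast
  have := Real.pi_pos.ne'
  have hpi : (π:ℂ) ≠ 0 := by exact_mod_cast this
  have hn : (n.factorial : ℂ) ≠ 0 := by exact_mod_cast n.factorial_ne_zero
  field_simp

lemma part2 : (∫ x in (-1:ℝ)..1, (legendreP (1/2) (x : ℂ)) ^ 3 / ((1 - (x:ℂ) ^ 2) ^ ((1:ℂ)/4)))
      = ((384 * π ^ 3 / Real.Gamma (1/4) ^ 8 : ℝ) : ℂ) := by
  rw [intervalIntegral.integral_of_le (by norm_num), integral_Ioc_eq_integral_Ioo]
  have e : Set.EqOn (fun x : ℝ => (legendreP (1/2) (x : ℂ)) ^ 3 / ((1 - (x:ℂ) ^ 2) ^ ((1:ℂ)/4))) (fun x => (((2/π * MM ((1 - x)/2)) ^ 3 / (1 - x ^ 2) ^ (1/4:ℝ) : ℝ) : ℂ)) (Set.Ioo (-1) 1) := by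
    intro x hx
    simp only
    have : 0 ≤ 1 - x ^ 2 := by nlinarith [hx.1, hx.2]
    rw [leg_eq hx, ofReal_div, ofReal_cpow this]
    push_cast; rfl
  rw [setIntegral_congr_fun measurableSet_Ioo e, integral_complex_ofReal]
  congr 1
  have c := cov (f := fun s => 2 * s - 1) (f' := fun _ => 2) (a := 0) (b := 1) one_pos (by fun_prop)
    (fun s _ => by simpa using ((hasDerivAt_id s).const_mul 2).sub_const 1) (fun _ _ => two_pos)
    (fun x => (2/π * MM ((1 - x)/2)) ^ 3 / (1 - x ^ 2) ^ (1/4:ℝ))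
  norm_num only at c
  rw [show (384 * π ^ 3 / Real.Gamma (1/4) ^ 8 : ℝ) = 8 / π ^ 3 * (48 * π ^ 6 / Real.Gamma (1/4) ^ 8) by
    have := Real.pi_pos.ne'
    field_simp; norm_num, ← J3_val, cov_refl (fun t => MM t ^ 3 * rho t), ← mul_assoc, ← MeasureTheory.integral_const_mul]
  refine c.trans (setIntegral_congr_fun measurableSet_Ioo fun s hs => ?_)
  have s1 : 0 < 1 - s := by linarith [hs.2]
  have s2 := mul_pos hs.1 s1
  have e2 : (1 - (2 * s - 1) ^ 2) ^ (1/4:ℝ) = √2 * (s * (1 - s)) ^ (1/4:ℝ) := by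
    rw [show 1 - (2 * s - 1) ^ 2 = 2 ^ 2 * (s * (1 - s)) by ring, Real.mul_rpow (by norm_num) s2.le, Real.sqrt_eq_rpow,
      ← Real.rpow_natCast, ← Real.rpow_mul (by norm_num)]
    norm_num
  rw [show (1 - (2 * s - 1))/2 = 1 - s by ring, rho_refl, e2, rho, Real.rpow_neg s2.le]
  have p := (Real.rpow_pos_of_pos s2 (1/4)).ne'
  have p3 : √2 ≠ 0 := (Real.sqrt_pos.2 (by norm_num)).ne'
  have q1 : √2 ^ 2 = 2 := Real.sq_sqrt (by norm_num)
  have := Real.pi_pos.ne'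
  field_simp
  rw [q1]; ring

theorem stmt19 :
    (∫ t in (0:ℝ)..1, Real.sqrt 2 * (2 * ellipticE (Real.sqrt t) - ellipticK (Real.sqrt t)) ^ 3 /
        (t * (1 - t)) ^ ((1:ℝ)/4)) = 48 * π ^ 6 / Real.Gamma (1/4) ^ 8 ∧
    (∫ x in (-1:ℝ)..1, (legendreP (1/2) (x : ℂ)) ^ 3 / ((1 - (x:ℂ) ^ 2) ^ ((1:ℂ)/4)))
      = ((384 * π ^ 3 / Real.Gamma (1/4) ^ 8 : ℝ) : ℂ) := by
  exact ⟨part1, part2⟩
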